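/- For every β ∈ [2,∞) there exist constants C_β > 0 and λ₀ ∈ (0,1/2) such that for all λ ∈ (0,λ₀) and all integers N ≥ 2, |log Z_{N,β}^λ − ( 2N log N + N( (2−β)(log λ)·1_{β>2} + (log|log λ|)·1_{β=2} + log 𝒵_β − 1 ) )| ≤ C_β (N ω_λ + log N). -/

import Mathlib

open MeasureTheory Real
open scoped ENNReal NNReal BigOperators Classical

noncomputable section

/-- The plane `ℝ²`. -/
abbrev E2 := EuclideanSpace ℝ (Fin 2)

/-- The logarithmic Coulomb kernel `g(x) = -log |x|`. -/
def gfun (x : E2) : ℝ := -Real.log ‖x‖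

/-- The uniform probability measure on the closed ball `B(z, lam)` (smeared charge). -/
def udisc (z : E2) (lam : ℝ) : MeasureTheory.Measure E2 :=
  (MeasureTheory.volume (Metric.closedBall z lam))⁻¹ •
    MeasureTheory.volume.restrict (Metric.closedBall z lam)

/-- The smeared interaction `g_lam(z) = ∬ g(x-y) dδ_0^{(lam)}(x) dδ_z^{(lam)}(y)`. -/
def gsm (lam : ℝ) (z : E2) : ℝ :=
  ∫ x, (∫ y, gfun (x - y) ∂(udisc z lam)) ∂(udisc 0 lam)

/-- `κ = g_1(0)`. -/
def kappa : ℝ := gsm 1 0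

/-- The (renormalized) energy `F_lam(X_N, Y_N)`. -/
def Flam (N : ℕ) (lam : ℝ) (X Y : Fin N → E2) : ℝ :=
  (1/2) * (∑ i : Fin N, ∑ j : Fin N,
      (gsm lam (X i - X j) + gsm lam (Y i - Y j) - 2 * gsm lam (X i - Y j)))
    - N * (-Real.log lam + kappa)

/-- The box `Λ = [0, √N]²`. -/
def LamBox (N : ℕ) : Set E2 := {x | ∀ i, x i ∈ Set.Icc (0:ℝ) (Real.sqrt N)}

/-- The configuration space `Λ^N × Λ^N`. -/
def confSet (N : ℕ) : Set ((Fin N → E2) × (Fin N → E2)) :=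
  {P | (∀ i, P.1 i ∈ LamBox N) ∧ (∀ i, P.2 i ∈ LamBox N)}

/-- The partition function `Z_{N,β}^{lam}`. -/
def Zpart (N : ℕ) (β lam : ℝ) : ℝ :=
  ∫ P in confSet N, Real.exp (-β * Flam N lam P.1 P.2)

/-- `g_1` evaluated at (any) point of norm `r` (it is radial). -/
def g1rad (r : ℝ) : ℝ := gsm 1 (EuclideanSpace.single (0 : Fin 2) r)

/-- The constant `𝒵_β`. -/
def Zbeta (β : ℝ) : ℝ :=
  if β = 2 then 2 * Real.pi
  else 2 * Real.pi * ∫ r in Set.Ioi (0:ℝ), Real.exp (β * g1rad r) * r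

/-- The error rate `ω_lam` (with `M₀ = 36`). -/
def omegaL (β lam : ℝ) : ℝ :=
  if β = 2 then |Real.log lam| ^ (-(1:ℝ)/(5+36))
  else if β < 4 then lam ^ ((2*(β-2))/(12-β+36))
  else if β = 4 then (lam * |Real.log lam|) ^ ((1:ℝ)/(2+36))
  else lam ^ ((1:ℝ)/(2+36))

/-! ### The law of the difference of two independent uniform points of the unit disc -/

lemma volume_closedBall_ne_zero (z : E2) {r : ℝ} (hr : 0 < r) :
    volume (Metric.closedBall z r) ≠ 0 :=
  (Metric.measure_closedBall_pos volume z hr).ne'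

lemma volume_closedBall_ne_top (z : E2) (r : ℝ) : volume (Metric.closedBall z r) ≠ ⊤ :=
  measure_closedBall_lt_top.ne

lemma volume_preimage_affine (z : E2) {lam : ℝ} (hlam : 0 < lam) (s : Set E2) :
    volume ((fun x : E2 => z + lam • x) ⁻¹' s) = ENNReal.ofReal (lam ^ 2)⁻¹ * volume s := by
  have h1 : (fun x : E2 => z + lam • x) ⁻¹' s = (fun x : E2 => lam • x) ⁻¹' ((fun x => z + x) ⁻¹' s) := rfl
  rw [h1, Measure.addHaar_preimage_smul _ hlam.ne', measure_preimage_add]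
  simp [abs_of_pos hlam]

lemma isProbabilityMeasure_udisc (z : E2) {lam : ℝ} (hlam : 0 < lam) :
    IsProbabilityMeasure (udisc z lam) := by
  constructor
  simp only [udisc, Measure.smul_apply, Measure.restrict_apply_univ, smul_eq_mul]
  exact ENNReal.inv_mul_cancel (volume_closedBall_ne_zero z hlam) (volume_closedBall_ne_top z lam)

/-- The uniform law on the closed unit disc. -/
def unitDiscLaw : Measure E2 := udisc 0 1

instance : IsProbabilityMeasure unitDiscLaw := isProbabilityMeasure_udisc 0 one_pos

lemma udisc_eq_map (z : E2) {lam : ℝ} (hlam : 0 < lam) :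
    udisc z lam = unitDiscLaw.map (fun x => z + lam • x) := by
  have hm : Measurable (fun x : E2 => z + lam • x) := by fun_prop
  have hball : (fun x : E2 => z + lam • x) ⁻¹' Metric.closedBall z lam = Metric.closedBall 0 1 := by
    ext x
    simp [norm_smul, abs_of_pos hlam, hlam]
  ext s hs
  rw [Measure.map_apply hm hs]
  simp only [unitDiscLaw, udisc, Measure.smul_apply, smul_eq_mul]
  rw [Measure.restrict_apply hs, Measure.restrict_apply (hm hs), ← hball, ← Set.preimage_inter,
    volume_preimage_affine z hlam, volume_preimage_affine z hlam, ENNReal.mul_inv, ENNReal.ofReal]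
  · rw [mul_mul_mul_comm, ENNReal.inv_mul_cancel, one_mul]
    · simpa using hlam.ne'
    · simp
  · right; exact volume_closedBall_ne_top z lam
  · right; exact volume_closedBall_ne_zero z hlam

/-- The law of the difference of two independent uniform points of the unit disc. -/
def diffLaw : Measure E2 := (unitDiscLaw.prod unitDiscLaw).map (fun p => p.2 - p.1)

instance : IsProbabilityMeasure diffLaw :=
  Measure.isProbabilityMeasure_map (by fun_prop)

lemma unitDiscLaw_le :
    unitDiscLaw ≤ (volume (Metric.closedBall (0 : E2) 1))⁻¹ • volume := by
  intro s
  simp only [unitDiscLaw, udisc, Measure.smul_apply, smul_eq_mul]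
  gcongr
  exact Measure.restrict_le_self

lemma unitDiscLaw_ae : ∀ᵐ x ∂unitDiscLaw, ‖x‖ ≤ 1 := by
  have h : ∀ᵐ x ∂(volume.restrict (Metric.closedBall (0 : E2) 1)), ‖x‖ ≤ 1 := by
    filter_upwards [ae_restrict_mem Metric.isClosed_closedBall.measurableSet] with x hx
    simpa using hx
  exact Measure.ae_smul_measure h _

lemma diffLaw_ae : ∀ᵐ x ∂diffLaw, ‖x‖ ≤ 2 := by
  rw [diffLaw, ae_map_iff (by fun_prop) (measurableSet_le (by fun_prop) (by fun_prop))]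
  have h1 : ∀ᵐ p ∂(unitDiscLaw.prod unitDiscLaw), ‖p.1‖ ≤ 1 :=
    Measure.quasiMeasurePreserving_fst.ae unitDiscLaw_ae
  have h2 : ∀ᵐ p ∂(unitDiscLaw.prod unitDiscLaw), ‖p.2‖ ≤ 1 :=
    Measure.quasiMeasurePreserving_snd.ae unitDiscLaw_ae
  filter_upwards [h1, h2] with p hp1 hp2
  calc ‖p.2 - p.1‖ ≤ ‖p.2‖ + ‖p.1‖ := norm_sub_le _ _
    _ ≤ 2 := by linarith

lemma diffLaw_le :
    diffLaw ≤ (volume (Metric.closedBall (0 : E2) 1))⁻¹ • volume := by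
  refine Measure.le_iff.2 fun s hs => ?_
  have hm : Measurable (fun p : E2 × E2 => p.2 - p.1) := by fun_prop
  rw [diffLaw, Measure.map_apply hm hs, Measure.prod_apply (hm hs)]
  calc ∫⁻ x, unitDiscLaw (Prod.mk x ⁻¹' ((fun p : E2 × E2 => p.2 - p.1) ⁻¹' s)) ∂unitDiscLaw
      ≤ ∫⁻ _x, ((volume (Metric.closedBall (0 : E2) 1))⁻¹ • (volume : Measure E2)) s
          ∂unitDiscLaw := by
        refine lintegral_mono fun x => ?_
        refine (unitDiscLaw_le _).trans (le_of_eq ?_)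
        simp only [Measure.smul_apply, smul_eq_mul]
        congr 1
        have : (Prod.mk x ⁻¹' ((fun p : E2 × E2 => p.2 - p.1) ⁻¹' s)) = (fun y => y - x) ⁻¹' s := rfl
        rw [this]
        simp only [sub_eq_add_neg]
        exact measure_preimage_add_right _ _ _
    _ = _ := by simp

lemma integrable_diffLaw_of_integrableOn {F : Type*} [NormedAddCommGroup F] {f : E2 → F} {r : ℝ}
    (hr : 2 ≤ r) (hf : IntegrableOn f (Metric.closedBall 0 r)) : Integrable f diffLaw := by
  have h1 : diffLaw.restrict (Metric.closedBall 0 r) = diffLaw := by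
    rw [Measure.restrict_eq_self_of_ae_mem]
    filter_upwards [diffLaw_ae] with x hx
    simpa using hx.trans hr
  rw [← h1]
  have h2 : diffLaw.restrict (Metric.closedBall 0 r) ≤
      (volume (Metric.closedBall (0 : E2) 1))⁻¹ • volume.restrict (Metric.closedBall 0 r) := by
    rw [← Measure.restrict_smul]
    exact Measure.restrict_mono le_rfl diffLaw_le
  refine Integrable.mono_measure ?_ h2
  exact hf.smul_measure (ENNReal.inv_ne_top.2 (volume_closedBall_ne_zero 0 one_pos))

lemma measurable_gfun : Measurable gfun := by
  unfold gfun; fun_prop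

lemma integrableOn_gfun_ball (r : ℝ) : IntegrableOn gfun (Metric.closedBall 0 r) := by
  have h1 : IntegrableOn (fun x : E2 => (fun t : ℝ => -Real.log t) ‖x‖) (Metric.ball 0 (r + 1)) := by
    refine (integrableOn_fun_norm_addHaar (F := ℝ) (f := fun t : ℝ => -Real.log t) (r := r + 1)
      (volume : Measure E2)).2 ?_
    simp only [finrank_euclideanSpace, Fintype.card_fin, smul_eq_mul]
    have hc : Continuous fun t : ℝ => t ^ (2 - 1) * -Real.log t := by
      have := Real.continuous_mul_log.neg
      refine this.congr fun t => ?_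
      simp
    exact (hc.integrableOn_Icc (a := 0) (b := r + 1)).mono_set Set.Ioo_subset_Icc_self
  exact h1.mono_set (Metric.closedBall_subset_ball (by linarith))

lemma integrableOn_gfun_affine (z : E2) {lam : ℝ} (hlam : 0 < lam) (r : ℝ) :
    IntegrableOn (fun x => gfun (z + lam • x)) (Metric.closedBall 0 r) := by
  have h0 := integrableOn_gfun_ball (‖z‖ + lam * r)
  rw [← integrable_indicator_iff Metric.isClosed_closedBall.measurableSet] at h0
  have h1 := (h0.comp_add_left z).comp_smul hlam.ne'
  have h2 := h1.integrableOn (s := Metric.closedBall 0 r)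
  refine h2.congr_fun (fun x hx => ?_) Metric.isClosed_closedBall.measurableSet
  simp only
  rw [Set.indicator_of_mem]
  simp only [Metric.mem_closedBall, dist_zero_right] at hx ⊢
  calc ‖z + lam • x‖ ≤ ‖z‖ + ‖lam • x‖ := norm_add_le _ _
    _ ≤ _ := by
      rw [norm_smul, Real.norm_of_nonneg hlam.le]; gcongr

lemma integrable_gfun_diffLaw (z : E2) {lam : ℝ} (hlam : 0 < lam) :
    Integrable (fun x => gfun (z + lam • x)) diffLaw :=
  integrable_diffLaw_of_integrableOn le_rfl (integrableOn_gfun_affine z hlam 2)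

lemma gfun_neg (x : E2) : gfun (-x) = gfun x := by simp [gfun]

lemma gsm_eq_integral_diffLaw {lam : ℝ} (hlam : 0 < lam) (z : E2) :
    gsm lam z = ∫ x, gfun (z + lam • x) ∂diffLaw := by
  have hm : Measurable fun x : E2 => gfun (z + lam • x) := measurable_gfun.comp (by fun_prop)
  have hmap := integrable_gfun_diffLaw z hlam
  rw [diffLaw, integrable_map_measure hm.aestronglyMeasurable (by fun_prop)] at hmap
  rw [diffLaw, integral_map (by fun_prop) hm.aestronglyMeasurable,
    integral_prod (fun p : E2 × E2 => gfun (z + lam • (p.2 - p.1))) hmap, gsm, udisc_eq_map 0 hlam, integral_map (by fun_prop)]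
  · refine integral_congr_ae (Filter.Eventually.of_forall fun x => ?_)
    simp only
    rw [udisc_eq_map z hlam, integral_map (by fun_prop)]
    · refine integral_congr_ae (Filter.Eventually.of_forall fun y => ?_)
      simp only
      rw [← gfun_neg]
      congr 1
      rw [smul_sub]; abel
    · exact (measurable_gfun.comp (by fun_prop)).aestronglyMeasurable
  · refine StronglyMeasurable.aestronglyMeasurable ?_
    have : IsProbabilityMeasure (udisc z lam) := isProbabilityMeasure_udisc z hlam
    have hg : Measurable fun p : E2 × E2 => gfun (p.1 - p.2) := measurable_gfun.comp (by fun_prop)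
    exact hg.stronglyMeasurable.integral_prod_right

lemma measurable_gsm {lam : ℝ} (hlam : 0 < lam) : Measurable (gsm lam) := by
  have h : gsm lam = fun z => ∫ x, gfun (z + lam • x) ∂diffLaw :=
    funext fun z => gsm_eq_integral_diffLaw hlam z
  rw [h]
  have : Measurable fun p : E2 × E2 => gfun (p.1 + lam • p.2) :=
    measurable_gfun.comp (by fun_prop)
  exact this.stronglyMeasurable.integral_prod_right.measurable

lemma map_linearIsometry_unitDiscLaw (L : E2 ≃ₗᵢ[ℝ] E2) : unitDiscLaw.map L = unitDiscLaw := by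
  have hv := L.measurePreserving
  ext s hs
  rw [Measure.map_apply L.continuous.measurable hs]
  simp only [unitDiscLaw, udisc, Measure.smul_apply, smul_eq_mul]
  rw [Measure.restrict_apply hs, Measure.restrict_apply (L.continuous.measurable hs)]
  have hb : Metric.closedBall (0 : E2) 1 = L ⁻¹' Metric.closedBall 0 1 := by
    ext x; simp
  conv_lhs => rw [hb, ← Set.preimage_inter]
  rw [← hb, hv.measure_preimage]
  exact (hs.inter Metric.isClosed_closedBall.measurableSet).nullMeasurableSet

lemma map_linearIsometry_diffLaw (L : E2 ≃ₗᵢ[ℝ] E2) : diffLaw.map L = diffLaw := by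
  have hL : Measurable L := L.continuous.measurable
  have h1 : (unitDiscLaw.prod unitDiscLaw).map (Prod.map L L) = unitDiscLaw.prod unitDiscLaw := by
    rw [← Measure.map_prod_map _ _ hL hL, map_linearIsometry_unitDiscLaw]
  conv_rhs => rw [diffLaw, ← h1]
  rw [diffLaw, Measure.map_map hL (by fun_prop), Measure.map_map (by fun_prop) (hL.prodMap hL)]
  congr 1
  ext1 p
  simp

lemma exists_linearIsometryEquiv_apply_eq {x y : E2} (h : ‖x‖ = ‖y‖) :
    ∃ L : E2 ≃ₗᵢ[ℝ] E2, L x = y :=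
  ⟨_, Submodule.reflection_sub h⟩

lemma gsm_radial {lam : ℝ} (hlam : 0 < lam) {x y : E2} (h : ‖x‖ = ‖y‖) : gsm lam x = gsm lam y := by
  obtain ⟨L, hL⟩ := exists_linearIsometryEquiv_apply_eq h
  rw [gsm_eq_integral_diffLaw hlam, gsm_eq_integral_diffLaw hlam, ← hL]
  conv_rhs => rw [← map_linearIsometry_diffLaw L]
  rw [integral_map L.continuous.aemeasurable]
  · refine integral_congr_ae (Filter.Eventually.of_forall fun z => ?_)
    simp only [gfun]
    rw [← map_smul, ← map_add, L.norm_map]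
  · exact (measurable_gfun.comp (by fun_prop)).aestronglyMeasurable

lemma gsm_neg {lam : ℝ} (hlam : 0 < lam) (x : E2) : gsm lam (-x) = gsm lam x :=
  gsm_radial hlam (norm_neg x)

lemma gsm_sub_comm {lam : ℝ} (hlam : 0 < lam) (x y : E2) : gsm lam (x - y) = gsm lam (y - x) := by
  rw [← gsm_neg hlam, neg_sub]

lemma gsm_one_eq_g1rad (x : E2) : gsm 1 x = g1rad ‖x‖ := by
  refine gsm_radial one_pos ?_
  simp

lemma diffLaw_singleton (x : E2) : diffLaw {x} = 0 := by
  refine le_antisymm ((diffLaw_le _).trans (by simp)) (zero_le)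

lemma gsm_eq_neg_log_add {lam : ℝ} (hlam : 0 < lam) (z : E2) :
    gsm lam z = -Real.log lam + gsm 1 (lam⁻¹ • z) := by
  rw [gsm_eq_integral_diffLaw hlam, gsm_eq_integral_diffLaw one_pos]
  have hi := integrable_gfun_diffLaw (lam⁻¹ • z) one_pos
  have : (-Real.log lam) = ∫ _x, (-Real.log lam) ∂diffLaw := by simp
  rw [this, ← integral_add (integrable_const _) hi]
  refine integral_congr_ae ?_
  have hae : ∀ᵐ x ∂diffLaw, x ≠ -(lam⁻¹ • z) := by
    rw [ae_iff]; simpa using diffLaw_singleton _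
  filter_upwards [hae] with x hx
  have h1 : z + lam • x = lam • (lam⁻¹ • z + (1 : ℝ) • x) := by
    rw [one_smul, smul_add, smul_inv_smul₀ hlam.ne']
  have h2 : lam⁻¹ • z + (1 : ℝ) • x ≠ 0 := by
    rw [one_smul]
    intro h
    exact hx (eq_neg_of_add_eq_zero_right h)
  simp only [gfun]
  rw [h1, norm_smul, Real.norm_of_nonneg hlam.le, Real.log_mul hlam.ne' (norm_ne_zero_iff.2 h2)]
  ring

lemma gsm_zero {lam : ℝ} (hlam : 0 < lam) : gsm lam 0 = -Real.log lam + kappa := by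
  rw [gsm_eq_neg_log_add hlam, smul_zero, kappa]

/-! ### A compactly supported positive definite radial kernel -/

/-- The tent function `x ↦ (1 - |x|)₊`. -/
def tent (x : E2) : ℝ := max 0 (1 - ‖x‖)

lemma continuous_tent : Continuous tent := by unfold tent; fun_prop

lemma tent_nonneg (x : E2) : 0 ≤ tent x := le_max_left _ _

lemma tent_eq_zero {x : E2} (h : 1 ≤ ‖x‖) : tent x = 0 := max_eq_left (by linarith)

lemma abs_tent_sub_le (x y : E2) : |tent x - tent y| ≤ ‖x - y‖ := by
  unfold tent
  have h := abs_max_sub_max_le_max 0 (1 - ‖x‖) 0 (1 - ‖y‖)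
  refine h.trans ?_
  have h2 : |1 - ‖x‖ - (1 - ‖y‖)| = |‖x‖ - ‖y‖| := by rw [abs_sub_comm]; congr 1; ring
  rw [h2]
  simpa using abs_norm_sub_norm_le x y

lemma hasCompactSupport_tent : HasCompactSupport tent :=
  HasCompactSupport.intro (isCompact_closedBall (0 : E2) 1) fun x hx => by
    simp only [Metric.mem_closedBall, dist_zero_right, not_le] at hx
    exact tent_eq_zero hx.le

lemma integrable_tent : Integrable tent :=
  continuous_tent.integrable_of_hasCompactSupport hasCompactSupport_tent

lemma integrable_tent_mul {f : E2 → ℝ} (hf : Continuous f) : Integrable fun w => tent w * f w :=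
  (continuous_tent.mul hf).integrable_of_hasCompactSupport hasCompactSupport_tent.mul_right

lemma integrable_tent_mul_tent (x : E2) : Integrable fun w => tent w * tent (x + w) :=
  integrable_tent_mul (continuous_tent.comp (by fun_prop))

/-- The squared `L²` norm of the tent function. -/
def tentSq : ℝ := ∫ w, tent w * tent w

lemma tentSq_pos : 0 < tentSq := by
  have hc : Continuous fun w : E2 => tent w * tent w := continuous_tent.mul continuous_tent
  refine hc.integral_pos_of_hasCompactSupport_nonneg_nonzero (hasCompactSupport_tent.mul_right)
    (fun w => mul_self_nonneg _) (x := 0) ?_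
  simp [tent]

/-- The normalised autocorrelation of the tent function. -/
def tentCorr (x : E2) : ℝ := (∫ w, tent w * tent (x + w)) / tentSq

lemma tentCorr_zero : tentCorr 0 = 1 := by
  simp only [tentCorr, zero_add]
  exact div_self tentSq_pos.ne'

lemma tentCorr_nonneg (x : E2) : 0 ≤ tentCorr x :=
  div_nonneg (integral_nonneg fun _ => mul_nonneg (tent_nonneg _) (tent_nonneg _)) tentSq_pos.le

lemma integral_tent_shift (x : E2) : ∫ w, tent (x + w) * tent (x + w) = tentSq :=
  integral_add_left_eq_self (fun w => tent w * tent w) x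

lemma integrable_tent_shift_mul (x y : E2) : Integrable fun w => tent (x + w) * tent (y + w) := by
  have h := (integrable_tent_mul_tent (y - x)).comp_add_left x
  refine h.congr (Filter.Eventually.of_forall fun w => ?_)
  simp only
  rw [← add_assoc, sub_add_cancel]

lemma integral_tent_shift_mul (x y : E2) :
    ∫ w, tent (x + w) * tent (y + w) = tentSq * tentCorr (y - x) := by
  have h := integral_add_left_eq_self (μ := volume) (fun w => tent w * tent (y - x + w)) x
  rw [tentCorr, mul_div_cancel₀ _ tentSq_pos.ne', ← h]
  refine integral_congr_ae (Filter.Eventually.of_forall fun w => ?_)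
  simp only
  rw [← add_assoc (y - x), sub_add_cancel]

lemma tentCorr_le_one (x : E2) : tentCorr x ≤ 1 := by
  rw [tentCorr, div_le_one tentSq_pos]
  have h1 := integrable_tent_shift_mul 0 0
  have h2 := integrable_tent_shift_mul x x
  simp only [zero_add] at h1
  calc ∫ w, tent w * tent (x + w)
      ≤ ∫ w, (1 / 2) * (tent w * tent w + tent (x + w) * tent (x + w)) := by
        refine integral_mono (integrable_tent_mul_tent x) ((h1.add h2).const_mul _) fun w => ?_
        simp only
        nlinarith [sq_nonneg (tent w - tent (x + w))]
    _ = tentSq := by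
        rw [integral_const_mul, integral_add h1 h2, integral_tent_shift]
        rw [← tentSq]; ring

lemma tentCorr_eq_zero {x : E2} (h : 2 ≤ ‖x‖) : tentCorr x = 0 := by
  have : ∀ w : E2, tent w * tent (x + w) = 0 := fun w => by
    by_cases hw : 1 ≤ ‖w‖
    · rw [tent_eq_zero hw, zero_mul]
    · rw [tent_eq_zero (x := x + w), mul_zero]
      have := norm_sub_norm_le x (-w)
      rw [norm_neg, sub_neg_eq_add] at this
      push Not at hw
      linarith
  simp [tentCorr, this]

/-- A Lipschitz constant for `tentCorr`. -/
def tentLip : ℝ := (∫ w, tent w) / tentSq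

lemma tentLip_nonneg : 0 ≤ tentLip :=
  div_nonneg (integral_nonneg tent_nonneg) tentSq_pos.le

lemma abs_tentCorr_sub_le (x y : E2) : |tentCorr x - tentCorr y| ≤ tentLip * ‖x - y‖ := by
  have hx := integrable_tent_mul_tent x
  have hy := integrable_tent_mul_tent y
  rw [tentCorr, tentCorr, ← sub_div, ← integral_sub hx hy, abs_div, abs_of_pos tentSq_pos, tentLip,
    div_mul_eq_mul_div]
  refine div_le_div_of_nonneg_right ?_ tentSq_pos.le
  rw [← integral_mul_const]
  refine (abs_integral_le_integral_abs).trans ?_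
  refine integral_mono (hx.sub hy).abs (integrable_tent.mul_const _) fun w => ?_
  simp only
  rw [← mul_sub, abs_mul, abs_of_nonneg (tent_nonneg w)]
  refine mul_le_mul_of_nonneg_left ?_ (tent_nonneg w)
  refine (abs_tent_sub_le _ _).trans (le_of_eq ?_)
  congr 1; abel

lemma continuous_tentCorr : Continuous tentCorr := by
  refine continuous_iff_continuousAt.2 fun x => ?_
  have h : Filter.Tendsto (fun y => tentLip * ‖y - x‖) (nhds x) (nhds 0) := by
    have : Continuous fun y : E2 => tentLip * ‖y - x‖ := by fun_prop
    simpa using this.tendsto x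
  refine tendsto_iff_dist_tendsto_zero.2 (squeeze_zero (fun _ => dist_nonneg) (fun y => ?_) h)
  rw [Real.dist_eq]
  exact abs_tentCorr_sub_le y x

lemma tentCorr_radial {x y : E2} (h : ‖x‖ = ‖y‖) : tentCorr x = tentCorr y := by
  obtain ⟨L, hL⟩ := exists_linearIsometryEquiv_apply_eq h
  rw [tentCorr, tentCorr, ← hL]
  congr 1
  conv_rhs => rw [← L.measurePreserving.integral_comp L.toHomeomorph.measurableEmbedding]
  refine integral_congr_ae (Filter.Eventually.of_forall fun w => ?_)
  simp only [tent]
  rw [← map_add, L.norm_map, L.norm_map]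

/-- The kernel `tentCorr` averaged over independent displacements of size `a` of both points. -/
def smearCorr (a : ℝ) (x : E2) : ℝ := ∫ z, tentCorr (x + a • z) ∂diffLaw

lemma integrable_tentCorr_diffLaw (a : ℝ) (x : E2) :
    Integrable (fun z => tentCorr (x + a • z)) diffLaw := by
  refine Integrable.of_bound (C := 1) ?_ (Filter.Eventually.of_forall fun z => ?_)
  · exact (continuous_tentCorr.comp (by fun_prop)).aestronglyMeasurable
  · rw [Real.norm_of_nonneg (tentCorr_nonneg _)]; exact tentCorr_le_one _

lemma smearCorr_nonneg (a : ℝ) (x : E2) : 0 ≤ smearCorr a x :=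
  integral_nonneg fun _ => tentCorr_nonneg _

lemma smearCorr_le_one (a : ℝ) (x : E2) : smearCorr a x ≤ 1 := by
  calc smearCorr a x ≤ ∫ _z, (1 : ℝ) ∂diffLaw :=
        integral_mono (integrable_tentCorr_diffLaw a x) (integrable_const _)
          fun z => tentCorr_le_one _
    _ = 1 := by simp

lemma abs_smearCorr_sub_le (a : ℝ) (x y : E2) :
    |smearCorr a x - smearCorr a y| ≤ tentLip * ‖x - y‖ := by
  rw [smearCorr, smearCorr,
    ← integral_sub (integrable_tentCorr_diffLaw a x) (integrable_tentCorr_diffLaw a y)]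
  refine abs_integral_le_integral_abs.trans ?_
  calc ∫ z, |tentCorr (x + a • z) - tentCorr (y + a • z)| ∂diffLaw
      ≤ ∫ _z, tentLip * ‖x - y‖ ∂diffLaw := by
        refine integral_mono ((integrable_tentCorr_diffLaw a x).sub
          (integrable_tentCorr_diffLaw a y)).abs (integrable_const _) fun z => ?_
        simpa using abs_tentCorr_sub_le (x + a • z) (y + a • z)
    _ = _ := by simp

lemma smearCorr_eq_zero {a : ℝ} (ha : 0 ≤ a) {x : E2} (h : 2 + 2 * a ≤ ‖x‖) : smearCorr a x = 0 := by
  rw [smearCorr, integral_eq_zero_of_ae]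
  filter_upwards [diffLaw_ae] with z hz
  refine tentCorr_eq_zero ?_
  have h1 := norm_sub_norm_le x (-(a • z))
  rw [norm_neg, sub_neg_eq_add, norm_smul, Real.norm_of_nonneg ha] at h1
  nlinarith

lemma smearCorr_neg (a : ℝ) (x : E2) : smearCorr a (-x) = smearCorr a x := by
  rw [smearCorr, smearCorr]
  conv_lhs => rw [← map_linearIsometry_diffLaw (LinearIsometryEquiv.neg ℝ)]
  have hm := integral_map (μ := diffLaw) (φ := LinearIsometryEquiv.neg ℝ)
    (f := fun z : E2 => tentCorr (-x + a • z))
    (LinearIsometryEquiv.neg ℝ).continuous.aemeasurable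
    (continuous_tentCorr.comp (by fun_prop)).aestronglyMeasurable
  refine hm.trans ?_
  refine integral_congr_ae (Filter.Eventually.of_forall fun z => ?_)
  refine tentCorr_radial ?_
  rw [← norm_neg]
  congr 1
  simp [add_comm]

/-- The tent function averaged over a displacement of size `a`. -/
def smearTent (a : ℝ) (x : E2) : ℝ := ∫ z, tent (x + a • z) ∂unitDiscLaw

lemma integral_smearTent_mul (a : ℝ) (x y : E2) :
    Integrable (fun w => smearTent a (x + w) * smearTent a (y + w)) ∧
    ∫ w, smearTent a (x + w) * smearTent a (y + w) = tentSq * smearCorr a (y - x) := by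
  let F : (E2 × E2) → E2 → ℝ := fun p w => tent (x + w + a • p.1) * tent (y + w + a • p.2)
  have hFc : Continuous (Function.uncurry F) := by
    have := continuous_tent
    simp only [F, Function.uncurry_def]
    fun_prop
  have hF1 : ∀ p, F p = fun w => tent (x + a • p.1 + w) * tent (y + a • p.2 + w) := fun p => by
    ext w; simp only [F]; rw [add_right_comm x, add_right_comm y]
  have hFi : ∀ p, ∫ w, F p w = tentSq * tentCorr (y - x + a • (p.2 - p.1)) := fun p => by
    rw [hF1, integral_tent_shift_mul, smul_sub]; congr 2; abel
  have hFn : ∀ p w, 0 ≤ F p w := fun p w => mul_nonneg (tent_nonneg _) (tent_nonneg _)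
  have hFI : Integrable (Function.uncurry F) ((unitDiscLaw.prod unitDiscLaw).prod volume) := by
    rw [integrable_prod_iff hFc.aestronglyMeasurable]
    refine ⟨Filter.Eventually.of_forall fun p => ?_, ?_⟩
    · simp only [Function.uncurry_apply_pair]
      have := integrable_tent_shift_mul (x + a • p.1) (y + a • p.2)
      rw [← hF1] at this
      exact this
    · simp only [Function.uncurry_apply_pair, Real.norm_of_nonneg (hFn _ _), hFi]
      refine Integrable.of_bound (C := tentSq) ?_ (Filter.Eventually.of_forall fun p => ?_)
      · have := continuous_tentCorr
        exact Continuous.aestronglyMeasurable (by fun_prop)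
      · rw [Real.norm_of_nonneg (mul_nonneg tentSq_pos.le (tentCorr_nonneg _))]
        exact mul_le_of_le_one_right tentSq_pos.le (tentCorr_le_one _)
  have hsw : ∀ w, ∫ p, F p w ∂(unitDiscLaw.prod unitDiscLaw) =
      smearTent a (x + w) * smearTent a (y + w) := fun w => by
    simp only [F, smearTent]
    exact integral_prod_mul (fun z => tent (x + w + a • z)) (fun z => tent (y + w + a • z))
  constructor
  · have := hFI.integral_prod_right
    simpa only [Function.uncurry_apply_pair, hsw] using this
  · have := integral_integral_swap hFI
    simp only [hsw, hFi] at this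
    rw [← this, integral_const_mul, smearCorr, diffLaw, integral_map (by fun_prop)]
    exact (continuous_tentCorr.comp (by fun_prop)).aestronglyMeasurable

lemma smearCorr_posDef {ι : Type*} [Fintype ι] (a : ℝ) (p : ι → E2) (c : ι → ℝ) :
    0 ≤ ∑ i, ∑ j, c i * c j * smearCorr a (p i - p j) := by
  have h : tentSq * ∑ i, ∑ j, c i * c j * smearCorr a (p i - p j) =
      ∫ w, (∑ i, c i * smearTent a (p i + w)) ^ 2 := by
    have h1 : ∀ w, (∑ i, c i * smearTent a (p i + w)) ^ 2 =
        ∑ i, ∑ j, c i * c j * (smearTent a (p j + w) * smearTent a (p i + w)) := fun w => by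
      rw [sq, Finset.sum_mul_sum]
      refine Finset.sum_congr rfl fun i _ => Finset.sum_congr rfl fun j _ => by ring
    simp only [h1]
    rw [integral_finsetSum _ fun i _ => integrable_finsetSum _ fun j _ =>
      ((integral_smearTent_mul a (p j) (p i)).1.const_mul _), Finset.mul_sum]
    refine Finset.sum_congr rfl fun i _ => ?_
    rw [integral_finsetSum _ fun j _ =>
      ((integral_smearTent_mul a (p j) (p i)).1.const_mul _), Finset.mul_sum]
    refine Finset.sum_congr rfl fun j _ => ?_
    rw [integral_const_mul, (integral_smearTent_mul a (p j) (p i)).2]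
    ring
  have h2 : 0 ≤ tentSq * ∑ i, ∑ j, c i * c j * smearCorr a (p i - p j) := by
    rw [h]; exact integral_nonneg fun w => sq_nonneg _
  exact nonneg_of_mul_nonneg_right h2 tentSq_pos

/-! ### The logarithm as a superposition of positive definite kernels -/

/-- The indicator of `[a, ∞)`. -/
def step (a t : ℝ) : ℝ := if a ≤ t then 1 else 0

lemma step_nonneg (a t : ℝ) : 0 ≤ step a t := by unfold step; split_ifs <;> norm_num

lemma step_le_one (a t : ℝ) : step a t ≤ 1 := by unfold step; split_ifs <;> norm_num

lemma measurable_step (a : ℝ) : Measurable (step a) :=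
  Measurable.ite measurableSet_Ici measurable_const measurable_const

lemma integral_step_sub_step_of_le {a b : ℝ} (ha : 0 < a) (hab : a ≤ b) :
    IntegrableOn (fun t => (step a t - step b t) / t) (Set.Ioi 0) ∧
    ∫ t in Set.Ioi (0 : ℝ), (step a t - step b t) / t = Real.log b - Real.log a := by
  have h1 : (fun t => (step a t - step b t) / t) = (Set.Ico a b).indicator fun t => 1 / t := by
    ext t
    by_cases h : t ∈ Set.Ico a b
    · rw [Set.indicator_of_mem h, step, step, if_pos h.1, if_neg (not_le.2 h.2), sub_zero]
    · rw [Set.indicator_of_notMem h, step, step]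
      by_cases h2 : a ≤ t
      · have : b ≤ t := by by_contra h3; exact h ⟨h2, not_le.1 h3⟩
        simp [h2, this]
      · have : ¬ b ≤ t := fun h3 => h2 (hab.trans h3)
        simp [h2, this]
  have h2 : Set.Ioi (0 : ℝ) ∩ Set.Ico a b = Set.Ico a b :=
    Set.inter_eq_right.2 fun t ht => ha.trans_le ht.1
  have h0 : (0 : ℝ) ∉ Set.uIcc a b := by
    rw [Set.uIcc_of_le hab]; exact fun h => absurd h.1 (not_le.2 ha)
  have h3 := intervalIntegral.intervalIntegrable_one_div (a := a) (b := b) (μ := volume)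
    (f := fun t : ℝ => t) (fun x hx h => h0 (h ▸ hx)) continuousOn_id
  rw [intervalIntegrable_iff_integrableOn_Ico_of_le hab] at h3
  rw [h1]
  constructor
  · exact (h3.integrable_indicator measurableSet_Ico).integrableOn
  · rw [setIntegral_indicator measurableSet_Ico, h2, integral_Ico_eq_integral_Ioc,
      ← intervalIntegral.integral_of_le hab, integral_one_div h0, Real.log_div
      (ha.trans_le hab).ne' ha.ne']

lemma integral_step_sub_step {a b : ℝ} (ha : 0 < a) (hb : 0 < b) :
    IntegrableOn (fun t => (step a t - step b t) / t) (Set.Ioi 0) ∧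
    ∫ t in Set.Ioi (0 : ℝ), (step a t - step b t) / t = Real.log b - Real.log a := by
  rcases le_total a b with h | h
  · exact integral_step_sub_step_of_le ha h
  · obtain ⟨h1, h2⟩ := integral_step_sub_step_of_le hb h
    have h3 : (fun t => (step a t - step b t) / t) = fun t => -((step b t - step a t) / t) := by
      ext t; ring
    rw [h3]
    refine ⟨h1.neg, ?_⟩
    rw [integral_neg, h2]; ring

lemma integral_indicator_Ici_inv_sq {r : ℝ} (hr : 0 < r) :
    IntegrableOn ((Set.Ici r).indicator fun t : ℝ => (t ^ 2)⁻¹) (Set.Ioi 0) ∧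
    ∫ t in Set.Ioi (0 : ℝ), (Set.Ici r).indicator (fun t : ℝ => (t ^ 2)⁻¹) t = r⁻¹ := by
  have h2 : Set.Ioi (0 : ℝ) ∩ Set.Ici r = Set.Ici r :=
    Set.inter_eq_right.2 fun t ht => hr.trans_le ht
  have h3 : ∀ t : ℝ, (t ^ 2)⁻¹ = t ^ (-2 : ℝ) := fun t => by
    rw [Real.rpow_neg_ofNat]; simp [zpow_neg]
  have hi : IntegrableOn (fun t : ℝ => (t ^ 2)⁻¹) (Set.Ici r) := by
    simp only [h3]
    rw [integrableOn_Ici_iff_integrableOn_Ioi]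
    exact integrableOn_Ioi_rpow_of_lt (by norm_num) hr
  constructor
  · exact (hi.integrable_indicator measurableSet_Ici).integrableOn
  · rw [setIntegral_indicator measurableSet_Ici, h2, integral_Ici_eq_integral_Ioi]
    simp only [h3]
    rw [integral_Ioi_rpow_of_lt (by norm_num) hr]
    norm_num
    rw [Real.rpow_neg_one]

/-- The scale-`t` component of `-log ‖x‖`, renormalised at large scales. -/
def scaleKernel (x : E2) (t : ℝ) : ℝ := (tentCorr (t⁻¹ • x) - step 1 t) / t

lemma measurable_scaleKernel {α : Type*} [MeasurableSpace α] {f : α → E2} {g : α → ℝ}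
    (hf : Measurable f) (hg : Measurable g) : Measurable fun a => scaleKernel (f a) (g a) := by
  unfold scaleKernel
  have h1 : Measurable fun a => tentCorr ((g a)⁻¹ • f a) :=
    continuous_tentCorr.measurable.comp (hg.inv.smul hf)
  exact (h1.sub ((measurable_step 1).comp hg)).div hg

lemma one_sub_tentCorr_le (x : E2) : 1 - tentCorr x ≤ tentLip * ‖x‖ := by
  have := abs_tentCorr_sub_le 0 x
  rw [tentCorr_zero, zero_sub, norm_neg] at this
  exact (le_abs_self _).trans this

lemma abs_scaleKernel_le_add (x : E2) {t : ℝ} (ht : 0 < t) :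
    |scaleKernel x t| ≤ scaleKernel x t +
      2 * (tentLip * ‖x‖) * (Set.Ici 1).indicator (fun t : ℝ => (t ^ 2)⁻¹) t := by
  by_cases h : 1 ≤ t
  · rw [Set.indicator_of_mem (by exact h)]
    have h1 := one_sub_tentCorr_le (t⁻¹ • x)
    rw [norm_smul, Real.norm_of_nonneg (inv_nonneg.2 ht.le)] at h1
    have h2 : -scaleKernel x t ≤ tentLip * ‖x‖ * (t ^ 2)⁻¹ := by
      have : tentLip * ‖x‖ * (t ^ 2)⁻¹ = (tentLip * (t⁻¹ * ‖x‖)) / t := by field_simp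
      rw [this, scaleKernel, ← neg_div, step, if_pos h]
      gcongr
      linarith
    have h3 : scaleKernel x t ≤ 0 := by
      rw [scaleKernel, step, if_pos h]
      exact div_nonpos_of_nonpos_of_nonneg (by linarith [tentCorr_le_one (t⁻¹ • x)]) ht.le
    rw [abs_of_nonpos h3]
    linarith
  · rw [Set.indicator_of_notMem (by exact h), mul_zero, add_zero, abs_of_nonneg]
    rw [scaleKernel, step, if_neg h, sub_zero]
    exact div_nonneg (tentCorr_nonneg _) ht.le

lemma integrableOn_scaleKernel {x : E2} (hx : x ≠ 0) :
    IntegrableOn (scaleKernel x) (Set.Ioi 0) := by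
  have hx' : 0 < ‖x‖ := norm_pos_iff.2 hx
  have hb : IntegrableOn (fun t : ℝ => (tentLip * ‖x‖) * (Set.Ici 1).indicator
      (fun t : ℝ => (t ^ 2)⁻¹) t + (Set.Ioo 0 1).indicator (fun _ => 2 / ‖x‖) t) (Set.Ioi 0) := by
    refine ((integral_indicator_Ici_inv_sq one_pos).1.const_mul _).add ?_
    refine (IntegrableOn.integrable_indicator ?_ measurableSet_Ioo).integrableOn
    exact integrableOn_const (by simp)
  refine Integrable.mono' hb
    (measurable_scaleKernel measurable_const measurable_id).aestronglyMeasurable ?_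
  filter_upwards [ae_restrict_mem measurableSet_Ioi] with t (ht : 0 < t)
  by_cases h : 1 ≤ t
  · have h1 := abs_scaleKernel_le_add x ht
    have h3 : scaleKernel x t ≤ 0 := by
      rw [scaleKernel, step, if_pos h]
      exact div_nonpos_of_nonpos_of_nonneg (by linarith [tentCorr_le_one (t⁻¹ • x)]) ht.le
    rw [Set.indicator_of_mem (by exact h)] at h1 ⊢
    rw [Set.indicator_of_notMem (by exact fun h' => absurd h (not_le.2 h'.2)), Real.norm_eq_abs]
    rw [abs_of_nonpos h3] at h1 ⊢
    linarith
  · rw [Set.indicator_of_notMem (by exact h), Set.indicator_of_mem (show t ∈ Set.Ioo 0 1 from ⟨ht, not_le.1 h⟩),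
      mul_zero, zero_add, scaleKernel, step, if_neg h, sub_zero,
      Real.norm_of_nonneg (div_nonneg (tentCorr_nonneg _) ht.le)]
    by_cases h2 : ‖x‖ / 2 ≤ t
    · rw [div_le_div_iff₀ ht hx']
      nlinarith [tentCorr_le_one (t⁻¹ • x)]
    · rw [tentCorr_eq_zero, zero_div]
      · positivity
      · rw [norm_smul, Real.norm_of_nonneg (inv_nonneg.2 ht.le), inv_mul_eq_div, le_div_iff₀ ht]
        linarith

/-- The constant by which the superposition of kernels differs from `-log`. -/
def logShift : ℝ := ∫ t in Set.Ioi (0 : ℝ), scaleKernel (EuclideanSpace.single (0 : Fin 2) 1) t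

lemma integral_scaleKernel {x : E2} (hx : x ≠ 0) :
    ∫ t in Set.Ioi (0 : ℝ), scaleKernel x t = logShift + gfun x := by
  have hx' : 0 < ‖x‖ := norm_pos_iff.2 hx
  set e : E2 := EuclideanSpace.single (0 : Fin 2) 1 with he
  have he0 : e ≠ 0 := by
    rw [← norm_ne_zero_iff, he]; simp
  have h1 : ∀ t ∈ Set.Ioi (0 : ℝ), scaleKernel x (‖x‖ * t) * ‖x‖ =
      scaleKernel e t + (step 1 t - step ‖x‖⁻¹ t) / t := fun t ht => by
    have ht : 0 < t := ht
    have h2 : tentCorr ((‖x‖ * t)⁻¹ • x) = tentCorr (t⁻¹ • e) := by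
      refine tentCorr_radial ?_
      rw [norm_smul, norm_smul, he]
      simp only [norm_inv, norm_mul, norm_norm, PiLp.norm_single, norm_one, mul_one]
      field_simp
    have h3 : step 1 (‖x‖ * t) = step ‖x‖⁻¹ t := by
      unfold step
      congr 1
      rw [eq_iff_iff, inv_le_iff_one_le_mul₀ hx', mul_comm]
    rw [scaleKernel, scaleKernel, h2, h3]
    field_simp
    ring
  have h4 := integral_comp_mul_left_Ioi (fun t => scaleKernel x t) 0 hx'
  rw [mul_zero] at h4
  have h5 := integral_step_sub_step one_pos (inv_pos.2 hx')
  have h6 : ∫ t in Set.Ioi (0 : ℝ), scaleKernel x (‖x‖ * t) * ‖x‖ =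
      logShift + gfun x := by
    rw [setIntegral_congr_fun measurableSet_Ioi h1, integral_add (integrableOn_scaleKernel he0) h5.1,
      h5.2, logShift, gfun, Real.log_inv, Real.log_one, sub_zero]
  rw [integral_mul_const, h4, smul_eq_mul, mul_comm _ ‖x‖, mul_inv_cancel_left₀ hx'.ne'] at h6
  exact h6

/-- The scale-`t` component of the smeared interaction. -/
def smearScale (lam t : ℝ) (z : E2) : ℝ := smearCorr (lam / t) (t⁻¹ • z)

lemma smearScale_nonneg (lam t : ℝ) (z : E2) : 0 ≤ smearScale lam t z := smearCorr_nonneg _ _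

lemma smearScale_le_one (lam t : ℝ) (z : E2) : smearScale lam t z ≤ 1 := smearCorr_le_one _ _

lemma smearScale_eq_zero {lam t : ℝ} (hlam : 0 < lam) (ht : 0 < t) {z : E2}
    (h : 2 * t + 2 * lam ≤ ‖z‖) : smearScale lam t z = 0 := by
  refine smearCorr_eq_zero (by positivity) ?_
  rw [norm_smul, Real.norm_of_nonneg (inv_nonneg.2 ht.le), inv_mul_eq_div, le_div_iff₀ ht]
  have : (2 + 2 * (lam / t)) * t = 2 * t + 2 * lam := by field_simp
  linarith

lemma smearScale_zero_sub_le (lam : ℝ) {t : ℝ} (ht : 0 < t) (z : E2) :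
    smearScale lam t 0 - smearScale lam t z ≤ tentLip * ‖z‖ / t := by
  have := abs_smearCorr_sub_le (lam / t) (t⁻¹ • (0 : E2)) (t⁻¹ • z)
  rw [← smul_sub, norm_smul, zero_sub, norm_neg, Real.norm_of_nonneg (inv_nonneg.2 ht.le)] at this
  refine (le_abs_self _).trans (this.trans (le_of_eq ?_))
  field_simp

lemma smearScale_posDef {ι : Type*} [Fintype ι] (lam t : ℝ) (p : ι → E2) (c : ι → ℝ) :
    0 ≤ ∑ i, ∑ j, c i * c j * smearScale lam t (p i - p j) := by
  simpa only [smearScale, smul_sub] using smearCorr_posDef (lam / t) (fun i => t⁻¹ • p i) c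

/-- The scale decomposition of the smeared interaction, up to an additive constant. -/
lemma integral_smearScale {lam : ℝ} (hlam : 0 < lam) (z : E2) :
    IntegrableOn (fun t => (smearScale lam t z - step 1 t) / t) (Set.Ioi 0) ∧
    ∫ t in Set.Ioi (0 : ℝ), (smearScale lam t z - step 1 t) / t = logShift + gsm lam z := by
  set ν : Measure ℝ := volume.restrict (Set.Ioi (0 : ℝ)) with hν
  set K : E2 → ℝ → ℝ := fun w t => scaleKernel (z + lam • w) t with hK
  have hne : ∀ᵐ w ∂diffLaw, z + lam • w ≠ 0 := by
    have : ∀ᵐ w ∂diffLaw, w ∉ ({(-lam⁻¹) • z} : Set E2) :=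
      measure_eq_zero_iff_ae_notMem.1 (diffLaw_singleton _)
    filter_upwards [this] with w hw h0
    refine hw ?_
    have : lam • w = -z := by rw [← add_eq_zero_iff_eq_neg, add_comm]; exact h0
    rw [Set.mem_singleton_iff, neg_smul, ← smul_neg, ← this, smul_smul, inv_mul_cancel₀ hlam.ne',
      one_smul]
  have hmeas : Measurable (Function.uncurry K) := by
    have h1 : Measurable fun p : E2 × ℝ => z + lam • p.1 := by fun_prop
    have h2 : Measurable fun p : E2 × ℝ => scaleKernel (z + lam • p.1) p.2 :=
      measurable_scaleKernel h1 measurable_snd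
    exact h2
  have hKI : Integrable (Function.uncurry K) (diffLaw.prod ν) := by
    rw [integrable_prod_iff hmeas.aestronglyMeasurable]
    constructor
    · filter_upwards [hne] with w hw
      have h1 : Integrable (scaleKernel (z + lam • w)) ν := integrableOn_scaleKernel hw
      exact h1
    · have hdom : Integrable (fun w => logShift + gfun (z + lam • w) +
          2 * (tentLip * ‖z + lam • w‖)) diffLaw := by
        refine ((integrable_const _).add (integrable_gfun_diffLaw z hlam)).add ?_
        have hc : Continuous fun w : E2 => 2 * (tentLip * ‖z + lam • w‖) := by fun_prop
        exact integrable_diffLaw_of_integrableOn le_rfl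
          (hc.continuousOn.integrableOn_compact (isCompact_closedBall _ _))
      refine hdom.mono' (hmeas.stronglyMeasurable.norm.integral_prod_right.aestronglyMeasurable) ?_
      filter_upwards [hne] with w hw
      rw [Real.norm_of_nonneg (integral_nonneg fun _ => norm_nonneg _)]
      have hi := integral_indicator_Ici_inv_sq one_pos
      have h1 : ∫ t, ‖K w t‖ ∂ν ≤ ∫ t, (K w t + 2 * (tentLip * ‖z + lam • w‖) *
          (Set.Ici 1).indicator (fun t : ℝ => (t ^ 2)⁻¹) t) ∂ν := by
        refine integral_mono_ae (integrableOn_scaleKernel hw).norm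
          ((integrableOn_scaleKernel hw).add (hi.1.const_mul _)) ?_
        filter_upwards [ae_restrict_mem measurableSet_Ioi] with t ht
        exact abs_scaleKernel_le_add _ ht
      refine h1.trans (le_of_eq ?_)
      rw [integral_add (integrableOn_scaleKernel hw) (hi.1.const_mul _), integral_const_mul, hi.2,
        integral_scaleKernel hw, inv_one, mul_one]
  have hsw : ∀ t, 0 < t → ∫ w, K w t ∂diffLaw = (smearScale lam t z - step 1 t) / t := by
    intro t ht
    simp only [hK, scaleKernel]
    have h1 : ∀ w : E2, t⁻¹ • (z + lam • w) = t⁻¹ • z + (lam / t) • w := fun w => by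
      rw [smul_add, smul_smul, inv_mul_eq_div]
    simp only [h1]
    rw [integral_div, integral_sub (integrable_tentCorr_diffLaw _ _) (integrable_const _), smearScale,
      smearCorr]
    simp
  constructor
  · refine hKI.integral_prod_right.congr ?_
    filter_upwards [ae_restrict_mem measurableSet_Ioi] with t ht using hsw t ht
  · have h1 := integral_integral_swap hKI
    have h2 : ∫ t in Set.Ioi (0 : ℝ), (smearScale lam t z - step 1 t) / t =
        ∫ t, ∫ w, K w t ∂diffLaw ∂ν :=
      setIntegral_congr_fun measurableSet_Ioi fun t ht => (hsw t ht).symm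
    rw [h2, ← h1, gsm_eq_integral_diffLaw hlam]
    have h3 : ∫ w, ∫ t, K w t ∂ν ∂diffLaw = ∫ w, (logShift + gfun (z + lam • w)) ∂diffLaw := by
      refine integral_congr_ae ?_
      filter_upwards [hne] with w hw using integral_scaleKernel hw
    rw [h3, integral_add (integrable_const _) (integrable_gfun_diffLaw z hlam)]
    simp

/-! ### A lower bound for the energy by positive definiteness -/

lemma smearScale_sub_comm (lam t : ℝ) (x y : E2) :
    smearScale lam t (x - y) = smearScale lam t (y - x) := by
  rw [smearScale, smearScale, ← smearCorr_neg, ← smul_neg, neg_sub]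

/-- The contribution to the energy bound of a charge smeared up to scale `η`. -/
def chargeCost (lam η : ℝ) : ℝ := if η = 0 then gsm lam 0 else -logShift - Real.log η

lemma sum_truncated_smearScale_nonneg {N : ℕ} (lam t : ℝ) (X Y : Fin N → E2) (a b : Fin N → ℝ) :
    0 ≤ ∑ i, ∑ j, (a i * a j * smearScale lam t (X i - X j) +
      b i * b j * smearScale lam t (Y i - Y j) - 2 * (a i * b j * smearScale lam t (X i - Y j))) := by
  have h := smearScale_posDef lam t (Sum.elim X Y) (Sum.elim a (fun i => -b i))
  simp only [Fintype.sum_sum_type, Sum.elim_inl, Sum.elim_inr] at h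
  have h1 : ∑ i, ∑ j, -b i * a j * smearScale lam t (Y i - X j) =
      ∑ i, ∑ j, a i * -b j * smearScale lam t (X i - Y j) := by
    rw [Finset.sum_comm]
    refine Finset.sum_congr rfl fun i _ => Finset.sum_congr rfl fun j _ => ?_
    rw [smearScale_sub_comm]; ring
  simp only [Finset.sum_add_distrib, h1] at h
  refine h.trans (le_of_eq ?_)
  simp only [Finset.sum_sub_distrib, Finset.sum_add_distrib, ← Finset.mul_sum]
  have h2 : ∑ i, ∑ j, a i * -b j * smearScale lam t (X i - Y j) =
      -∑ i, ∑ j, a i * b j * smearScale lam t (X i - Y j) := by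
    rw [← Finset.sum_neg_distrib]
    refine Finset.sum_congr rfl fun i _ => ?_
    rw [← Finset.sum_neg_distrib]
    refine Finset.sum_congr rfl fun j _ => by ring
  have h3 : ∑ i, ∑ j, -b i * -b j * smearScale lam t (Y i - Y j) =
      ∑ i, ∑ j, b i * b j * smearScale lam t (Y i - Y j) := by
    refine Finset.sum_congr rfl fun i _ => Finset.sum_congr rfl fun j _ => by ring
  rw [h2, h3]; ring

lemma sum_smearScale_ge {N : ℕ} {lam t : ℝ} (hlam : 0 < lam) (ht : 0 < t) (X Y : Fin N → E2)
    (P : Finset (Fin N)) (u v : Fin N → ℝ) (r : ℝ)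
    (hsep : ∀ i j, (i ≠ j ∨ i ∉ P) → (0 < u i → 2 * u i + 2 * lam ≤ ‖X i - Y j‖) ∧
      (0 < v j → 2 * v j + 2 * lam ≤ ‖X i - Y j‖))
    (hP : ∀ i ∈ P, u i = r ∧ v i = r) :
    ∑ i, (if i ∈ P then 2 * ((1 - step r t) * (smearScale lam t 0 - smearScale lam t (X i - Y i)))
      else (1 - step (u i) t) * smearScale lam t 0 + (1 - step (v i) t) * smearScale lam t 0) ≤
    ∑ i, ∑ j, (smearScale lam t (X i - X j) + smearScale lam t (Y i - Y j) -
      2 * smearScale lam t (X i - Y j)) := by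
  have h0 := sum_truncated_smearScale_nonneg lam t X Y (fun i => step (u i) t) (fun i => step (v i) t)
  have key : ∑ i, ∑ j, (if i = j then (if i ∈ P then
      2 * ((1 - step r t) * (smearScale lam t 0 - smearScale lam t (X i - Y i)))
      else (1 - step (u i) t) * smearScale lam t 0 + (1 - step (v i) t) * smearScale lam t 0)
      else 0) ≤
    ∑ i, ∑ j, ((smearScale lam t (X i - X j) + smearScale lam t (Y i - Y j) -
      2 * smearScale lam t (X i - Y j)) -
      (step (u i) t * step (u j) t * smearScale lam t (X i - X j) +
      step (v i) t * step (v j) t * smearScale lam t (Y i - Y j) -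
      2 * (step (u i) t * step (v j) t * smearScale lam t (X i - Y j)))) := by
    refine Finset.sum_le_sum fun i _ => Finset.sum_le_sum fun j _ => ?_
    have hsq : ∀ a : ℝ, step a t * step a t = step a t := fun a => by
      unfold step; split_ifs <;> norm_num
    have hcross : (i ≠ j ∨ i ∉ P) →
        step (u i) t * step (v j) t * smearScale lam t (X i - Y j) = smearScale lam t (X i - Y j) := by
      intro hij
      obtain ⟨h1, h2⟩ := hsep i j hij
      by_cases hz : smearScale lam t (X i - Y j) = 0
      · rw [hz, mul_zero]
      · have h3 : ‖X i - Y j‖ < 2 * t + 2 * lam := by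
          by_contra h; exact hz (smearScale_eq_zero hlam ht (not_lt.1 h))
        have h4 : u i ≤ t := by
          by_contra h
          have := h1 (ht.trans (not_le.1 h)); linarith
        have h5 : v j ≤ t := by
          by_contra h
          have := h2 (ht.trans (not_le.1 h)); linarith
        simp [step, h4, h5]
    by_cases hij : i = j
    · subst hij
      rw [if_pos rfl, sub_self, sub_self, hsq, hsq]
      by_cases hi : i ∈ P
      · rw [if_pos hi, (hP i hi).1, (hP i hi).2, hsq]
        exact le_of_eq (by ring)
      · rw [if_neg hi, hcross (Or.inr hi)]
        exact le_of_eq (by ring)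
    · rw [if_neg hij, hcross (Or.inl hij)]
      have hle : ∀ a b z, step a t * step b t * smearScale lam t z ≤ smearScale lam t z :=
        fun a b z => mul_le_of_le_one_left (smearScale_nonneg _ _ _)
          (mul_le_one₀ (step_le_one _ _) (step_nonneg _ _) (step_le_one _ _))
      have h1 := hle (u i) (u j) (X i - X j)
      have h2 := hle (v i) (v j) (Y i - Y j)
      linarith
  simp only [Finset.sum_ite_eq, Finset.mem_univ, if_true] at key
  refine key.trans ?_
  simp only [Finset.sum_sub_distrib] at h0 ⊢
  linarith

lemma integral_truncated_self {lam : ℝ} (hlam : 0 < lam) {η : ℝ} (hη : 0 ≤ η) :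
    ∃ m : ℝ → ℝ, IntegrableOn m (Set.Ioi 0) ∧
      ∫ t in Set.Ioi (0 : ℝ), m t = gsm lam 0 - chargeCost lam η ∧
      ∀ t, 0 < t → m t ≤ (1 - step η t) * smearScale lam t 0 / t := by
  by_cases h : η = 0
  · refine ⟨fun _ => 0, integrableOn_zero, ?_, fun t ht => ?_⟩
    · simp [chargeCost, h]
    · simp [step, h, ht.le]
  · have hη' : 0 < η := lt_of_le_of_ne hη (Ne.symm h)
    obtain ⟨h1, h2⟩ := integral_smearScale hlam 0
    obtain ⟨h3, h4⟩ := integral_step_sub_step hη' one_pos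
    refine ⟨_, h1.sub h3, ?_, fun t ht => ?_⟩
    · simp only [Pi.sub_apply]
      rw [integral_sub h1 h3, h2, h4, chargeCost, if_neg h, Real.log_one]
      ring
    · simp only [Pi.sub_apply]
      rw [← sub_div]
      gcongr
      have := smearScale_le_one lam t 0
      have := smearScale_nonneg lam t 0
      have : step η t = 0 ∨ step η t = 1 := by unfold step; split_ifs <;> simp
      rcases this with h | h <;> rw [h] <;> linarith

lemma integral_truncated_dipole {lam : ℝ} (hlam : 0 < lam) {r : ℝ} (hr : 0 < r) (z : E2) :
    ∃ m : ℝ → ℝ, IntegrableOn m (Set.Ioi 0) ∧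
      ∫ t in Set.Ioi (0 : ℝ), m t = gsm lam 0 - gsm lam z - tentLip * ‖z‖ / r ∧
      ∀ t, 0 < t → m t ≤ (1 - step r t) * (smearScale lam t 0 - smearScale lam t z) / t := by
  obtain ⟨h1, h2⟩ := integral_smearScale hlam 0
  obtain ⟨h3, h4⟩ := integral_smearScale hlam z
  obtain ⟨h5, h6⟩ := integral_indicator_Ici_inv_sq hr
  refine ⟨_, (h1.sub h3).sub (h5.const_mul (tentLip * ‖z‖)), ?_, fun t ht => ?_⟩
  · simp only [Pi.sub_apply]
    have h7 := integral_sub (h1.sub h3) (h5.const_mul (tentLip * ‖z‖))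
    have h8 := integral_sub h1 h3
    simp only [Pi.sub_apply] at h7
    rw [h7, h8, integral_const_mul, h2, h4, h6]
    ring
  · simp only [Pi.sub_apply]
    by_cases h : r ≤ t
    · rw [Set.indicator_of_mem (by exact h), step, step, if_pos h, sub_self, zero_mul, zero_div,
        ← sub_div]
      have := smearScale_zero_sub_le lam ht z
      have h9 : (smearScale lam t 0 - smearScale lam t z) / t ≤ (tentLip * ‖z‖ / t) / t := by gcongr
      have h10 : (tentLip * ‖z‖ / t) / t = tentLip * ‖z‖ * (t ^ 2)⁻¹ := by field_simp
      rw [h10] at h9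
      refine le_trans (le_of_eq ?_) (sub_nonpos.2 h9)
      congr 2
      ring
    · rw [Set.indicator_of_notMem (by exact h), step, step, if_neg h]
      refine le_of_eq ?_
      ring

theorem neg_Flam_le {N : ℕ} {lam : ℝ} (hlam : 0 < lam) (X Y : Fin N → E2)
    (P : Finset (Fin N)) (u v : Fin N → ℝ) {r : ℝ} (hr : 0 < r)
    (hu : ∀ i, 0 ≤ u i) (hv : ∀ i, 0 ≤ v i)
    (hsep : ∀ i j, (i ≠ j ∨ i ∉ P) → (0 < u i → 2 * u i + 2 * lam ≤ ‖X i - Y j‖) ∧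
      (0 < v j → 2 * v j + 2 * lam ≤ ‖X i - Y j‖))
    (hP : ∀ i ∈ P, u i = r ∧ v i = r) :
    -Flam N lam X Y ≤ ∑ i, (if i ∈ P then gsm lam (X i - Y i) + tentLip * ‖X i - Y i‖ / r
      else (chargeCost lam (u i) + chargeCost lam (v i)) / 2) := by
  choose mu hmu1 hmu2 hmu3 using fun i => integral_truncated_self hlam (hu i)
  choose mv hmv1 hmv2 hmv3 using fun i => integral_truncated_self hlam (hv i)
  choose md hmd1 hmd2 hmd3 using fun i => integral_truncated_dipole hlam hr (X i - Y i)
  let m : Fin N → ℝ → ℝ := fun i t => if i ∈ P then 2 * md i t else mu i t + mv i t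
  have hm1 : ∀ i, IntegrableOn (m i) (Set.Ioi 0) := fun i => by
    by_cases h : i ∈ P
    · simp only [m, if_pos h]; exact (hmd1 i).const_mul 2
    · simp only [m, if_neg h]; exact (hmu1 i).add (hmv1 i)
  have hm2 : ∀ i, ∫ t in Set.Ioi (0 : ℝ), m i t = if i ∈ P then
      2 * (gsm lam 0 - gsm lam (X i - Y i) - tentLip * ‖X i - Y i‖ / r) else
      (gsm lam 0 - chargeCost lam (u i)) + (gsm lam 0 - chargeCost lam (v i)) := fun i => by
    by_cases h : i ∈ P
    · simp only [m, if_pos h]; rw [integral_const_mul, hmd2]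
    · simp only [m, if_neg h]; rw [integral_add (hmu1 i) (hmv1 i), hmu2, hmv2]
  let k : E2 → ℝ → ℝ := fun z t => (smearScale lam t z - step 1 t) / t
  have hk1 : ∀ z, IntegrableOn (k z) (Set.Ioi 0) := fun z => (integral_smearScale hlam z).1
  have hk2 : ∀ z, ∫ t in Set.Ioi (0 : ℝ), k z t = logShift + gsm lam z :=
    fun z => (integral_smearScale hlam z).2
  have hS1 : ∀ i j, IntegrableOn (fun t => k (X i - X j) t + k (Y i - Y j) t - 2 * k (X i - Y j) t)
      (Set.Ioi 0) := fun i j => ((hk1 _).add (hk1 _)).sub ((hk1 _).const_mul 2)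
  have hS2 : ∀ i j, ∫ t in Set.Ioi (0 : ℝ), (k (X i - X j) t + k (Y i - Y j) t -
      2 * k (X i - Y j) t) = gsm lam (X i - X j) + gsm lam (Y i - Y j) - 2 * gsm lam (X i - Y j) := by
    intro i j
    have h1 := integral_sub ((hk1 (X i - X j)).add (hk1 (Y i - Y j))) ((hk1 (X i - Y j)).const_mul 2)
    simp only [Pi.add_apply] at h1
    rw [h1, integral_add (hk1 _) (hk1 _), integral_const_mul, hk2, hk2, hk2]
    ring
  have hle : ∫ t in Set.Ioi (0 : ℝ), ∑ i, m i t ≤ ∫ t in Set.Ioi (0 : ℝ),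
      ∑ i, ∑ j, (k (X i - X j) t + k (Y i - Y j) t - 2 * k (X i - Y j) t) := by
    refine setIntegral_mono_on (integrable_finsetSum _ fun i _ => hm1 i)
      (integrable_finsetSum _ fun i _ => integrable_finsetSum _ fun j _ => hS1 i j)
      measurableSet_Ioi fun t (ht : 0 < t) => ?_
    have h1 := sum_smearScale_ge hlam ht X Y P u v r hsep hP
    have h2 : ∑ i, ∑ j, (k (X i - X j) t + k (Y i - Y j) t - 2 * k (X i - Y j) t) =
        (∑ i, ∑ j, (smearScale lam t (X i - X j) + smearScale lam t (Y i - Y j) -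
          2 * smearScale lam t (X i - Y j))) / t := by
      simp only [Finset.sum_div, k]
      refine Finset.sum_congr rfl fun i _ => Finset.sum_congr rfl fun j _ => by ring
    rw [h2]
    refine le_trans ?_ (div_le_div_of_nonneg_right h1 ht.le)
    rw [Finset.sum_div]
    refine Finset.sum_le_sum fun i _ => ?_
    by_cases h : i ∈ P
    · simp only [m, if_pos h]
      rw [mul_div_assoc]
      linarith [hmd3 i t ht]
    · simp only [m, if_neg h]
      rw [add_div]
      linarith [hmu3 i t ht, hmv3 i t ht]
  rw [integral_finsetSum _ fun i _ => hm1 i, integral_finsetSum _ fun i _ =>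
    integrable_finsetSum _ fun j _ => hS1 i j] at hle
  simp only [integral_finsetSum _ fun j _ => hS1 _ j, hS2, hm2] at hle
  have hF : Flam N lam X Y = (1 / 2) * (∑ i, ∑ j, (gsm lam (X i - X j) + gsm lam (Y i - Y j) -
      2 * gsm lam (X i - Y j))) - N * gsm lam 0 := by rw [Flam, gsm_zero hlam]
  have hsum : ∑ i : Fin N, (if i ∈ P then
      2 * (gsm lam 0 - gsm lam (X i - Y i) - tentLip * ‖X i - Y i‖ / r) else
      (gsm lam 0 - chargeCost lam (u i)) + (gsm lam 0 - chargeCost lam (v i))) =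
      2 * (N * gsm lam 0) - 2 * ∑ i, (if i ∈ P then gsm lam (X i - Y i) +
        tentLip * ‖X i - Y i‖ / r else (chargeCost lam (u i) + chargeCost lam (v i)) / 2) := by
    have : ∑ _i : Fin N, gsm lam 0 = N * gsm lam 0 := by simp
    rw [← this, Finset.mul_sum, Finset.mul_sum, ← Finset.sum_sub_distrib]
    refine Finset.sum_congr rfl fun i _ => ?_
    split_ifs <;> ring
  rw [hsum] at hle
  rw [hF]
  linarith

/-! ### Isolated dipoles and the combinatorics of the remaining charges -/

/-- The opposite charges `X i`, `Y j` form a dipole of length at most `ε`, at distance more than `R`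
from all other charges. -/
def IsolatedPair {N : ℕ} (R ε : ℝ) (X Y : Fin N → E2) (i j : Fin N) : Prop :=
  ‖X i - Y j‖ ≤ ε ∧ (∀ k, k ≠ i → R < ‖X k - X i‖ ∧ R < ‖X k - Y j‖) ∧
    ∀ l, l ≠ j → R < ‖Y l - Y j‖ ∧ R < ‖X i - Y l‖

/-- The isolated dipoles are exactly the pairs `(X i, Y i)` with `i ∈ P`. -/
def MatchedOn {N : ℕ} (R ε : ℝ) (P : Finset (Fin N)) (X Y : Fin N → E2) : Prop :=
  (∀ i ∈ P, IsolatedPair R ε X Y i i) ∧ ∀ i, i ∉ P → ∀ j, j ∉ P → ¬ IsolatedPair R ε X Y i j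

section
variable {N : ℕ} {R ε : ℝ} {X Y : Fin N → E2} {P : Finset (Fin N)}

lemma IsolatedPair.symm {i j : Fin N} (h : IsolatedPair R ε X Y i j) :
    IsolatedPair R ε Y X j i := by
  obtain ⟨h1, h2, h3⟩ := h
  refine ⟨by rwa [norm_sub_rev], fun k hk => ⟨(h3 k hk).1, ?_⟩, fun k hk => ⟨(h2 k hk).1, ?_⟩⟩
  · rw [norm_sub_rev]; exact (h3 k hk).2
  · rw [norm_sub_rev]; exact (h2 k hk).2

lemma MatchedOn.symm (h : MatchedOn R ε P X Y) : MatchedOn R ε P Y X :=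
  ⟨fun i hi => (h.1 i hi).symm, fun i hi j hj h' => h.2 j hj i hi h'.symm⟩

lemma IsolatedPair.right_unique (hε : ε ≤ R) {i j j' : Fin N} (h : IsolatedPair R ε X Y i j)
    (h' : IsolatedPair R ε X Y i j') : j = j' := by
  by_contra hne
  exact absurd ((h.2.2 j' (Ne.symm hne)).2) (not_lt.2 (h'.1.trans hε))

lemma IsolatedPair.left_unique (hε : ε ≤ R) {i i' j : Fin N} (h : IsolatedPair R ε X Y i j)
    (h' : IsolatedPair R ε X Y i' j) : i = i' :=
  h.symm.right_unique hε h'.symm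

lemma isolatedPair_comp_perm (τ : Equiv.Perm (Fin N)) (i j : Fin N) :
    IsolatedPair R ε X (Y ∘ τ) i j ↔ IsolatedPair R ε X Y i (τ j) := by
  have h : (∀ l, l ≠ j → R < ‖Y (τ l) - Y (τ j)‖ ∧ R < ‖X i - Y (τ l)‖) ↔
      ∀ l, l ≠ τ j → R < ‖Y l - Y (τ j)‖ ∧ R < ‖X i - Y l‖ := by
    rw [τ.forall_congr_left]
    refine forall_congr' fun l => ?_
    rw [Equiv.apply_symm_apply, Ne, Ne, Equiv.symm_apply_eq]
  simp only [IsolatedPair, Function.comp_apply, h]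

lemma MatchedOn.comp_perm (h : MatchedOn R ε P X Y) {τ : Equiv.Perm (Fin N)}
    (hτ : ∀ i ∈ P, τ i = i) : MatchedOn R ε P X (Y ∘ τ) := by
  refine ⟨fun i hi => ?_, fun i hi j hj h' => ?_⟩
  · rw [isolatedPair_comp_perm, hτ i hi]; exact h.1 i hi
  · rw [isolatedPair_comp_perm] at h'
    refine h.2 i hi (τ j) (fun hj' => hj ?_) h'
    have := τ.injective (hτ _ hj')
    rwa [this] at hj'

lemma exists_matchedOn (hε : ε ≤ R) (X Y : Fin N → E2) :
    ∃ (P : Finset (Fin N)) (σ : Equiv.Perm (Fin N)), MatchedOn R ε P X (Y ∘ σ) := by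
  let p : Fin N → Prop := fun i => ∃ j, IsolatedPair R ε X Y i j
  let q : Fin N → Prop := fun j => ∃ i, IsolatedPair R ε X Y i j
  let e : {i // p i} ≃ {j // q j} :=
    { toFun := fun i => ⟨i.2.choose, ⟨i.1, i.2.choose_spec⟩⟩
      invFun := fun j => ⟨j.2.choose, ⟨j.1, j.2.choose_spec⟩⟩
      left_inv := fun i => Subtype.ext ((Exists.choose_spec
        (⟨i.1, i.2.choose_spec⟩ : q i.2.choose)).left_unique hε i.2.choose_spec)
      right_inv := fun j => Subtype.ext ((Exists.choose_spec
        (⟨j.1, j.2.choose_spec⟩ : p j.2.choose)).right_unique hε j.2.choose_spec) }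
  refine ⟨Finset.univ.filter p, e.extendSubtype, fun i hi => ?_, fun i hi j _ h => ?_⟩
  · rw [isolatedPair_comp_perm]
    have hi' : p i := (Finset.mem_filter.1 hi).2
    rw [Equiv.extendSubtype_apply_of_mem e i hi']
    exact hi'.choose_spec
  · rw [isolatedPair_comp_perm] at h
    exact hi (Finset.mem_filter.2 ⟨Finset.mem_univ _, _, h⟩)

lemma card_perm_fixing (P : Finset (Fin N)) :
    (Finset.univ.filter fun τ : Equiv.Perm (Fin N) => ∀ i ∈ P, τ i = i).card = (Pᶜ.card).factorial := by
  have e := Equiv.Perm.subtypeEquivSubtypePerm (fun i : Fin N => i ∉ P)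
  have h1 := Fintype.card_congr e
  rw [Fintype.card_perm] at h1
  have h2 : Fintype.card {i : Fin N // i ∉ P} = Pᶜ.card := by
    rw [Fintype.card_subtype]
    congr 1
    ext; simp
  rw [h2] at h1
  rw [h1, Fintype.card_subtype]
  congr 1
  ext τ
  simp

lemma factorial_le_card_matchedOn {σ : Equiv.Perm (Fin N)} (h : MatchedOn R ε P X (Y ∘ σ)) :
    (Pᶜ.card).factorial ≤
      (Finset.univ.filter fun τ : Equiv.Perm (Fin N) => MatchedOn R ε P X (Y ∘ τ)).card := by
  rw [← card_perm_fixing]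
  refine Finset.card_le_card_of_injOn (fun τ => σ * τ) (fun τ hτ => ?_)
    (fun a _ b _ hab => mul_left_cancel hab)
  simp only [Finset.coe_filter, Finset.mem_univ, true_and, Set.mem_ofPred_eq] at hτ ⊢
  exact h.comp_perm hτ

lemma norm_sub_le_add_of_le {x y z : E2} {a b : ℝ} (h1 : ‖x - y‖ ≤ a) (h2 : ‖y - z‖ ≤ b) :
    ‖x - z‖ ≤ a + b := by
  have : x - z = (x - y) + (y - z) := by abel
  rw [this]
  exact (norm_add_le _ _).trans (add_le_add h1 h2)

/-- The indices outside `P` of points having another such point at distance at most twice `R`. -/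
def crowded (R : ℝ) (P : Finset (Fin N)) (X : Fin N → E2) : Finset (Fin N) :=
  Pᶜ.filter fun i => ∃ k, k ∉ P ∧ k ≠ i ∧ ‖X i - X k‖ ≤ 2 * R

/-- The distance from `X i` to the opposite charges. -/
def oppDist (X Y : Fin N → E2) (i : Fin N) : ℝ := ⨅ j, ‖X i - Y j‖

lemma oppDist_le (X Y : Fin N → E2) (i j : Fin N) : oppDist X Y i ≤ ‖X i - Y j‖ :=
  ciInf_le (Set.finite_range _).bddBelow j

lemma exists_oppDist_eq (X Y : Fin N → E2) (i : Fin N) : ∃ j, ‖X i - Y j‖ = oppDist X Y i :=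
  haveI : Nonempty (Fin N) := ⟨i⟩
  exists_eq_ciInf_of_finite

lemma MatchedOn.notMem_of_le (h : MatchedOn R ε P X Y) {i j : Fin N} (hi : i ∉ P)
    (hij : ‖X i - Y j‖ ≤ R) : j ∉ P := fun hj =>
  absurd ((h.1 j hj).2.1 i (fun h' => hi (h' ▸ hj))).2 (not_lt.2 hij)

lemma MatchedOn.notMem_of_le' (h : MatchedOn R ε P X Y) {i j : Fin N} (hi : i ∉ P)
    (hij : ‖X i - X j‖ ≤ R) : j ∉ P := fun hj =>
  absurd ((h.1 j hj).2.1 i (fun h' => hi (h' ▸ hj))).1 (not_lt.2 hij)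

lemma MatchedOn.mem_crowded (h : MatchedOn R ε P X Y) (hε : ε ≤ R) {i j : Fin N} (hi : i ∉ P)
    (hij : ‖X i - Y j‖ ≤ ε) (hc : i ∉ crowded R P X) : j ∈ crowded R P Y := by
  have hj := h.notMem_of_le hi (hij.trans hε)
  have hR : 0 ≤ R := (norm_nonneg _).trans (hij.trans hε)
  have hji : ‖Y j - X i‖ ≤ ε := by rwa [norm_sub_rev]
  have hnc : ∀ k, k ∉ P → k ≠ i → ¬ ‖X i - X k‖ ≤ 2 * R := fun k hk hki hle => hc
    (Finset.mem_filter.2 ⟨Finset.mem_compl.2 hi, k, hk, hki, hle⟩)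
  by_contra hc'
  have hnc' : ∀ k, k ∉ P → k ≠ j → ¬ ‖Y j - Y k‖ ≤ 2 * R := fun k hk hki hle => hc'
    (Finset.mem_filter.2 ⟨Finset.mem_compl.2 hj, k, hk, hki, hle⟩)
  refine h.2 i hi j hj ⟨hij, fun k hk => ⟨?_, ?_⟩, fun l hl => ⟨?_, ?_⟩⟩
  · by_contra hle
    rw [not_lt, norm_sub_rev] at hle
    exact hnc k (h.notMem_of_le' hi hle) hk (by linarith)
  · by_contra hle
    rw [not_lt, norm_sub_rev] at hle
    refine hnc k (h.symm.notMem_of_le hj hle) hk ?_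
    have := norm_sub_le_add_of_le hij hle
    linarith
  · by_contra hle
    rw [not_lt, norm_sub_rev] at hle
    exact hnc' l (h.symm.notMem_of_le' hj hle) hl (by linarith)
  · by_contra hle
    rw [not_lt] at hle
    refine hnc' l (h.notMem_of_le hi hle) hl ?_
    have := norm_sub_le_add_of_le hji hle
    linarith

lemma MatchedOn.card_le (h : MatchedOn R ε P X Y) (hε : ε ≤ R) :
    Pᶜ.card ≤ (Pᶜ.filter fun i => ε < oppDist X Y i).card + (crowded R P X).card +
      (crowded R P Y).card := by
  set A := Pᶜ.filter fun i => ε < oppDist X Y i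
  set B := Pᶜ \ (A ∪ crowded R P X)
  choose f hf using fun i => exists_oppDist_eq X Y i
  have hB : ∀ i ∈ B, i ∉ P ∧ ‖X i - Y (f i)‖ ≤ ε ∧ i ∉ crowded R P X := fun i hi => by
    rw [Finset.mem_sdiff, Finset.mem_union, not_or, Finset.mem_filter] at hi
    refine ⟨Finset.mem_compl.1 hi.1, ?_, hi.2.2⟩
    rw [hf]
    by_contra hlt
    exact hi.2.1 ⟨hi.1, not_le.1 hlt⟩
  have h1 : B.card ≤ (crowded R P Y).card := by
    refine Finset.card_le_card_of_injOn f (fun i hi => ?_) (fun i hi k hk hik => ?_)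
    · obtain ⟨h1, h2, h3⟩ := hB i hi
      exact h.mem_crowded hε h1 h2 h3
    · obtain ⟨h1, h2, h3⟩ := hB i hi
      obtain ⟨h4, h5, h6⟩ := hB k hk
      by_contra hne
      refine h3 (Finset.mem_filter.2 ⟨Finset.mem_compl.2 h1, k, h4, Ne.symm hne, ?_⟩)
      rw [← hik, norm_sub_rev] at h5
      have := norm_sub_le_add_of_le h2 h5
      linarith
  have h2 : Pᶜ.card ≤ (A ∪ crowded R P X).card + B.card := by
    rw [add_comm]
    exact tsub_le_iff_right.1 (Finset.le_card_sdiff _ _)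
  have h3 := Finset.card_union_le A (crowded R P X)
  omega

end

/-! ### Size of the smeared interaction -/

lemma smearScale_le_zero (lam t : ℝ) (z : E2) : smearScale lam t z ≤ smearScale lam t 0 := by
  have h := smearScale_posDef lam t ![0, z] ![1, -1]
  simp only [Fin.sum_univ_two, Matrix.cons_val_zero, Matrix.cons_val_one, sub_self, zero_sub,
    sub_zero] at h
  have h2 := smearScale_sub_comm lam t 0 z
  rw [zero_sub, sub_zero] at h2
  rw [h2] at h
  linarith

lemma gsm_le_gsm_zero {lam : ℝ} (hlam : 0 < lam) (z : E2) : gsm lam z ≤ gsm lam 0 := by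
  obtain ⟨h1, h2⟩ := integral_smearScale hlam z
  obtain ⟨h3, h4⟩ := integral_smearScale hlam 0
  have := setIntegral_mono_on h1 h3 measurableSet_Ioi fun t (ht : 0 < t) =>
    div_le_div_of_nonneg_right (sub_le_sub_right (smearScale_le_zero lam t z) _) ht.le
  linarith

lemma neg_log_le_gsm_one (z : E2) : -Real.log (‖z‖ + 2) ≤ gsm 1 z := by
  rw [gsm_eq_integral_diffLaw one_pos]
  have h : ∫ _w, -Real.log (‖z‖ + 2) ∂diffLaw ≤ ∫ w, gfun (z + (1 : ℝ) • w) ∂diffLaw := by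
    refine integral_mono_ae (integrable_const _) (integrable_gfun_diffLaw z one_pos) ?_
    filter_upwards [diffLaw_ae] with w hw
    simp only [gfun, one_smul, neg_le_neg_iff]
    rcases (norm_nonneg (z + w)).eq_or_lt with h0 | h0
    · rw [← h0, Real.log_zero]
      exact Real.log_nonneg (by linarith [norm_nonneg z])
    · exact Real.log_le_log h0 ((norm_add_le _ _).trans (by linarith))
  simpa using h

lemma gsm_one_le_neg_log {z : E2} (hz : 2 < ‖z‖) : gsm 1 z ≤ -Real.log (‖z‖ - 2) := by
  rw [gsm_eq_integral_diffLaw one_pos]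
  have h : ∫ w, gfun (z + (1 : ℝ) • w) ∂diffLaw ≤ ∫ _w, -Real.log (‖z‖ - 2) ∂diffLaw := by
    refine integral_mono_ae (integrable_gfun_diffLaw z one_pos) (integrable_const _) ?_
    filter_upwards [diffLaw_ae] with w hw
    simp only [gfun, one_smul, neg_le_neg_iff]
    refine Real.log_le_log (by linarith) ?_
    have := norm_sub_norm_le z (-w)
    rw [norm_neg, sub_neg_eq_add] at this
    linarith
  simpa using h

/-- The accuracy to which `gsm lam z` is `-log (max ‖z‖ lam)`. -/
def gsmErr : ℝ := max kappa 0 + Real.log 3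

lemma gsmErr_nonneg : 0 ≤ gsmErr :=
  add_nonneg (le_max_right _ _) (Real.log_nonneg (by norm_num))

lemma gsm_one_bounds (z : E2) :
    -Real.log (max ‖z‖ 1) - gsmErr ≤ gsm 1 z ∧ gsm 1 z ≤ -Real.log (max ‖z‖ 1) + gsmErr := by
  have hk := le_max_left kappa 0
  have hk0 := le_max_right kappa 0
  have hm : (0 : ℝ) < max ‖z‖ 1 := lt_max_of_lt_right one_pos
  have hl3 : (0 : ℝ) ≤ Real.log 3 := Real.log_nonneg (by norm_num)
  unfold gsmErr
  constructor
  · have h1 : Real.log (‖z‖ + 2) ≤ Real.log (3 * max ‖z‖ 1) := by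
      refine Real.log_le_log (by linarith [norm_nonneg z]) ?_
      linarith [le_max_left ‖z‖ 1, le_max_right ‖z‖ 1]
    rw [Real.log_mul (by norm_num) hm.ne'] at h1
    linarith [neg_log_le_gsm_one z]
  · by_cases h : 3 ≤ ‖z‖
    · have h1 := gsm_one_le_neg_log (z := z) (by linarith)
      have h2 : Real.log (max ‖z‖ 1) ≤ Real.log (3 * (‖z‖ - 2)) := by
        refine Real.log_le_log hm ?_
        rw [max_eq_left (by linarith)]; linarith
      rw [Real.log_mul (by norm_num) (by linarith)] at h2
      linarith
    · have h1 : gsm 1 z ≤ kappa := gsm_le_gsm_zero one_pos z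
      have h2 : Real.log (max ‖z‖ 1) ≤ Real.log 3 := by
        refine Real.log_le_log hm (max_le (not_le.1 h).le (by norm_num))
      linarith

lemma gsm_bounds {lam : ℝ} (hlam : 0 < lam) (z : E2) :
    -Real.log (max ‖z‖ lam) - gsmErr ≤ gsm lam z ∧
      gsm lam z ≤ -Real.log (max ‖z‖ lam) + gsmErr := by
  have h := gsm_one_bounds (lam⁻¹ • z)
  have h1 : max ‖lam⁻¹ • z‖ 1 = lam⁻¹ * max ‖z‖ lam := by
    rw [norm_smul, Real.norm_of_nonneg (inv_nonneg.2 hlam.le), mul_max_of_nonneg _ _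
      (inv_nonneg.2 hlam.le), inv_mul_cancel₀ hlam.ne']
  rw [h1, Real.log_mul (inv_ne_zero hlam.ne') (lt_max_of_lt_right hlam).ne', Real.log_inv] at h
  rw [gsm_eq_neg_log_add hlam]
  constructor <;> linarith [h.1, h.2]

/-! ### Pointwise bound for the Boltzmann factor -/

/-- The truncation scale of a charge at distance `d` from the opposite charges. -/
def cutScale (lam R d : ℝ) : ℝ := if d < 4 * lam then 0 else min d R / 4

lemma cutScale_nonneg {lam R d : ℝ} (hlam : 0 < lam) (hR : 0 ≤ R) : 0 ≤ cutScale lam R d := by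
  unfold cutScale
  split_ifs with h
  · exact le_rfl
  · exact div_nonneg (le_min (by linarith) hR) (by norm_num)

lemma two_mul_cutScale_le {lam R d : ℝ} (hd : 0 < cutScale lam R d) :
    2 * cutScale lam R d + 2 * lam ≤ d := by
  unfold cutScale at hd ⊢
  split_ifs with h
  · rw [if_pos h] at hd; exact absurd hd (lt_irrefl _)
  · linarith [min_le_left d R]

/-- The constant in the bound for `chargeCost`. -/
def costConst : ℝ := max kappa (-logShift) + Real.log 4

lemma chargeCost_cutScale_le {lam R d : ℝ} (hlam : 0 < lam) (hR : 4 * lam ≤ R) :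
    chargeCost lam (cutScale lam R d) ≤ costConst - Real.log (max lam (min d R)) := by
  unfold costConst
  by_cases h : d < 4 * lam
  · rw [cutScale, if_pos h, chargeCost, if_pos rfl, gsm_zero hlam]
    have h1 : Real.log (max lam (min d R)) ≤ Real.log (4 * lam) :=
      Real.log_le_log (lt_max_of_lt_left hlam)
        (max_le (by linarith) ((min_le_left _ _).trans h.le))
    rw [Real.log_mul (by norm_num) hlam.ne'] at h1
    linarith [le_max_left kappa (-logShift)]
  · have h4 : 4 * lam ≤ min d R := le_min (not_lt.1 h) hR
    have h5 : 0 < min d R := by linarith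
    rw [cutScale, if_neg h, chargeCost, if_neg (div_pos h5 four_pos).ne',
      max_eq_right (show lam ≤ min d R by linarith), Real.log_div h5.ne' (by norm_num)]
    linarith [le_max_right kappa (-logShift)]

/-- The weight of a dipole of length at most `ε`. -/
def pairWeight (β lam ε : ℝ) (z : E2) : ℝ := if ‖z‖ ≤ ε then Real.exp (β * gsm lam z) else 0

lemma pairWeight_nonneg (β lam ε : ℝ) (z : E2) : 0 ≤ pairWeight β lam ε z := by
  unfold pairWeight; split_ifs <;> positivity

/-- The constant in `siteWeight`. -/
def siteConst (β : ℝ) : ℝ := Real.exp (β * (costConst + gsmErr))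

lemma siteConst_pos (β : ℝ) : 0 < siteConst β := Real.exp_pos _

/-- The weight of a point `x` with index `i` in the field of opposite charges `Y`. -/
def siteWeight {N : ℕ} (β lam T : ℝ) (P : Finset (Fin N)) (Y : Fin N → E2) (i : Fin N) (x : E2) : ℝ :=
  if i ∈ P then pairWeight β lam (T ^ 6)⁻¹ (x - Y i) else
    siteConst β * (T ^ 2 * (T ^ 6) ^ β + ∑ j ∈ Pᶜ, pairWeight β lam (T ^ 6)⁻¹ (x - Y j))

/-- The weight counting the points among `Y k`, with `k` preceding `i`, that crowd `Y i`. -/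
def crowdWeight {N : ℕ} (T : ℝ) (P : Finset (Fin N)) (prec : Fin N → Fin N → Prop)
    (Y : Fin N → E2) (i : Fin N) : ℝ :=
  if i ∈ P then 1 else
    1 + T ^ 8 * ∑ k ∈ Pᶜ, if prec k i ∧ ‖Y i - Y k‖ ≤ 2 * (T ^ 4)⁻¹ then 1 else 0

section
variable {N : ℕ} {β lam T : ℝ} {X Y : Fin N → E2} {P : Finset (Fin N)}

lemma siteWeight_nonneg (i : Fin N) (x : E2) : 0 ≤ siteWeight β lam T P Y i x := by
  unfold siteWeight
  split_ifs
  · exact pairWeight_nonneg _ _ _ _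
  · have : 0 ≤ ∑ j ∈ Pᶜ, pairWeight β lam (T ^ 6)⁻¹ (x - Y j) :=
      Finset.sum_nonneg fun j _ => pairWeight_nonneg _ _ _ _
    have := siteConst_pos β
    positivity

lemma one_le_crowdWeight (prec : Fin N → Fin N → Prop) (i : Fin N) :
    1 ≤ crowdWeight T P prec Y i := by
  unfold crowdWeight
  split_ifs
  · exact le_rfl
  · have : (0 : ℝ) ≤ ∑ k ∈ Pᶜ, if prec k i ∧ ‖Y i - Y k‖ ≤ 2 * (T ^ 4)⁻¹ then 1 else 0 :=
      Finset.sum_nonneg fun j _ => by split_ifs <;> norm_num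
    have : 0 ≤ T ^ 8 * ∑ k ∈ Pᶜ, (if prec k i ∧ ‖Y i - Y k‖ ≤ 2 * (T ^ 4)⁻¹ then (1 : ℝ) else 0) :=
      by positivity
    linarith

lemma pow_card_le_prod_crowdWeight (hT : 1 ≤ T) (prec : Fin N → Fin N → Prop) :
    (T ^ 8) ^ (Pᶜ.filter fun i => ∃ k, k ∉ P ∧ prec k i ∧ ‖Y i - Y k‖ ≤ 2 * (T ^ 4)⁻¹).card ≤
      ∏ i, crowdWeight T P prec Y i := by
  rw [← Finset.prod_const, Finset.prod_filter, ← Finset.prod_mul_prod_compl P]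
  have h1 : 1 ≤ ∏ i ∈ P, crowdWeight T P prec Y i :=
    Finset.prod_induction _ (1 ≤ ·) (fun _ _ => one_le_mul_of_one_le_of_one_le) le_rfl
      fun i _ => one_le_crowdWeight prec i
  refine le_trans ?_ (le_mul_of_one_le_left
    (Finset.prod_nonneg fun i _ => zero_le_one.trans (one_le_crowdWeight prec i)) h1)
  · refine Finset.prod_le_prod (fun i _ => by split_ifs <;> positivity) fun i hi => ?_
    split_ifs with h
    · obtain ⟨k, hk, hk2, hk3⟩ := h
      rw [crowdWeight, if_neg (Finset.mem_compl.1 hi)]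
      have : (1 : ℝ) ≤ ∑ k ∈ Pᶜ, if prec k i ∧ ‖Y i - Y k‖ ≤ 2 * (T ^ 4)⁻¹ then 1 else 0 := by
        refine le_trans (le_of_eq ?_) (Finset.single_le_sum (f := fun k =>
          if prec k i ∧ ‖Y i - Y k‖ ≤ 2 * (T ^ 4)⁻¹ then (1 : ℝ) else 0)
          (fun j _ => by split_ifs <;> norm_num) (Finset.mem_compl.2 hk))
        simp only [if_pos (And.intro hk2 hk3)]
      have hT8 : (0 : ℝ) ≤ T ^ 8 := by positivity
      nlinarith
    · exact one_le_crowdWeight prec i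

lemma pow_card_crowded_le (hT : 1 ≤ T) :
    (T ^ 4) ^ (crowded (T ^ 4)⁻¹ P Y).card ≤
      (∏ i, crowdWeight T P (· < ·) Y i + ∏ i, crowdWeight T P (· > ·) Y i) / 2 := by
  have hsub : crowded (T ^ 4)⁻¹ P Y ⊆
      (Pᶜ.filter fun i => ∃ k, k ∉ P ∧ k < i ∧ ‖Y i - Y k‖ ≤ 2 * (T ^ 4)⁻¹) ∪
      (Pᶜ.filter fun i => ∃ k, k ∉ P ∧ k > i ∧ ‖Y i - Y k‖ ≤ 2 * (T ^ 4)⁻¹) := by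
    intro i hi
    obtain ⟨hi, k, hk1, hk2, hk3⟩ := Finset.mem_filter.1 hi
    rw [Finset.mem_union, Finset.mem_filter, Finset.mem_filter]
    rcases lt_or_gt_of_ne hk2 with h | h
    · exact Or.inl ⟨hi, k, hk1, h, hk3⟩
    · exact Or.inr ⟨hi, k, hk1, h, hk3⟩
  have hc := (Finset.card_le_card hsub).trans (Finset.card_union_le _ _)
  have hT4 : (1 : ℝ) ≤ T ^ 4 := one_le_pow₀ hT
  have h1 := pow_card_le_prod_crowdWeight (P := P) (Y := Y) hT (· < ·)
  have h2 := pow_card_le_prod_crowdWeight (P := P) (Y := Y) hT (· > ·)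
  refine (pow_le_pow_right₀ hT4 hc).trans ?_
  rw [pow_add]
  have h8 : T ^ 8 = (T ^ 4) ^ 2 := by ring
  rw [h8, ← pow_mul, mul_comm 2, pow_mul] at h1 h2
  set a := (T ^ 4) ^ (Pᶜ.filter fun i => ∃ k, k ∉ P ∧ k < i ∧ ‖Y i - Y k‖ ≤ 2 * (T ^ 4)⁻¹).card
  set b := (T ^ 4) ^ (Pᶜ.filter fun i => ∃ k, k ∉ P ∧ k > i ∧ ‖Y i - Y k‖ ≤ 2 * (T ^ 4)⁻¹).card
  have h3 := two_mul_le_add_sq a b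
  have h4 : a ^ 2 ≤ ∏ i, crowdWeight T P (· < ·) Y i := by convert h1
  have h5 : b ^ 2 ≤ ∏ i, crowdWeight T P (· > ·) Y i := by convert h2
  linarith

lemma exp_chargeCost_le (hβ : 0 ≤ β) (hlam : 0 < lam) (hT : 1 ≤ T) (hε : 4 * lam ≤ (T ^ 6)⁻¹)
    (hM : MatchedOn (T ^ 4)⁻¹ (T ^ 6)⁻¹ P X Y) {i : Fin N} (hi : i ∉ P) :
    (if (T ^ 6)⁻¹ < oppDist X Y i then T ^ 2 else 1) *
      Real.exp (β * chargeCost lam (cutScale lam (T ^ 4)⁻¹ (oppDist X Y i))) ≤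
      siteWeight β lam T P Y i (X i) := by
  have hεR : (T ^ 6)⁻¹ ≤ (T ^ 4)⁻¹ :=
    inv_anti₀ (by positivity) (pow_le_pow_right₀ hT (by norm_num))
  have hε0 : 0 < (T ^ 6)⁻¹ := by positivity
  have hcost := chargeCost_cutScale_le (d := oppDist X Y i) hlam (hε.trans hεR)
  have hsum : 0 ≤ ∑ j ∈ Pᶜ, pairWeight β lam (T ^ 6)⁻¹ (X i - Y j) :=
    Finset.sum_nonneg fun j _ => pairWeight_nonneg _ _ _ _
  have hK := siteConst_pos β
  rw [siteWeight, if_neg hi]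
  split_ifs with h
  · have h1 : Real.exp (β * chargeCost lam (cutScale lam (T ^ 4)⁻¹ (oppDist X Y i))) ≤
        siteConst β * (T ^ 6) ^ β := by
      rw [siteConst, Real.rpow_def_of_pos (by positivity), ← Real.exp_add, Real.exp_le_exp]
      have h2 : Real.log (T ^ 6)⁻¹ ≤ Real.log (max lam (min (oppDist X Y i) (T ^ 4)⁻¹)) :=
        Real.log_le_log hε0 (le_max_of_le_right (le_min h.le hεR))
      rw [Real.log_inv] at h2
      have := gsmErr_nonneg
      have h3 : chargeCost lam (cutScale lam (T ^ 4)⁻¹ (oppDist X Y i)) ≤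
        (costConst + gsmErr) + Real.log (T ^ 6) := by linarith
      nlinarith [mul_le_mul_of_nonneg_left h3 hβ]
    have hT2 : (0 : ℝ) ≤ T ^ 2 := by positivity
    nlinarith [mul_le_mul_of_nonneg_left h1 hT2, mul_nonneg hK.le hsum]
  · obtain ⟨j, hj⟩ := exists_oppDist_eq X Y i
    have hle : ‖X i - Y j‖ ≤ (T ^ 6)⁻¹ := by rw [hj]; exact not_lt.1 h
    have hjP := hM.notMem_of_le hi (hle.trans hεR)
    have h1 : Real.exp (β * chargeCost lam (cutScale lam (T ^ 4)⁻¹ (oppDist X Y i))) ≤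
        siteConst β * pairWeight β lam (T ^ 6)⁻¹ (X i - Y j) := by
      rw [siteConst, pairWeight, if_pos hle, ← Real.exp_add, Real.exp_le_exp, ← mul_add]
      refine mul_le_mul_of_nonneg_left (hcost.trans ?_) hβ
      have h2 := (gsm_bounds hlam (X i - Y j)).1
      rw [← hj, min_eq_left (hle.trans hεR), max_comm]
      linarith
    have h2 : pairWeight β lam (T ^ 6)⁻¹ (X i - Y j) ≤
        ∑ j ∈ Pᶜ, pairWeight β lam (T ^ 6)⁻¹ (X i - Y j) :=
      Finset.single_le_sum (f := fun j => pairWeight β lam (T ^ 6)⁻¹ (X i - Y j))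
        (fun j _ => pairWeight_nonneg _ _ _ _) (Finset.mem_compl.2 hjP)
    rw [one_mul]
    refine h1.trans (mul_le_mul_of_nonneg_left (h2.trans ?_) hK.le)
    have : (0 : ℝ) ≤ T ^ 2 * (T ^ 6) ^ β := by positivity
    linarith

lemma neg_Flam_le_of_matchedOn (hlam : 0 < lam) (hT : 1 ≤ T) (hε : 4 * lam ≤ (T ^ 6)⁻¹)
    (hM : MatchedOn (T ^ 4)⁻¹ (T ^ 6)⁻¹ P X Y) :
    -Flam N lam X Y ≤ N * (4 * tentLip * (T ^ 2)⁻¹) + ∑ i, (if i ∈ P then gsm lam (X i - Y i) else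
      (chargeCost lam (cutScale lam (T ^ 4)⁻¹ (oppDist X Y i)) +
        chargeCost lam (cutScale lam (T ^ 4)⁻¹ (oppDist Y X i))) / 2) := by
  have hεR : (T ^ 6)⁻¹ ≤ (T ^ 4)⁻¹ :=
    inv_anti₀ (by positivity) (pow_le_pow_right₀ hT (by norm_num))
  have hR : 0 < (T ^ 4)⁻¹ := by positivity
  have h := neg_Flam_le hlam X Y P
    (fun i => if i ∈ P then (T ^ 4)⁻¹ / 4 else cutScale lam (T ^ 4)⁻¹ (oppDist X Y i))
    (fun i => if i ∈ P then (T ^ 4)⁻¹ / 4 else cutScale lam (T ^ 4)⁻¹ (oppDist Y X i))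
    (r := (T ^ 4)⁻¹ / 4) (by positivity)
    (fun i => by split_ifs; exacts [by positivity, cutScale_nonneg hlam hR.le])
    (fun i => by split_ifs; exacts [by positivity, cutScale_nonneg hlam hR.le])
    (fun i j hij => by
      constructor
      · by_cases hi : i ∈ P
        · intro _
          have hne : j ≠ i := by
            rcases hij with h | h
            · exact h.symm
            · exact absurd hi h
          simp only [if_pos hi]
          linarith [((hM.1 i hi).2.2 j hne).2]
        · simp only [if_neg hi]
          intro h
          exact (two_mul_cutScale_le h).trans (oppDist_le X Y i j)
      · by_cases hj : j ∈ P
        · intro _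
          have hne : i ≠ j := by
            rcases hij with h | h
            · exact h
            · rintro rfl; exact h hj
          simp only [if_pos hj]
          linarith [((hM.1 j hj).2.1 i hne).2]
        · simp only [if_neg hj]
          intro h
          rw [norm_sub_rev]
          exact (two_mul_cutScale_le h).trans (oppDist_le Y X j i))
    (fun i hi => by simp [hi])
  refine h.trans ?_
  have hc : (N : ℝ) * (4 * tentLip * (T ^ 2)⁻¹) = ∑ _i : Fin N, 4 * tentLip * (T ^ 2)⁻¹ := by simp
  rw [hc, ← Finset.sum_add_distrib]
  have hL := tentLip_nonneg
  refine Finset.sum_le_sum fun i _ => ?_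
  by_cases hi : i ∈ P
  · simp only [if_pos hi]
    have h1 : tentLip * ‖X i - Y i‖ / ((T ^ 4)⁻¹ / 4) ≤ tentLip * (T ^ 6)⁻¹ / ((T ^ 4)⁻¹ / 4) := by
      have := (hM.1 i hi).1
      gcongr
    have h2 : tentLip * (T ^ 6)⁻¹ / ((T ^ 4)⁻¹ / 4) = 4 * tentLip * (T ^ 2)⁻¹ := by
      field_simp
    linarith
  · simp only [if_neg hi]
    have : 0 ≤ 4 * tentLip * (T ^ 2)⁻¹ := by positivity
    linarith

lemma exp_neg_mul_Flam_le (hβ : 0 ≤ β) (hlam : 0 < lam) (hT : 1 ≤ T) (hε : 4 * lam ≤ (T ^ 6)⁻¹)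
    (hM : MatchedOn (T ^ 4)⁻¹ (T ^ 6)⁻¹ P X Y) :
    Real.exp (-β * Flam N lam X Y) ≤ Real.exp (N * (4 * β * tentLip * (T ^ 2)⁻¹)) *
      ((T ^ 2)⁻¹ ^ Pᶜ.card / 4 *
      ((∏ i, siteWeight β lam T P Y i (X i)) *
        (∏ i, crowdWeight T P (· < ·) Y i + ∏ i, crowdWeight T P (· > ·) Y i) +
       (∏ i, siteWeight β lam T P X i (Y i)) *
        (∏ i, crowdWeight T P (· < ·) X i + ∏ i, crowdWeight T P (· > ·) X i))) := by
  have hεR : (T ^ 6)⁻¹ ≤ (T ^ 4)⁻¹ :=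
    inv_anti₀ (by positivity) (pow_le_pow_right₀ hT (by norm_num))
  set cx : Fin N → ℝ := fun i => chargeCost lam (cutScale lam (T ^ 4)⁻¹ (oppDist X Y i)) with hcx
  set cy : Fin N → ℝ := fun i => chargeCost lam (cutScale lam (T ^ 4)⁻¹ (oppDist Y X i)) with hcy
  have h1 : Real.exp (-β * Flam N lam X Y) ≤ Real.exp (N * (4 * β * tentLip * (T ^ 2)⁻¹)) *
      ((∏ i ∈ P, pairWeight β lam (T ^ 6)⁻¹ (X i - Y i)) *
        ((∏ i ∈ Pᶜ, Real.exp (β * cx i / 2)) * ∏ i ∈ Pᶜ, Real.exp (β * cy i / 2))) := by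
    have h2 := mul_le_mul_of_nonneg_left (neg_Flam_le_of_matchedOn hlam hT hε hM) hβ
    rw [← Finset.sum_add_sum_compl P] at h2
    have h3 : ∏ i ∈ P, pairWeight β lam (T ^ 6)⁻¹ (X i - Y i) =
        Real.exp (∑ i ∈ P, β * gsm lam (X i - Y i)) := by
      rw [Real.exp_sum]
      exact Finset.prod_congr rfl fun i hi => if_pos (hM.1 i hi).1
    have h4 : ∑ i ∈ P, (if i ∈ P then gsm lam (X i - Y i) else (cx i + cy i) / 2) =
        ∑ i ∈ P, gsm lam (X i - Y i) := Finset.sum_congr rfl fun i hi => if_pos hi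
    have h5 : ∑ i ∈ Pᶜ, (if i ∈ P then gsm lam (X i - Y i) else (cx i + cy i) / 2) =
        ∑ i ∈ Pᶜ, (cx i + cy i) / 2 :=
      Finset.sum_congr rfl fun i hi => if_neg (Finset.mem_compl.1 hi)
    rw [h4, h5] at h2
    rw [h3, ← Real.exp_sum, ← Real.exp_sum, ← Real.exp_add, ← Real.exp_add, ← Real.exp_add,
      Real.exp_le_exp, ← Finset.sum_add_distrib, ← Finset.mul_sum]
    have h6 : ∑ i ∈ Pᶜ, (β * cx i / 2 + β * cy i / 2) = β * ∑ i ∈ Pᶜ, (cx i + cy i) / 2 := by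
      rw [Finset.mul_sum]
      exact Finset.sum_congr rfl fun i _ => by ring
    rw [h6]
    linarith
  refine h1.trans (mul_le_mul_of_nonneg_left ?_ (Real.exp_pos _).le)
  set WX := ∏ i ∈ Pᶜ, Real.exp (β * cx i / 2) with hWX
  set WY := ∏ i ∈ Pᶜ, Real.exp (β * cy i / 2) with hWY
  set ax := (Pᶜ.filter fun i => (T ^ 6)⁻¹ < oppDist X Y i).card with hax
  set ay := (Pᶜ.filter fun i => (T ^ 6)⁻¹ < oppDist Y X i).card with hay
  set kx := (crowded (T ^ 4)⁻¹ P X).card with hkx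
  set ky := (crowded (T ^ 4)⁻¹ P Y).card with hky
  have hn1 : Pᶜ.card ≤ ax + kx + ky := hM.card_le hεR
  have hn2 : Pᶜ.card ≤ ay + ky + kx := hM.symm.card_le hεR
  have hsq : ∀ (c : Fin N → ℝ) (Q : Fin N → Prop), (∏ i ∈ Pᶜ, Real.exp (β * c i / 2)) ^ 2 *
      (T ^ 2) ^ (Pᶜ.filter Q).card = ∏ i ∈ Pᶜ, (if Q i then T ^ 2 else 1) * Real.exp (β * c i) := by
    intro c Q
    rw [← Finset.prod_const, Finset.prod_filter, ← Finset.prod_pow, ← Finset.prod_mul_distrib]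
    refine Finset.prod_congr rfl fun i _ => ?_
    rw [← Real.exp_nat_mul, mul_comm]
    congr 2
    push_cast; ring
  have hWX0 : 0 < WX := Finset.prod_pos fun i _ => Real.exp_pos _
  have hWY0 : 0 < WY := Finset.prod_pos fun i _ => Real.exp_pos _
  have hX : WX ^ 2 * (T ^ 2) ^ ax ≤ ∏ i ∈ Pᶜ, siteWeight β lam T P Y i (X i) := by
    rw [hWX, hax, hsq]
    exact Finset.prod_le_prod (fun i _ => by split_ifs <;> positivity) fun i hi =>
      exp_chargeCost_le hβ hlam hT hε hM (Finset.mem_compl.1 hi)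
  have hY : WY ^ 2 * (T ^ 2) ^ ay ≤ ∏ i ∈ Pᶜ, siteWeight β lam T P X i (Y i) := by
    rw [hWY, hay, hsq]
    exact Finset.prod_le_prod (fun i _ => by split_ifs <;> positivity) fun i hi =>
      exp_chargeCost_le hβ hlam hT hε hM.symm (Finset.mem_compl.1 hi)
  have hpair : ∀ i, pairWeight β lam (T ^ 6)⁻¹ (Y i - X i) =
      pairWeight β lam (T ^ 6)⁻¹ (X i - Y i) := fun i => by
    rw [pairWeight, pairWeight, norm_sub_rev, gsm_sub_comm hlam]
  have hprodX : ∏ i, siteWeight β lam T P Y i (X i) =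
      (∏ i ∈ P, pairWeight β lam (T ^ 6)⁻¹ (X i - Y i)) *
        ∏ i ∈ Pᶜ, siteWeight β lam T P Y i (X i) := by
    rw [← Finset.prod_mul_prod_compl P]
    congr 1
    exact Finset.prod_congr rfl fun i hi => by rw [siteWeight, if_pos hi]
  have hprodY : ∏ i, siteWeight β lam T P X i (Y i) =
      (∏ i ∈ P, pairWeight β lam (T ^ 6)⁻¹ (X i - Y i)) *
        ∏ i ∈ Pᶜ, siteWeight β lam T P X i (Y i) := by
    rw [← Finset.prod_mul_prod_compl P]
    congr 1
    exact Finset.prod_congr rfl fun i hi => by rw [siteWeight, if_pos hi, hpair]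
  have hm : 0 ≤ ∏ i ∈ P, pairWeight β lam (T ^ 6)⁻¹ (X i - Y i) :=
    Finset.prod_nonneg fun i _ => pairWeight_nonneg _ _ _ _
  rw [hprodX, hprodY]
  have hcY := pow_card_crowded_le (P := P) (Y := Y) hT
  have hcX := pow_card_crowded_le (P := P) (Y := X) hT
  rw [← hky] at hcY
  rw [← hkx] at hcX
  set CY := ∏ i, crowdWeight T P (· < ·) Y i + ∏ i, crowdWeight T P (· > ·) Y i
  set CX := ∏ i, crowdWeight T P (· < ·) X i + ∏ i, crowdWeight T P (· > ·) X i
  set SX := ∏ i ∈ Pᶜ, siteWeight β lam T P Y i (X i)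
  set SY := ∏ i ∈ Pᶜ, siteWeight β lam T P X i (Y i)
  set M := ∏ i ∈ P, pairWeight β lam (T ^ 6)⁻¹ (X i - Y i)
  have hT0 : 0 < T := by linarith
  have hmain : WX * WY * (T ^ 2) ^ Pᶜ.card ≤ (SX * CY + SY * CX) / 4 := by
    have h2 : (T ^ 2) ^ Pᶜ.card ≤ (T ^ ax * (T ^ 2) ^ ky) * (T ^ ay * (T ^ 2) ^ kx) := by
      have : (T ^ ax * (T ^ 2) ^ ky) * (T ^ ay * (T ^ 2) ^ kx) = T ^ (ax + ay + 2 * kx + 2 * ky) := by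
        rw [← pow_mul, ← pow_mul]; ring
      rw [this, ← pow_mul]
      exact pow_le_pow_right₀ hT (by omega)
    have h3 : WX * WY * (T ^ 2) ^ Pᶜ.card ≤
        (WX * (T ^ ax * (T ^ 2) ^ ky)) * (WY * (T ^ ay * (T ^ 2) ^ kx)) := by
      refine (mul_le_mul_of_nonneg_left h2 (by positivity)).trans (le_of_eq (by ring))
    have h4 : (WX * (T ^ ax * (T ^ 2) ^ ky)) ^ 2 ≤ SX * (CY / 2) := by
      have : (WX * (T ^ ax * (T ^ 2) ^ ky)) ^ 2 = (WX ^ 2 * (T ^ 2) ^ ax) * (T ^ 4) ^ ky := by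
        rw [← pow_mul, ← pow_mul, ← pow_mul]; ring
      rw [this]
      exact mul_le_mul hX hcY (by positivity) ((by positivity : 0 ≤ WX ^ 2 * (T ^ 2) ^ ax).trans hX)
    have h5 : (WY * (T ^ ay * (T ^ 2) ^ kx)) ^ 2 ≤ SY * (CX / 2) := by
      have : (WY * (T ^ ay * (T ^ 2) ^ kx)) ^ 2 = (WY ^ 2 * (T ^ 2) ^ ay) * (T ^ 4) ^ kx := by
        rw [← pow_mul, ← pow_mul, ← pow_mul]; ring
      rw [this]
      exact mul_le_mul hY hcX (by positivity) ((by positivity : 0 ≤ WY ^ 2 * (T ^ 2) ^ ay).trans hY)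
    nlinarith [sq_nonneg ((WX * (T ^ ax * (T ^ 2) ^ ky)) - (WY * (T ^ ay * (T ^ 2) ^ kx)))]
  have hTn : 0 < (T ^ 2) ^ Pᶜ.card := by positivity
  have h6 : WX * WY ≤ (T ^ 2)⁻¹ ^ Pᶜ.card * ((SX * CY + SY * CX) / 4) := by
    rw [inv_pow, inv_mul_eq_div, le_div_iff₀ hTn]
    exact hmain
  refine (mul_le_mul_of_nonneg_left h6 hm).trans (le_of_eq (by ring))

end

/-! ### Iterated integration over configurations -/

section
variable {ι Ω : Type*} [Fintype ι] [MeasurableSpace Ω]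

lemma lintegral_prod_le_prod [DecidableEq ι] (ν : Measure Ω) [SigmaFinite ν] (rank : ι → ℤ)
    {k : ι → (ι → Ω) → ℝ≥0∞} (hk : ∀ i, Measurable (k i)) {c : ι → ℝ≥0∞}
    (hdep : ∀ i j, i ≠ j → rank i ≤ rank j → ∀ Y a, k i (Function.update Y j a) = k i Y)
    (hc : ∀ i Y, ∫⁻ a, k i (Function.update Y i a) ∂ν ≤ c i) :
    ∫⁻ Y, ∏ i, k i Y ∂(Measure.pi fun _ => ν) ≤ ∏ i, c i := by
  rcases isEmpty_or_nonempty (ι → Ω) with h | ⟨⟨Y₀⟩⟩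
  · simp [lintegral_of_isEmpty]
  rw [lintegral_eq_lmarginal_univ Y₀]
  have key : ∀ s : Finset ι, ∀ Y,
      (∫⋯∫⁻_s, (fun Y => ∏ i ∈ s, k i Y) ∂(fun _ => ν)) Y ≤ ∏ i ∈ s, c i := by
    intro s
    induction s using Finset.induction_on_max_value rank with
    | empty => intro Y; simp
    | insert a s ha hmax ih =>
      intro Y
      rw [lmarginal_insert' _ (Finset.measurable_fun_prod _ fun i _ => hk i) ha,
        Finset.prod_insert ha]
      have h1 : (fun x => ∫⁻ y, ∏ i ∈ insert a s, k i (Function.update x a y) ∂ν) ≤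
          fun x => c a * ∏ i ∈ s, k i x := by
        intro x
        have h2 : ∀ y, ∏ i ∈ insert a s, k i (Function.update x a y) =
            k a (Function.update x a y) * ∏ i ∈ s, k i x := by
          intro y
          rw [Finset.prod_insert ha]
          congr 1
          exact Finset.prod_congr rfl fun i hi =>
            hdep i a (fun h => ha (h ▸ hi)) (hmax i hi) x y
        simp only [h2]
        rw [lintegral_mul_const (f := fun y => k a (Function.update x a y)) _
          ((hk a).comp (measurable_update x))]
        exact mul_le_mul_left (hc a x) _
      refine (lmarginal_mono h1 Y).trans ?_
      rw [lmarginal, lintegral_const_mul]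
      · exact mul_le_mul_right (ih Y) _
      · exact (Finset.measurable_fun_prod _ fun i _ => hk i).comp measurable_updateFinset
  exact key Finset.univ Y₀

lemma prod_le_lintegral_prod [DecidableEq ι] (ν : Measure Ω) [SigmaFinite ν] (rank : ι → ℤ) [Nonempty Ω]
    {k : ι → (ι → Ω) → ℝ≥0∞} (hk : ∀ i, Measurable (k i)) {c : ι → ℝ≥0∞}
    (hdep : ∀ i j, i ≠ j → rank i ≤ rank j → ∀ Y a, k i (Function.update Y j a) = k i Y)
    (hc : ∀ i Y, c i ≤ ∫⁻ a, k i (Function.update Y i a) ∂ν) :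
    ∏ i, c i ≤ ∫⁻ Y, ∏ i, k i Y ∂(Measure.pi fun _ => ν) := by
  obtain ⟨Y₀⟩ : Nonempty (ι → Ω) := inferInstance
  rw [lintegral_eq_lmarginal_univ Y₀]
  have key : ∀ s : Finset ι, ∀ Y,
      ∏ i ∈ s, c i ≤ (∫⋯∫⁻_s, (fun Y => ∏ i ∈ s, k i Y) ∂(fun _ => ν)) Y := by
    intro s
    induction s using Finset.induction_on_max_value rank with
    | empty => intro Y; simp
    | insert a s ha hmax ih =>
      intro Y
      rw [lmarginal_insert' _ (Finset.measurable_fun_prod _ fun i _ => hk i) ha,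
        Finset.prod_insert ha]
      have h1 : (fun x => c a * ∏ i ∈ s, k i x) ≤
          (fun x => ∫⁻ y, ∏ i ∈ insert a s, k i (Function.update x a y) ∂ν) := by
        intro x
        have h2 : ∀ y, ∏ i ∈ insert a s, k i (Function.update x a y) =
            k a (Function.update x a y) * ∏ i ∈ s, k i x := by
          intro y
          rw [Finset.prod_insert ha]
          congr 1
          exact Finset.prod_congr rfl fun i hi =>
            hdep i a (fun h => ha (h ▸ hi)) (hmax i hi) x y
        simp only [h2]
        rw [lintegral_mul_const (f := fun y => k a (Function.update x a y)) _
          ((hk a).comp (measurable_update x))]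
        exact mul_le_mul_left (hc a x) _
      refine le_trans ?_ (lmarginal_mono h1 Y)
      rw [lmarginal, lintegral_const_mul]
      · exact mul_le_mul_right (ih Y) _
      · exact (Finset.measurable_fun_prod _ fun i _ => hk i).comp measurable_updateFinset
  exact key Finset.univ Y₀

lemma measurePreserving_comp_perm (ν : Measure Ω) [SigmaFinite ν] (σ : Equiv.Perm ι) :
    MeasurePreserving (fun Y : ι → Ω => Y ∘ σ) (Measure.pi fun _ => ν) (Measure.pi fun _ => ν) := by
  have h := measurePreserving_piCongrLeft (fun _ : ι => ν) σ.symm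
  convert h using 1
  ext Y i
  simp [MeasurableEquiv.piCongrLeft, Equiv.piCongrLeft_apply_eq_cast]

/-- Exchange the two configurations at the indices in `S`. -/
def swapOn (S : Finset ι) (p : (ι → Ω) × (ι → Ω)) : (ι → Ω) × (ι → Ω) :=
  (fun i => if i ∈ S then p.2 i else p.1 i, fun i => if i ∈ S then p.1 i else p.2 i)

lemma measurePreserving_swapOn (ν : Measure Ω) [SigmaFinite ν] (S : Finset ι) :
    MeasurePreserving (swapOn S : (ι → Ω) × (ι → Ω) → (ι → Ω) × (ι → Ω))
      ((Measure.pi fun _ => ν).prod (Measure.pi fun _ => ν))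
      ((Measure.pi fun _ => ν).prod (Measure.pi fun _ => ν)) := by
  have h1 := measurePreserving_arrowProdEquivProdArrow Ω Ω ι (fun _ => ν) (fun _ => ν)
  have h2 : MeasurePreserving (fun (f : ι → Ω × Ω) i => (if i ∈ S then Prod.swap else id) (f i))
      (Measure.pi fun _ => ν.prod ν) (Measure.pi fun _ => ν.prod ν) := by
    refine measurePreserving_pi _ _ fun i => ?_
    split_ifs
    · exact Measure.measurePreserving_swap
    · exact MeasurePreserving.id _
  have h3 := h1.comp (h2.comp h1.symm)
  convert h3 using 1
  ext p i
  · by_cases h : i ∈ S <;>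
      simp [swapOn, MeasurableEquiv.arrowProdEquivProdArrow, Equiv.arrowProdEquivProdArrow, h]
  · by_cases h : i ∈ S <;>
      simp [swapOn, MeasurableEquiv.arrowProdEquivProdArrow, Equiv.arrowProdEquivProdArrow, h]

end

lemma volume_square (a b : ℝ) :
    volume {x : E2 | ∀ i, x i ∈ Set.Icc a b} = ENNReal.ofReal (b - a) ^ 2 := by
  have h1 : {x : E2 | ∀ i, x i ∈ Set.Icc a b} =
      (MeasurableEquiv.toLp 2 (Fin 2 → ℝ)).symm ⁻¹' (Set.pi Set.univ fun _ => Set.Icc a b) := by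
    ext x; simp only [Set.mem_preimage, Set.mem_univ_pi]; rfl
  rw [h1, (EuclideanSpace.volume_preserving_symm_measurableEquiv_toLp (Fin 2)).measure_preimage_equiv,
    volume_pi_pi]
  simp

lemma measurableSet_square (a b : ℝ) : MeasurableSet {x : E2 | ∀ i, x i ∈ Set.Icc a b} := by
  have : {x : E2 | ∀ i, x i ∈ Set.Icc a b} = ⋂ i, {x : E2 | x i ∈ Set.Icc a b} := by ext; simp
  rw [this]
  exact MeasurableSet.iInter fun i => (by fun_prop : Measurable fun x : E2 => x i) measurableSet_Icc

lemma volume_LamBox (N : ℕ) : volume (LamBox N) = N := by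
  rw [LamBox, volume_square, sub_zero, ← ENNReal.ofReal_pow (Real.sqrt_nonneg _),
    Real.sq_sqrt (Nat.cast_nonneg _), ENNReal.ofReal_natCast]

/-- Lebesgue measure on the box `Λ`. -/
def boxMeasure (N : ℕ) : Measure E2 := volume.restrict (LamBox N)

lemma boxMeasure_univ (N : ℕ) : boxMeasure N Set.univ = N := by
  rw [boxMeasure, Measure.restrict_apply_univ, volume_LamBox]

instance (N : ℕ) : IsFiniteMeasure (boxMeasure N) :=
  ⟨by rw [boxMeasure_univ]; exact ENNReal.natCast_lt_top N⟩

lemma boxMeasure_le (N : ℕ) : boxMeasure N ≤ volume := Measure.restrict_le_self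

/-- Lebesgue measure on the configurations of `N` points in the box. -/
def confMeasure (N : ℕ) : Measure (Fin N → E2) := Measure.pi fun _ => boxMeasure N

instance (N : ℕ) : IsFiniteMeasure (confMeasure N) := by unfold confMeasure; infer_instance

lemma volume_restrict_confSet (N : ℕ) :
    volume.restrict (confSet N) = (confMeasure N).prod (confMeasure N) := by
  have h : confSet N = (Set.pi Set.univ fun _ : Fin N => LamBox N) ×ˢ
      (Set.pi Set.univ fun _ : Fin N => LamBox N) := by
    ext P; simp [confSet]
  rw [h, confMeasure]
  simp only [boxMeasure]
  rw [← Measure.restrict_pi_pi, Measure.prod_restrict]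
  rfl

/-! ### Integration of the pointwise bound -/

lemma lintegral_affine_sum_le {ι Ω : Type*} [MeasurableSpace Ω] {ν : Measure Ω} {a b I V : ℝ}
    (ha : 0 ≤ a) (hb : 0 ≤ b) (hI : 0 ≤ I) (hV : 0 ≤ V) (hν : ν Set.univ ≤ ENNReal.ofReal V)
    (S : Finset ι) {f : ι → Ω → ℝ} (hf : ∀ j ∈ S, Measurable (f j)) (hf0 : ∀ j ∈ S, ∀ x, 0 ≤ f j x)
    (hfI : ∀ j ∈ S, ∫⁻ x, ENNReal.ofReal (f j x) ∂ν ≤ ENNReal.ofReal I) :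
    ∫⁻ x, ENNReal.ofReal (a + b * ∑ j ∈ S, f j x) ∂ν ≤ ENNReal.ofReal (a * V + b * (S.card * I)) := by
  have h1 : ∀ x, ENNReal.ofReal (a + b * ∑ j ∈ S, f j x) =
      ENNReal.ofReal a + ENNReal.ofReal b * ∑ j ∈ S, ENNReal.ofReal (f j x) := by
    intro x
    have hs : 0 ≤ ∑ j ∈ S, f j x := Finset.sum_nonneg fun j hj => hf0 j hj x
    rw [ENNReal.ofReal_add ha (mul_nonneg hb hs), ENNReal.ofReal_mul hb,
      ENNReal.ofReal_sum_of_nonneg fun j hj => hf0 j hj x]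
  simp only [h1]
  rw [lintegral_add_left measurable_const, lintegral_const, lintegral_const_mul,
    lintegral_finsetSum' _ fun j hj => (hf j hj).ennreal_ofReal.aemeasurable,
    ENNReal.ofReal_add (by positivity) (by positivity), ENNReal.ofReal_mul ha,
    ENNReal.ofReal_mul hb, ENNReal.ofReal_mul (Nat.cast_nonneg _), ENNReal.ofReal_natCast]
  · gcongr
    refine (Finset.sum_le_sum hfI).trans ?_
    simp
  · exact Finset.measurable_fun_sum _ fun j hj => (hf j hj).ennreal_ofReal

lemma measurable_pairWeight (β : ℝ) {lam : ℝ} (hlam : 0 < lam) (ε : ℝ) :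
    Measurable (pairWeight β lam ε) := by
  unfold pairWeight
  refine Measurable.ite (measurableSet_le measurable_norm measurable_const) ?_ measurable_const
  exact Real.measurable_exp.comp ((measurable_gsm hlam).const_mul β)

section
variable {N : ℕ} {β lam T : ℝ} {P : Finset (Fin N)}

lemma measurable_siteWeight (hlam : 0 < lam) (i : Fin N) :
    Measurable fun p : (Fin N → E2) × E2 => siteWeight β lam T P p.1 i p.2 := by
  have h := measurable_pairWeight β hlam (T ^ 6)⁻¹
  unfold siteWeight
  split_ifs
  · exact h.comp (by fun_prop)
  · refine (Measurable.const_add ?_ _).const_mul _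
    exact Finset.measurable_fun_sum _ fun j _ => h.comp (by fun_prop)

lemma measurable_siteWeight_right (hlam : 0 < lam) (Y : Fin N → E2) (i : Fin N) :
    Measurable (siteWeight β lam T P Y i) := by
  have h := measurable_siteWeight (β := β) (T := T) (P := P) hlam i
  have h2 : Measurable fun x : E2 => (Y, x) := by fun_prop
  have h3 := h.comp h2
  exact h3

lemma measurable_crowdWeight (prec : Fin N → Fin N → Prop) (i : Fin N) :
    Measurable fun Y : Fin N → E2 => crowdWeight T P prec Y i := by
  unfold crowdWeight
  split_ifs
  · exact measurable_const
  · refine (Measurable.const_mul ?_ _).const_add _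
    refine Finset.measurable_fun_sum _ fun k _ => ?_
    by_cases h : prec k i
    · simp only [h, true_and]
      exact Measurable.ite (measurableSet_le (by fun_prop) measurable_const) measurable_const
        measurable_const
    · simp only [h, false_and, if_false]
      exact measurable_const

lemma prod_ite_mem_const (P : Finset (Fin N)) (a b : ℝ) :
    ∏ i, (if i ∈ P then a else b) = a ^ P.card * b ^ Pᶜ.card := by
  rw [← Finset.prod_mul_prod_compl P, ← Finset.prod_const, ← Finset.prod_const]
  congr 1
  · exact Finset.prod_congr rfl fun i hi => if_pos hi
  · exact Finset.prod_congr rfl fun i hi => if_neg (Finset.mem_compl.1 hi)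

lemma lintegral_pairWeight_sub_le {ε I : ℝ}
    (hI : ∫⁻ z, ENNReal.ofReal (pairWeight β lam ε z) ≤ ENNReal.ofReal I) (y : E2) :
    ∫⁻ x, ENNReal.ofReal (pairWeight β lam ε (x - y)) ∂boxMeasure N ≤ ENNReal.ofReal I := by
  refine (lintegral_mono' (boxMeasure_le N) le_rfl).trans ?_
  rwa [lintegral_sub_right_eq_self (fun z => ENNReal.ofReal (pairWeight β lam ε z)) y]

lemma lintegral_siteWeight_le (hlam : 0 < lam) {I : ℝ} (hI0 : 0 ≤ I)
    (hI : ∫⁻ z, ENNReal.ofReal (pairWeight β lam (T ^ 6)⁻¹ z) ≤ ENNReal.ofReal I)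
    (Y : Fin N → E2) :
    ∫⁻ X, ∏ i, ENNReal.ofReal (siteWeight β lam T P Y i (X i)) ∂confMeasure N ≤
      ENNReal.ofReal (I ^ P.card *
        (siteConst β * (T ^ 2 * (T ^ 6) ^ β * N + Pᶜ.card * I)) ^ Pᶜ.card) := by
  have hK := siteConst_pos β
  have hT6 : 0 ≤ (T ^ 6) ^ β := Real.rpow_nonneg (by positivity) _
  refine (lintegral_prod_le_prod (boxMeasure N) (fun _ => 0)
    (k := fun i X => ENNReal.ofReal (siteWeight β lam T P Y i (X i)))
    (fun i => ((measurable_siteWeight_right hlam Y i).comp (measurable_pi_apply i)).ennreal_ofReal)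
    (c := fun i => ENNReal.ofReal (if i ∈ P then I else
      siteConst β * (T ^ 2 * (T ^ 6) ^ β * N + Pᶜ.card * I)))
    (fun i j hij _ X a => ?_) (fun i X => ?_)).trans ?_
  · simp only [Function.update_of_ne hij]
  · simp only [Function.update_self]
    unfold siteWeight
    split_ifs with h
    · exact lintegral_pairWeight_sub_le hI (Y i)
    · have := lintegral_affine_sum_le (ν := boxMeasure N) (V := N)
        (a := siteConst β * (T ^ 2 * (T ^ 6) ^ β)) (b := siteConst β) (by positivity) hK.le hI0
        (Nat.cast_nonneg N) (by rw [boxMeasure_univ, ENNReal.ofReal_natCast]) Pᶜ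
        (f := fun j x => pairWeight β lam (T ^ 6)⁻¹ (x - Y j))
        (fun j _ => (measurable_pairWeight β hlam _).comp (measurable_sub_const _))
        (fun j _ x => pairWeight_nonneg _ _ _ _)
        (fun j _ => lintegral_pairWeight_sub_le hI (Y j))
      refine le_trans (lintegral_mono fun x => le_of_eq ?_) (this.trans (le_of_eq ?_))
      · rw [mul_add]
      · congr 1; ring
  · rw [← ENNReal.ofReal_prod_of_nonneg, prod_ite_mem_const]
    intro i _
    split_ifs <;> positivity

lemma lintegral_crowdWeight_le (hT : 0 < T) (prec : Fin N → Fin N → Prop) (rank : Fin N → ℤ)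
    (hprec : ∀ k i, prec k i → rank k < rank i) :
    ∫⁻ Y, ∏ i, ENNReal.ofReal (crowdWeight T P prec Y i) ∂confMeasure N ≤
      ENNReal.ofReal ((N : ℝ) ^ P.card * ((1 + 4 * π) * N) ^ Pᶜ.card) := by
  have hπ := Real.pi_pos
  refine (lintegral_prod_le_prod (boxMeasure N) rank
    (k := fun i Y => ENNReal.ofReal (crowdWeight T P prec Y i))
    (fun i => (measurable_crowdWeight prec i).ennreal_ofReal)
    (c := fun i => ENNReal.ofReal (if i ∈ P then (N : ℝ) else (1 + 4 * π) * N))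
    (fun i j hij hr Y a => ?_) (fun i Y => ?_)).trans ?_
  · unfold crowdWeight
    congr 1
    refine if_congr Iff.rfl rfl ?_
    congr 2
    refine Finset.sum_congr rfl fun k _ => if_congr (and_congr_right fun hk => ?_) rfl rfl
    have hkj : k ≠ j := by
      rintro rfl
      exact absurd (hprec _ _ hk) (not_lt.2 hr)
    rw [Function.update_of_ne hij, Function.update_of_ne hkj]
  · unfold crowdWeight
    split_ifs with h
    · simp [boxMeasure_univ]
    · have hupd : ∀ (a : E2) (k : Fin N), (if prec k i ∧
          ‖Function.update Y i a i - Function.update Y i a k‖ ≤ 2 * (T ^ 4)⁻¹ then (1 : ℝ) else 0) =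
          if prec k i ∧ ‖a - Y k‖ ≤ 2 * (T ^ 4)⁻¹ then 1 else 0 := by
        intro a k
        refine if_congr (and_congr_right fun hk => ?_) rfl rfl
        have hki : k ≠ i := by
          rintro rfl
          exact lt_irrefl _ (hprec _ _ hk)
        rw [Function.update_self, Function.update_of_ne hki]
      simp only [hupd]
      have hmeas : ∀ k, MeasurableSet {a : E2 | prec k i ∧ ‖a - Y k‖ ≤ 2 * (T ^ 4)⁻¹} := by
        intro k
        by_cases hk : prec k i
        · simp only [hk, true_and]
          exact measurableSet_le (by fun_prop) measurable_const
        · simp [hk]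
      have := lintegral_affine_sum_le (ν := boxMeasure N) (V := N) (a := 1) (b := T ^ 8)
        (I := 4 * π * (T ^ 8)⁻¹) zero_le_one (by positivity) (by positivity)
        (Nat.cast_nonneg N) (by rw [boxMeasure_univ, ENNReal.ofReal_natCast]) Pᶜ
        (f := fun k a => if prec k i ∧ ‖a - Y k‖ ≤ 2 * (T ^ 4)⁻¹ then 1 else 0)
        (fun k _ => Measurable.ite (hmeas k) measurable_const measurable_const)
        (fun j _ x => by split_ifs <;> norm_num)
        (fun k _ => by
          have h1 : ∀ a : E2, ENNReal.ofReal (if prec k i ∧ ‖a - Y k‖ ≤ 2 * (T ^ 4)⁻¹ then 1 else 0)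
              ≤ (Metric.closedBall (Y k) (2 * (T ^ 4)⁻¹)).indicator 1 a := by
            intro a
            by_cases ha : ‖a - Y k‖ ≤ 2 * (T ^ 4)⁻¹
            · rw [Set.indicator_of_mem (by rwa [mem_closedBall_iff_norm])]
              split_ifs <;> simp
            · simp [ha]
          refine (lintegral_mono h1).trans ?_
          rw [lintegral_indicator_one Metric.isClosed_closedBall.measurableSet]
          refine (boxMeasure_le N _).trans ?_
          rw [EuclideanSpace.volume_closedBall_fin_two, ← ENNReal.ofReal_pow (by positivity),
            ← ENNReal.ofReal_mul (by positivity)]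
          refine le_of_eq (congrArg _ ?_)
          field_simp
          norm_num)
      refine this.trans (ENNReal.ofReal_le_ofReal ?_)
      have hc : (Pᶜ.card : ℝ) ≤ N := by
        have := Finset.card_le_univ Pᶜ
        rw [Fintype.card_fin] at this
        exact_mod_cast this
      have : T ^ 8 * (Pᶜ.card * (4 * π * (T ^ 8)⁻¹)) = 4 * π * Pᶜ.card := by field_simp
      rw [this]
      nlinarith
  · rw [← ENNReal.ofReal_prod_of_nonneg, prod_ite_mem_const]
    intro i _
    split_ifs <;> positivity

/-- The weight of a configuration in the bound for the Boltzmann factor. -/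
def configWeight (β lam T : ℝ) (P : Finset (Fin N)) (prec : Fin N → Fin N → Prop)
    (p : (Fin N → E2) × (Fin N → E2)) : ℝ :=
  (∏ i, siteWeight β lam T P p.2 i (p.1 i)) * ∏ i, crowdWeight T P prec p.2 i

lemma configWeight_nonneg (prec : Fin N → Fin N → Prop) (p : (Fin N → E2) × (Fin N → E2)) :
    0 ≤ configWeight β lam T P prec p :=
  mul_nonneg (Finset.prod_nonneg fun i _ => siteWeight_nonneg i _)
    (Finset.prod_nonneg fun i _ => zero_le_one.trans (one_le_crowdWeight prec i))

lemma measurable_configWeight (hlam : 0 < lam) (prec : Fin N → Fin N → Prop) :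
    Measurable (configWeight β lam T P prec) := by
  refine Measurable.mul ?_ ?_
  · refine Finset.measurable_fun_prod _ fun i _ => ?_
    have h := measurable_siteWeight (β := β) (T := T) (P := P) hlam i
    have h2 : Measurable fun p : (Fin N → E2) × (Fin N → E2) => (p.2, p.1 i) := by fun_prop
    have h3 := h.comp h2
    exact h3
  · exact Finset.measurable_fun_prod _ fun i _ => (measurable_crowdWeight prec i).comp measurable_snd

lemma lintegral_configWeight_le (hlam : 0 < lam) (hT : 0 < T) {I : ℝ} (hI0 : 0 ≤ I)
    (hI : ∫⁻ z, ENNReal.ofReal (pairWeight β lam (T ^ 6)⁻¹ z) ≤ ENNReal.ofReal I)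
    (prec : Fin N → Fin N → Prop) (rank : Fin N → ℤ) (hprec : ∀ k i, prec k i → rank k < rank i) :
    ∫⁻ p, ENNReal.ofReal (configWeight β lam T P prec p) ∂((confMeasure N).prod (confMeasure N)) ≤
      ENNReal.ofReal (I ^ P.card *
        (siteConst β * (T ^ 2 * (T ^ 6) ^ β * N + Pᶜ.card * I)) ^ Pᶜ.card *
        ((N : ℝ) ^ P.card * ((1 + 4 * π) * N) ^ Pᶜ.card)) := by
  have hT6 : 0 ≤ (T ^ 6) ^ β := Real.rpow_nonneg (by positivity) _
  have hK := siteConst_pos β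
  rw [lintegral_prod_symm _ (measurable_configWeight hlam prec).ennreal_ofReal.aemeasurable]
  have h1 : ∀ X Y, ENNReal.ofReal (configWeight β lam T P prec (X, Y)) =
      (∏ i, ENNReal.ofReal (siteWeight β lam T P Y i (X i))) *
        ∏ i, ENNReal.ofReal (crowdWeight T P prec Y i) := by
    intro X Y
    rw [configWeight, ENNReal.ofReal_mul (Finset.prod_nonneg fun i _ => siteWeight_nonneg i _),
      ENNReal.ofReal_prod_of_nonneg fun i _ => siteWeight_nonneg i _,
      ENNReal.ofReal_prod_of_nonneg fun i _ => zero_le_one.trans (one_le_crowdWeight prec i)]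
  simp only [h1]
  have hm1 : ∀ Y, Measurable fun X : Fin N → E2 =>
      ∏ i, ENNReal.ofReal (siteWeight β lam T P Y i (X i)) := fun Y =>
    Finset.measurable_fun_prod _ fun i _ =>
      ((measurable_siteWeight_right hlam Y i).comp (measurable_pi_apply i)).ennreal_ofReal
  have hm2 : Measurable fun Y : Fin N → E2 => ∏ i, ENNReal.ofReal (crowdWeight T P prec Y i) :=
    Finset.measurable_fun_prod _ fun i _ => (measurable_crowdWeight prec i).ennreal_ofReal
  calc _ = ∫⁻ Y, (∫⁻ X, ∏ i, ENNReal.ofReal (siteWeight β lam T P Y i (X i)) ∂confMeasure N) *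
        ∏ i, ENNReal.ofReal (crowdWeight T P prec Y i) ∂confMeasure N :=
        lintegral_congr fun Y => lintegral_mul_const _ (hm1 Y)
    _ ≤ ∫⁻ Y, _ * ∏ i, ENNReal.ofReal (crowdWeight T P prec Y i) ∂confMeasure N :=
        lintegral_mono fun Y => mul_le_mul_left (lintegral_siteWeight_le hlam hI0 hI Y) _
    _ = _ * ∫⁻ Y, ∏ i, ENNReal.ofReal (crowdWeight T P prec Y i) ∂confMeasure N :=
        lintegral_const_mul _ hm2
    _ ≤ _ := by
      rw [ENNReal.ofReal_mul (p := I ^ P.card *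
        (siteConst β * (T ^ 2 * (T ^ 6) ^ β * N + Pᶜ.card * I)) ^ Pᶜ.card) (by positivity)]
      exact mul_le_mul_right (lintegral_crowdWeight_le hT prec rank hprec) _

end

/-! ### The upper bound for the partition function -/

lemma Flam_comp_perm {N : ℕ} (lam : ℝ) (X Y : Fin N → E2) (σ : Equiv.Perm (Fin N)) :
    Flam N lam X (Y ∘ σ) = Flam N lam X Y := by
  unfold Flam
  congr 2
  simp only [Finset.sum_sub_distrib, Finset.sum_add_distrib, ← Finset.mul_sum, Function.comp_apply]
  have h1 : ∑ i, ∑ j, gsm lam (Y (σ i) - Y (σ j)) = ∑ i, ∑ j, gsm lam (Y i - Y j) := by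
    rw [Equiv.sum_comp σ fun i => ∑ j, gsm lam (Y i - Y (σ j))]
    exact Finset.sum_congr rfl fun i _ => Equiv.sum_comp σ fun j => gsm lam (Y i - Y j)
  have h2 : ∑ i, ∑ j, gsm lam (X i - Y (σ j)) = ∑ i, ∑ j, gsm lam (X i - Y j) :=
    Finset.sum_congr rfl fun i _ => Equiv.sum_comp σ fun j => gsm lam (X i - Y j)
  rw [h1, h2]

lemma measurePreserving_comp_perm_snd (N : ℕ) (σ : Equiv.Perm (Fin N)) :
    MeasurePreserving (fun p : (Fin N → E2) × (Fin N → E2) => (p.1, p.2 ∘ σ))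
      ((confMeasure N).prod (confMeasure N)) ((confMeasure N).prod (confMeasure N)) :=
  (MeasurePreserving.id _).prod (measurePreserving_comp_perm (boxMeasure N) σ)

section
variable {N : ℕ} {β lam T : ℝ}

/-- The total weight bounding the Boltzmann factor when the isolated dipoles are given by `P`. -/
def totalWeight (β lam T : ℝ) (P : Finset (Fin N)) (p : (Fin N → E2) × (Fin N → E2)) : ℝ :=
  Real.exp (N * (4 * β * tentLip * (T ^ 2)⁻¹)) * ((T ^ 2)⁻¹ ^ Pᶜ.card / 4 *
    (configWeight β lam T P (· < ·) p + configWeight β lam T P (· > ·) p +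
      (configWeight β lam T P (· < ·) p.swap + configWeight β lam T P (· > ·) p.swap)))

lemma totalWeight_nonneg (P : Finset (Fin N)) (p : (Fin N → E2) × (Fin N → E2)) :
    0 ≤ totalWeight β lam T P p := by
  unfold totalWeight
  have h1 := configWeight_nonneg (β := β) (lam := lam) (T := T) (P := P) (· < ·) p
  have h2 := configWeight_nonneg (β := β) (lam := lam) (T := T) (P := P) (· > ·) p
  have h3 := configWeight_nonneg (β := β) (lam := lam) (T := T) (P := P) (· < ·) p.swap
  have h4 := configWeight_nonneg (β := β) (lam := lam) (T := T) (P := P) (· > ·) p.swap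
  positivity

lemma measurable_totalWeight (hlam : 0 < lam) (P : Finset (Fin N)) :
    Measurable (totalWeight β lam T P) := by
  have h1 := measurable_configWeight (β := β) (T := T) (P := P) hlam (· < ·)
  have h2 := measurable_configWeight (β := β) (T := T) (P := P) hlam (· > ·)
  have h3 := h1.comp measurable_swap
  have h4 := h2.comp measurable_swap
  exact (((h1.add h2).add (h3.add h4)).const_mul _).const_mul _

lemma exp_neg_mul_Flam_le_totalWeight (hβ : 0 ≤ β) (hlam : 0 < lam) (hT : 1 ≤ T)
    (hε : 4 * lam ≤ (T ^ 6)⁻¹) (X Y : Fin N → E2) :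
    Real.exp (-β * Flam N lam X Y) ≤
      ∑ P : Finset (Fin N), ∑ σ : Equiv.Perm (Fin N),
        ((Pᶜ.card).factorial : ℝ)⁻¹ * totalWeight β lam T P (X, Y ∘ σ) := by
  have hεR : (T ^ 6)⁻¹ ≤ (T ^ 4)⁻¹ :=
    inv_anti₀ (by positivity) (pow_le_pow_right₀ hT (by norm_num))
  obtain ⟨P, σ, hM⟩ := exists_matchedOn hεR X Y
  refine le_trans ?_ (Finset.single_le_sum (f := fun P : Finset (Fin N) =>
    ∑ σ : Equiv.Perm (Fin N), ((Pᶜ.card).factorial : ℝ)⁻¹ * totalWeight β lam T P (X, Y ∘ σ))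
    (fun P _ => Finset.sum_nonneg fun σ _ => mul_nonneg (by positivity) (totalWeight_nonneg _ _))
    (Finset.mem_univ P))
  have h1 := factorial_le_card_matchedOn hM
  rw [← Finset.mul_sum, ← div_eq_inv_mul, le_div_iff₀ (by positivity), mul_comm]
  refine le_trans ?_ (Finset.sum_le_sum_of_subset_of_nonneg (Finset.filter_subset
    (fun τ : Equiv.Perm (Fin N) => MatchedOn (T ^ 4)⁻¹ (T ^ 6)⁻¹ P X (Y ∘ τ)) _)
    fun τ _ _ => totalWeight_nonneg _ _)
  have h2 : ∀ τ ∈ Finset.univ.filter (fun τ : Equiv.Perm (Fin N) =>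
      MatchedOn (T ^ 4)⁻¹ (T ^ 6)⁻¹ P X (Y ∘ τ)),
      Real.exp (-β * Flam N lam X Y) ≤ totalWeight β lam T P (X, Y ∘ τ) := by
    intro τ hτ
    have h3 := exp_neg_mul_Flam_le hβ hlam hT hε (Finset.mem_filter.1 hτ).2
    rw [Flam_comp_perm] at h3
    refine h3.trans (le_of_eq ?_)
    simp only [totalWeight, configWeight, Prod.fst_swap, Prod.snd_swap]
    ring
  have h4 := Finset.card_nsmul_le_sum _ _ _ h2
  rw [nsmul_eq_mul] at h4
  refine le_trans ?_ h4
  gcongr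

lemma lintegral_totalWeight_le (hlam : 0 < lam) (hT : 0 < T) {I : ℝ} (hI0 : 0 ≤ I)
    (hI : ∫⁻ z, ENNReal.ofReal (pairWeight β lam (T ^ 6)⁻¹ z) ≤ ENNReal.ofReal I)
    (P : Finset (Fin N)) :
    ∫⁻ p, ENNReal.ofReal (totalWeight β lam T P p) ∂((confMeasure N).prod (confMeasure N)) ≤
      ENNReal.ofReal (Real.exp (N * (4 * β * tentLip * (T ^ 2)⁻¹)) * ((T ^ 2)⁻¹ ^ Pᶜ.card *
        (I ^ P.card * (siteConst β * (T ^ 2 * (T ^ 6) ^ β * N + Pᶜ.card * I)) ^ Pᶜ.card *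
        ((N : ℝ) ^ P.card * ((1 + 4 * π) * N) ^ Pᶜ.card)))) := by
  set B := I ^ P.card * (siteConst β * (T ^ 2 * (T ^ 6) ^ β * N + Pᶜ.card * I)) ^ Pᶜ.card *
        ((N : ℝ) ^ P.card * ((1 + 4 * π) * N) ^ Pᶜ.card) with hB
  have hT6 : 0 ≤ (T ^ 6) ^ β := Real.rpow_nonneg (by positivity) _
  have hK := siteConst_pos β
  have hB0 : 0 ≤ B := by positivity
  have h1 := lintegral_configWeight_le (N := N) (P := P) hlam hT hI0 hI (· < ·) (fun i => (i : ℤ))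
    (fun k i h => by simpa using h)
  have h2 := lintegral_configWeight_le (N := N) (P := P) hlam hT hI0 hI (· > ·) (fun i => -(i : ℤ))
    (fun k i h => by simpa using h)
  rw [← hB] at h1 h2
  have m1 := (measurable_configWeight (β := β) (T := T) (P := P) hlam (· < ·)).ennreal_ofReal
  have m2 := (measurable_configWeight (β := β) (T := T) (P := P) hlam (· > ·)).ennreal_ofReal
  have hswap : MeasurePreserving (Prod.swap : (Fin N → E2) × (Fin N → E2) → _)
      ((confMeasure N).prod (confMeasure N)) ((confMeasure N).prod (confMeasure N)) :=
    Measure.measurePreserving_swap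
  have h3 := h1
  have h4 := h2
  rw [← hswap.lintegral_comp m1] at h3
  rw [← hswap.lintegral_comp m2] at h4
  have hn := fun (prec : Fin N → Fin N → Prop) (p : (Fin N → E2) × (Fin N → E2)) =>
    configWeight_nonneg (β := β) (lam := lam) (T := T) (P := P) prec p
  have hc : 0 ≤ Real.exp (N * (4 * β * tentLip * (T ^ 2)⁻¹)) * ((T ^ 2)⁻¹ ^ Pᶜ.card / 4) := by
    positivity
  have h5 : ∀ p, ENNReal.ofReal (totalWeight β lam T P p) =
      ENNReal.ofReal (Real.exp (N * (4 * β * tentLip * (T ^ 2)⁻¹)) * ((T ^ 2)⁻¹ ^ Pᶜ.card / 4)) *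
      (ENNReal.ofReal (configWeight β lam T P (· < ·) p) +
        ENNReal.ofReal (configWeight β lam T P (· > ·) p) +
      (ENNReal.ofReal (configWeight β lam T P (· < ·) p.swap) +
        ENNReal.ofReal (configWeight β lam T P (· > ·) p.swap))) := by
    intro p
    rw [← ENNReal.ofReal_add (hn _ _) (hn _ _), ← ENNReal.ofReal_add (hn _ _) (hn _ _),
      ← ENNReal.ofReal_add (add_nonneg (hn _ _) (hn _ _)) (add_nonneg (hn _ _) (hn _ _)),
      ← ENNReal.ofReal_mul hc, totalWeight]
    congr 1
    ring
  simp only [h5]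
  have m3 : Measurable fun p : (Fin N → E2) × (Fin N → E2) =>
      ENNReal.ofReal (configWeight β lam T P (· < ·) p.swap) := m1.comp measurable_swap
  have m12 : Measurable fun p : (Fin N → E2) × (Fin N → E2) =>
      ENNReal.ofReal (configWeight β lam T P (· < ·) p) +
        ENNReal.ofReal (configWeight β lam T P (· > ·) p) := m1.add m2
  rw [lintegral_const_mul' _ _ ENNReal.ofReal_ne_top, lintegral_add_left m12,
    lintegral_add_left m1, lintegral_add_left m3]
  refine (mul_le_mul_right (add_le_add (add_le_add h1 h2) (add_le_add h3 h4)) _).trans (le_of_eq ?_)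
  rw [← ENNReal.ofReal_add hB0 hB0, ← ENNReal.ofReal_add (by positivity) (by positivity),
    ← ENNReal.ofReal_mul hc]
  congr 1
  ring

/-- The constant in the upper bound for the partition function. -/
def upperConst (β L : ℝ) : ℝ :=
  4 * β * tentLip + L + siteConst β * (1 + 4 * π) * Real.exp 1

lemma weight_sum_le (hT : 0 < T) {I L : ℝ} (hI0 : 0 ≤ I) (hL : 0 ≤ L)
    (hTI : T ^ 2 * (T ^ 6) ^ β ≤ L * (T ^ 2)⁻¹ * I) (P : Finset (Fin N)) :
    ((Pᶜ.card).factorial : ℝ)⁻¹ * ((T ^ 2)⁻¹ ^ Pᶜ.card *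
        (I ^ P.card * (siteConst β * (T ^ 2 * (T ^ 6) ^ β * N + Pᶜ.card * I)) ^ Pᶜ.card *
        ((N : ℝ) ^ P.card * ((1 + 4 * π) * N) ^ Pᶜ.card))) ≤
      I ^ N * (N : ℝ) ^ N * Real.exp (L * (T ^ 2)⁻¹ * N) *
        (siteConst β * (1 + 4 * π) * Real.exp 1 * (T ^ 2)⁻¹) ^ Pᶜ.card := by
  have hK := siteConst_pos β
  have hT6 : 0 ≤ (T ^ 6) ^ β := Real.rpow_nonneg (by positivity) _
  have hN : P.card + Pᶜ.card = N := by
    rw [Finset.card_add_card_compl, Fintype.card_fin]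
  set n := Pᶜ.card with hn
  set m := P.card with hm
  set a := L * (T ^ 2)⁻¹ * N with ha
  have ha0 : 0 ≤ a := by positivity
  have h1 : siteConst β * (T ^ 2 * (T ^ 6) ^ β * N + n * I) ≤ siteConst β * ((a + n) * I) := by
    refine mul_le_mul_of_nonneg_left ?_ hK.le
    have := mul_le_mul_of_nonneg_right hTI (Nat.cast_nonneg N : (0 : ℝ) ≤ N)
    rw [ha]; linarith
  have h2 : (a + n) ^ n / n.factorial ≤ Real.exp a * Real.exp 1 ^ n := by
    rw [← Real.exp_nat_mul, mul_one, ← Real.exp_add]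
    exact Real.pow_div_factorial_le_exp _ (by positivity) n
  have h3 : (siteConst β * (T ^ 2 * (T ^ 6) ^ β * N + n * I)) ^ n ≤ (siteConst β * ((a + n) * I)) ^ n :=
    pow_le_pow_left₀ (by positivity) h1 n
  calc _ ≤ ((n.factorial : ℝ))⁻¹ * ((T ^ 2)⁻¹ ^ n * (I ^ m * (siteConst β * ((a + n) * I)) ^ n *
        ((N : ℝ) ^ m * ((1 + 4 * π) * N) ^ n))) := by gcongr
    _ = (I ^ m * I ^ n) * ((N : ℝ) ^ m * (N : ℝ) ^ n) * ((a + n) ^ n / n.factorial) *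
        (siteConst β * (1 + 4 * π) * (T ^ 2)⁻¹) ^ n := by
      simp only [mul_pow]; ring
    _ ≤ (I ^ m * I ^ n) * ((N : ℝ) ^ m * (N : ℝ) ^ n) * (Real.exp a * Real.exp 1 ^ n) *
        (siteConst β * (1 + 4 * π) * (T ^ 2)⁻¹) ^ n := by gcongr
    _ = _ := by
      rw [← pow_add, ← pow_add, hN]
      simp only [mul_pow]; ring

lemma lintegral_exp_neg_mul_Flam_le (hβ : 0 ≤ β) (hlam : 0 < lam) (hT : 1 ≤ T)
    (hε : 4 * lam ≤ (T ^ 6)⁻¹) {I L : ℝ} (hI0 : 0 ≤ I) (hL : 0 ≤ L)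
    (hI : ∫⁻ z, ENNReal.ofReal (pairWeight β lam (T ^ 6)⁻¹ z) ≤ ENNReal.ofReal I)
    (hTI : T ^ 2 * (T ^ 6) ^ β ≤ L * (T ^ 2)⁻¹ * I) (N : ℕ) :
    ∫⁻ p in confSet N, ENNReal.ofReal (Real.exp (-β * Flam N lam p.1 p.2)) ≤
      ENNReal.ofReal (N.factorial * (I ^ N * (N : ℝ) ^ N) *
        Real.exp (upperConst β L * (N * (T ^ 2)⁻¹))) := by
  have hT0 : 0 < T := by linarith
  have hK := siteConst_pos β
  have hT6 : 0 ≤ (T ^ 6) ^ β := Real.rpow_nonneg (by positivity) _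
  rw [volume_restrict_confSet]
  set D := siteConst β * (1 + 4 * π) * Real.exp 1 with hD
  have hD0 : 0 ≤ D := by positivity
  set E := Real.exp (N * (4 * β * tentLip * (T ^ 2)⁻¹)) with hE
  have hm : ∀ (P : Finset (Fin N)) (σ : Equiv.Perm (Fin N)),
      Measurable fun p : (Fin N → E2) × (Fin N → E2) =>
        ENNReal.ofReal (((Pᶜ.card).factorial : ℝ)⁻¹ * totalWeight β lam T P (p.1, p.2 ∘ σ)) :=
    fun P σ => (((measurable_totalWeight hlam P).comp
      (measurePreserving_comp_perm_snd N σ).measurable).const_mul _).ennreal_ofReal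
  calc ∫⁻ p, ENNReal.ofReal (Real.exp (-β * Flam N lam p.1 p.2))
        ∂((confMeasure N).prod (confMeasure N)) ≤
      ∫⁻ p, ∑ P : Finset (Fin N), ∑ σ : Equiv.Perm (Fin N), ENNReal.ofReal
        (((Pᶜ.card).factorial : ℝ)⁻¹ * totalWeight β lam T P (p.1, p.2 ∘ σ))
        ∂((confMeasure N).prod (confMeasure N)) := by
        refine lintegral_mono fun p => ?_
        refine (ENNReal.ofReal_le_ofReal
          (exp_neg_mul_Flam_le_totalWeight hβ hlam hT hε p.1 p.2)).trans (le_of_eq ?_)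
        have h0 : ∀ (P : Finset (Fin N)) (σ : Equiv.Perm (Fin N)),
            0 ≤ ((Pᶜ.card).factorial : ℝ)⁻¹ * totalWeight β lam T P (p.1, p.2 ∘ σ) :=
          fun P σ => mul_nonneg (by positivity) (totalWeight_nonneg _ _)
        rw [ENNReal.ofReal_sum_of_nonneg fun P _ => Finset.sum_nonneg fun σ _ => h0 P σ]
        exact Finset.sum_congr rfl fun P _ => ENNReal.ofReal_sum_of_nonneg fun σ _ => h0 P σ
    _ = ∑ P : Finset (Fin N), ∑ σ : Equiv.Perm (Fin N), ∫⁻ p, ENNReal.ofReal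
        (((Pᶜ.card).factorial : ℝ)⁻¹ * totalWeight β lam T P (p.1, p.2 ∘ σ))
        ∂((confMeasure N).prod (confMeasure N)) := by
        rw [lintegral_finsetSum _ fun P _ => Finset.measurable_fun_sum _ fun σ _ => hm P σ]
        exact Finset.sum_congr rfl fun P _ => lintegral_finsetSum _ fun σ _ => hm P σ
    _ ≤ ∑ P : Finset (Fin N), ∑ _σ : Equiv.Perm (Fin N), ENNReal.ofReal
        (E * (I ^ N * (N : ℝ) ^ N * Real.exp (L * (T ^ 2)⁻¹ * N) * (D * (T ^ 2)⁻¹) ^ Pᶜ.card)) := by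
        refine Finset.sum_le_sum fun P _ => Finset.sum_le_sum fun σ _ => ?_
        have h1 : ∫⁻ p, ENNReal.ofReal
            (((Pᶜ.card).factorial : ℝ)⁻¹ * totalWeight β lam T P (p.1, p.2 ∘ σ))
            ∂((confMeasure N).prod (confMeasure N)) =
            ENNReal.ofReal ((Pᶜ.card).factorial : ℝ)⁻¹ *
              ∫⁻ p, ENNReal.ofReal (totalWeight β lam T P p)
                ∂((confMeasure N).prod (confMeasure N)) := by
          have hmt := (measurable_totalWeight (β := β) (T := T) hlam P).ennreal_ofReal
          rw [← (measurePreserving_comp_perm_snd N σ).lintegral_comp hmt,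
            ← lintegral_const_mul' _ _ ENNReal.ofReal_ne_top]
          exact lintegral_congr fun p => ENNReal.ofReal_mul (by positivity)
        rw [h1]
        refine (mul_le_mul_right (lintegral_totalWeight_le hlam hT0 hI0 hI P) _).trans ?_
        rw [← ENNReal.ofReal_mul (by positivity)]
        refine ENNReal.ofReal_le_ofReal ?_
        rw [mul_left_comm]
        exact mul_le_mul_of_nonneg_left (weight_sum_le hT0 hI0 hL hTI P) (Real.exp_pos _).le
    _ = ENNReal.ofReal (N.factorial * (E * (I ^ N * (N : ℝ) ^ N * Real.exp (L * (T ^ 2)⁻¹ * N) *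
        (1 + D * (T ^ 2)⁻¹) ^ N))) := by
        have h2 := Fintype.sum_pow_mul_eq_add_pow (Fin N) 1 (D * (T ^ 2)⁻¹)
        simp only [Finset.sum_const, Finset.card_univ, Fintype.card_perm, Fintype.card_fin,
          nsmul_eq_mul, one_pow, one_mul] at h2 ⊢
        rw [← h2, ENNReal.ofReal_mul (Nat.cast_nonneg _), ENNReal.ofReal_natCast, ← Finset.mul_sum,
          ← ENNReal.ofReal_sum_of_nonneg fun P _ => by positivity, Finset.mul_sum, Finset.mul_sum]
        congr 2
        refine Finset.sum_congr rfl fun P _ => ?_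
        rw [Finset.card_compl, Fintype.card_fin]
    _ ≤ _ := by
        refine ENNReal.ofReal_le_ofReal ?_
        have h3 : (1 + D * (T ^ 2)⁻¹) ^ N ≤ Real.exp (N * (D * (T ^ 2)⁻¹)) := by
          rw [Real.exp_nat_mul]
          refine pow_le_pow_left₀ (by positivity) ?_ _
          linarith [Real.add_one_le_exp (D * (T ^ 2)⁻¹)]
        calc _ ≤ (N.factorial : ℝ) * (E * (I ^ N * (N : ℝ) ^ N * Real.exp (L * (T ^ 2)⁻¹ * N) *
              Real.exp (N * (D * (T ^ 2)⁻¹)))) := by gcongr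
          _ = N.factorial * (I ^ N * (N : ℝ) ^ N) * (E * Real.exp (L * (T ^ 2)⁻¹ * N) *
              Real.exp (N * (D * (T ^ 2)⁻¹))) := by ring
          _ = _ := by
            rw [hE, ← Real.exp_add, ← Real.exp_add, upperConst]
            congr 2
            ring

end

/-! ### The dipole integral -/

lemma integral_norm_E2 (f : ℝ → ℝ) :
    ∫ x : E2, f ‖x‖ = 2 * π * ∫ r in Set.Ioi (0 : ℝ), f r * r := by
  rw [integral_fun_norm_addHaar volume f]
  simp only [finrank_euclideanSpace, Fintype.card_fin, Nat.add_one_sub_one, pow_one, smul_eq_mul,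
    nsmul_eq_mul, Measure.real, EuclideanSpace.volume_ball_fin_two, ENNReal.ofReal_one, one_pow,
    one_mul, ENNReal.toReal_ofReal Real.pi_pos.le, Nat.cast_ofNat, mul_assoc]
  simp_rw [mul_comm]

lemma integrable_pairWeight {β lam : ℝ} (hβ : 0 ≤ β) (hlam : 0 < lam) (ε : ℝ) :
    Integrable (pairWeight β lam ε) := by
  have h1 : IntegrableOn (fun _ : E2 => Real.exp (β * gsm lam 0)) (Metric.closedBall 0 ε) :=
    integrableOn_const (measure_closedBall_lt_top.ne)
  have h2 := h1.integrable_indicator measurableSet_closedBall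
  refine h2.mono' (measurable_pairWeight β hlam ε).aestronglyMeasurable
    (Filter.Eventually.of_forall fun z => ?_)
  rw [Real.norm_of_nonneg (pairWeight_nonneg _ _ _ _)]
  by_cases h : ‖z‖ ≤ ε
  · rw [Set.indicator_of_mem (by simpa using h), pairWeight, if_pos h]
    exact Real.exp_le_exp.2 (mul_le_mul_of_nonneg_left (gsm_le_gsm_zero hlam z) hβ)
  · rw [Set.indicator_of_notMem (by simpa using h), pairWeight, if_neg h]

lemma lintegral_pairWeight {β lam : ℝ} (hβ : 0 ≤ β) (hlam : 0 < lam) (ε : ℝ) :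
    ∫⁻ z, ENNReal.ofReal (pairWeight β lam ε z) = ENNReal.ofReal (∫ z, pairWeight β lam ε z) :=
  (ofReal_integral_eq_lintegral_ofReal (integrable_pairWeight hβ hlam ε)
    (Filter.Eventually.of_forall (pairWeight_nonneg _ _ _))).symm

lemma integral_pairWeight_scale (β : ℝ) {lam : ℝ} (hlam : 0 < lam) (ε : ℝ) :
    ∫ z, pairWeight β lam ε z = lam ^ (2 - β) * ∫ z, pairWeight β 1 (ε / lam) z := by
  have h1 : ∀ z : E2, pairWeight β lam ε z =
      lam ^ (-β) * pairWeight β 1 (ε / lam) (lam⁻¹ • z) := by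
    intro z
    have h2 : ‖lam⁻¹ • z‖ ≤ ε / lam ↔ ‖z‖ ≤ ε := by
      rw [norm_smul, Real.norm_of_nonneg (inv_nonneg.2 hlam.le), ← div_eq_inv_mul,
        div_le_div_iff_of_pos_right hlam]
    unfold pairWeight
    simp only [h2, mul_ite, mul_zero]
    split_ifs with h
    · rw [gsm_eq_neg_log_add hlam, Real.rpow_def_of_pos hlam, ← Real.exp_add]
      congr 1; ring
    · rfl
  simp_rw [h1]
  rw [integral_const_mul, Measure.integral_comp_inv_smul_of_nonneg volume _ hlam.le,
    finrank_euclideanSpace, Fintype.card_fin, smul_eq_mul, ← mul_assoc, ← Real.rpow_natCast,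
    ← Real.rpow_add hlam]
  congr 2
  push_cast; ring

section
variable {β : ℝ}

lemma exp_mul_gsm_one_le (hβ : 0 ≤ β) (z : E2) :
    Real.exp (β * gsm 1 z) ≤ Real.exp (β * gsmErr) * 2 ^ β * (1 + ‖z‖) ^ (-β) := by
  have h1 := (gsm_bounds one_pos z).2
  have h2 : (1 + ‖z‖) / 2 ≤ max ‖z‖ 1 := by
    linarith [le_max_left ‖z‖ 1, le_max_right ‖z‖ 1]
  have h3 : 0 < 1 + ‖z‖ := by positivity
  have h4 := Real.log_le_log (by positivity) h2
  rw [Real.log_div h3.ne' two_ne_zero] at h4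
  rw [Real.rpow_def_of_pos h3, Real.rpow_def_of_pos two_pos, ← Real.exp_add, ← Real.exp_add]
  refine Real.exp_le_exp.2 ?_
  have := mul_le_mul_of_nonneg_left (h1.trans (add_le_add_left (neg_le_neg h4) _)) hβ
  linarith

lemma integrable_exp_mul_gsm_one (hβ : 2 < β) :
    Integrable fun z : E2 => Real.exp (β * gsm 1 z) := by
  have h1 : Integrable fun z : E2 => (1 + ‖z‖) ^ (-β) :=
    integrable_one_add_norm (by simpa using hβ)
  refine (h1.const_mul (Real.exp (β * gsmErr) * 2 ^ β)).mono'
    (Real.measurable_exp.comp ((measurable_gsm one_pos).const_mul _)).aestronglyMeasurable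
    (Filter.Eventually.of_forall fun z => ?_)
  rw [Real.norm_of_nonneg (Real.exp_pos _).le]
  exact exp_mul_gsm_one_le (by linarith) z

lemma Zbeta_eq_integral (hβ : 2 < β) : Zbeta β = ∫ z : E2, Real.exp (β * gsm 1 z) := by
  simp_rw [gsm_one_eq_g1rad]
  rw [Zbeta, if_neg hβ.ne', integral_norm_E2 fun r => Real.exp (β * g1rad r)]

lemma Zbeta_pos (hβ : 2 ≤ β) : 0 < Zbeta β := by
  rcases hβ.eq_or_lt with h | h
  · rw [Zbeta, if_pos h.symm]; exact Real.two_pi_pos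
  · rw [Zbeta_eq_integral h]
    exact integral_exp_pos (integrable_exp_mul_gsm_one h)

lemma integral_pairWeight_one_le (hβ : 2 < β) (R : ℝ) :
    ∫ z, pairWeight β 1 R z ≤ Zbeta β := by
  rw [Zbeta_eq_integral hβ]
  refine integral_mono (integrable_pairWeight (by linarith) one_pos R)
    (integrable_exp_mul_gsm_one hβ) fun z => ?_
  simp only [pairWeight]
  split_ifs
  · exact le_rfl
  · exact (Real.exp_pos _).le

lemma exists_le_integral_pairWeight_one (hβ : 2 < β) :
    ∃ C : ℝ, 0 < C ∧ ∀ R : ℝ, 0 < R →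
      Zbeta β - C * R ^ (-((β - 2) / 2)) ≤ ∫ z, pairWeight β 1 R z := by
  have h1 : Integrable fun z : E2 => (1 + ‖z‖) ^ (-((β + 2) / 2)) :=
    integrable_one_add_norm (by simp; linarith)
  set K := Real.exp (β * gsmErr) * 2 ^ β with hK
  have hK0 : 0 < K := by positivity
  set J := ∫ z : E2, (1 + ‖z‖) ^ (-((β + 2) / 2)) with hJ
  have hJ0 : 0 ≤ J := integral_nonneg fun z => by positivity
  refine ⟨K * (J + 1), by positivity, fun R hR => ?_⟩
  have hI := integrable_exp_mul_gsm_one hβ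
  have hw := integrable_pairWeight (by linarith : 0 ≤ β) one_pos R
  have hRp : 0 ≤ R ^ (-((β - 2) / 2)) := by positivity
  have h2 : Zbeta β - ∫ z, pairWeight β 1 R z ≤ K * R ^ (-((β - 2) / 2)) * J := by
    rw [Zbeta_eq_integral hβ, ← integral_sub hI hw, hJ, ← integral_const_mul]
    refine integral_mono (hI.sub hw) (h1.const_mul _) fun z => ?_
    simp only [pairWeight]
    split_ifs with h
    · rw [sub_self]; positivity
    · rw [sub_zero]
      have h3 : R ≤ 1 + ‖z‖ := by linarith
      calc Real.exp (β * gsm 1 z) ≤ K * (1 + ‖z‖) ^ (-β) := exp_mul_gsm_one_le (by linarith) z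
        _ = K * ((1 + ‖z‖) ^ (-((β - 2) / 2)) * (1 + ‖z‖) ^ (-((β + 2) / 2))) := by
          rw [← Real.rpow_add (by positivity)]; congr 2; ring
        _ ≤ K * (R ^ (-((β - 2) / 2)) * (1 + ‖z‖) ^ (-((β + 2) / 2))) := by
          have := Real.rpow_le_rpow_of_nonpos hR h3 (show -((β - 2) / 2) ≤ 0 by linarith)
          gcongr
        _ = _ := by ring
  nlinarith [mul_nonneg hK0.le hRp]

end

lemma integral_Ioc_norm_E2 (f F : ℝ → ℝ) {a b : ℝ} (ha : 0 ≤ a) (hab : a ≤ b)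
    (hF : ∀ r ∈ Set.Icc a b, HasDerivAt F (f r * r) r)
    (hf : ContinuousOn (fun r => f r * r) (Set.Icc a b)) :
    ∫ x : E2, (Set.Ioc a b).indicator f ‖x‖ = 2 * π * (F b - F a) := by
  rw [integral_norm_E2 ((Set.Ioc a b).indicator f)]
  congr 1
  have h1 : (fun r => (Set.Ioc a b).indicator f r * r) =
      (Set.Ioc a b).indicator fun r => f r * r := by
    ext r
    by_cases h : r ∈ Set.Ioc a b <;> simp [h]
  have h2 : Set.Ioc a b ⊆ Set.Ioi 0 := fun r hr => ha.trans_lt hr.1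
  rw [h1, setIntegral_indicator measurableSet_Ioc, Set.inter_eq_self_of_subset_right h2,
    ← intervalIntegral.integral_of_le hab]
  rw [← Set.uIcc_of_le hab] at hF hf
  exact intervalIntegral.integral_eq_sub_of_hasDerivAt hF hf.intervalIntegrable

lemma exists_integral_pairWeight_two_le :
    ∃ C : ℝ, 0 < C ∧ ∀ R : ℝ, 3 ≤ R →
      ∫ z, pairWeight 2 1 R z ≤ 2 * π * (Real.log R + C) := by
  have hw3 := integrable_pairWeight zero_le_two one_pos 3
  set J := ∫ z, pairWeight 2 1 3 z with hJ
  have hJ0 : 0 ≤ J := integral_nonneg fun z => pairWeight_nonneg _ _ _ _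
  have hπ := Real.pi_pos
  refine ⟨J / (2 * π) + 2, by positivity, fun R hR => ?_⟩
  set f : ℝ → ℝ := fun r => ((r - 2) ^ 2)⁻¹ with hf
  have hderiv : ∀ r ∈ Set.Icc 3 R,
      HasDerivAt (fun r => Real.log (r - 2) - 2 * (r - 2)⁻¹) (f r * r) r := by
    intro r hr
    have h0 : r - 2 ≠ 0 := by linarith [hr.1]
    have h1 : HasDerivAt (fun r : ℝ => r - 2) 1 r := (hasDerivAt_id r).sub_const 2
    refine ((h1.log h0).sub ((h1.inv h0).const_mul 2)).congr_deriv ?_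
    simp only [hf]
    field_simp
    ring
  have hcont : ContinuousOn (fun r => f r * r) (Set.Icc 3 R) := by
    refine ContinuousOn.mul (ContinuousOn.inv₀ (by fun_prop) fun r hr => ?_) continuousOn_id
    have : 0 < r - 2 := by linarith [hr.1]
    positivity
  have h2 := integral_Ioc_norm_E2 f _ (by norm_num) hR hderiv hcont
  have hi : Integrable fun z : E2 => (Set.Ioc 3 R).indicator f ‖z‖ := by
    by_contra hne
    have h3 : IntegrableOn (fun _ : E2 => (1 : ℝ)) (Metric.closedBall 0 R) :=
      integrableOn_const (measure_closedBall_lt_top.ne)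
    refine hne ((h3.integrable_indicator measurableSet_closedBall).mono'
      (Measurable.aestronglyMeasurable ?_) (Filter.Eventually.of_forall fun z => ?_))
    · have : Measurable ((Set.Ioc 3 R).indicator f) :=
        Measurable.indicator (by fun_prop) measurableSet_Ioc
      exact this.comp measurable_norm
    · by_cases h : ‖z‖ ∈ Set.Ioc 3 R
      · rw [Set.indicator_of_mem h, Set.indicator_of_mem (by simpa using h.2)]
        simp only [hf]
        rw [Real.norm_of_nonneg (by positivity)]
        exact inv_le_one_of_one_le₀ (one_le_pow₀ (by linarith [h.1]))
      · rw [Set.indicator_of_notMem h, norm_zero]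
        exact Set.indicator_nonneg (fun _ _ => zero_le_one) _
  have h4 : ∫ z, pairWeight 2 1 R z ≤ ∫ z, (pairWeight 2 1 3 z + (Set.Ioc 3 R).indicator f ‖z‖) := by
    refine integral_mono (integrable_pairWeight zero_le_two one_pos R) (hw3.add hi) fun z => ?_
    simp only
    by_cases h : ‖z‖ ∈ Set.Ioc 3 R
    · rw [Set.indicator_of_mem h, pairWeight, if_pos h.2, pairWeight, if_neg (by linarith [h.1]),
        zero_add]
      have h5 := gsm_one_le_neg_log (z := z) (by linarith [h.1])
      have h6 : 0 < ‖z‖ - 2 := by linarith [h.1]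
      calc Real.exp (2 * gsm 1 z) ≤ Real.exp (-Real.log ((‖z‖ - 2) ^ 2)) := by
            refine Real.exp_le_exp.2 ?_
            rw [Real.log_pow]; push_cast; linarith
        _ = _ := by rw [Real.exp_neg, Real.exp_log (by positivity)]
    · rw [Set.indicator_of_notMem h, add_zero]
      by_cases h7 : ‖z‖ ≤ R
      · have h8 : ‖z‖ ≤ 3 := by
          by_contra h9
          exact h ⟨not_le.1 h9, h7⟩
        rw [pairWeight, if_pos h7, pairWeight, if_pos h8]
      · rw [pairWeight, if_neg h7]; exact pairWeight_nonneg _ _ _ _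
  rw [integral_add hw3 hi, h2] at h4
  refine h4.trans ?_
  have h5 : Real.log (R - 2) ≤ Real.log R := Real.log_le_log (by linarith) (by linarith)
  have h6 : 0 ≤ (R - 2)⁻¹ := inv_nonneg.2 (by linarith)
  have h7 : 2 * π * (Real.log R + (J / (2 * π) + 2)) = J + 2 * π * (Real.log R + 2) := by
    field_simp; ring
  rw [h7]
  norm_num
  gcongr
  linarith

lemma le_integral_pairWeight_two {R : ℝ} (hR : 0 < R) :
    2 * π * (Real.log R - 2) ≤ ∫ z, pairWeight 2 1 R z := by
  set f : ℝ → ℝ := fun r => ((r + 2) ^ 2)⁻¹ with hf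
  have hderiv : ∀ r ∈ Set.Icc 0 R,
      HasDerivAt (fun r => Real.log (r + 2) + 2 * (r + 2)⁻¹) (f r * r) r := by
    intro r hr
    have h0 : r + 2 ≠ 0 := by linarith [hr.1]
    have h1 : HasDerivAt (fun r : ℝ => r + 2) 1 r := (hasDerivAt_id r).add_const 2
    refine ((h1.log h0).add ((h1.inv h0).const_mul 2)).congr_deriv ?_
    simp only [hf]
    field_simp
    ring
  have hcont : ContinuousOn (fun r => f r * r) (Set.Icc 0 R) := by
    refine ContinuousOn.mul (ContinuousOn.inv₀ (by fun_prop) fun r hr => ?_) continuousOn_id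
    have : 0 < r + 2 := by linarith [hr.1]
    positivity
  have h2 := integral_Ioc_norm_E2 f _ le_rfl hR.le hderiv hcont
  have h3 : ∫ z : E2, (Set.Ioc 0 R).indicator f ‖z‖ ≤ ∫ z, pairWeight 2 1 R z := by
    refine integral_mono_of_nonneg (Filter.Eventually.of_forall fun z =>
      Set.indicator_nonneg (fun r _ => by simp only [hf]; positivity) _)
      (integrable_pairWeight zero_le_two one_pos R) (Filter.Eventually.of_forall fun z => ?_)
    simp only
    by_cases h : ‖z‖ ∈ Set.Ioc 0 R
    · rw [Set.indicator_of_mem h, pairWeight, if_pos h.2]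
      have h5 := neg_log_le_gsm_one z
      have h6 : 0 < ‖z‖ + 2 := by positivity
      calc ((‖z‖ + 2) ^ 2)⁻¹ = Real.exp (-Real.log ((‖z‖ + 2) ^ 2)) := by
            rw [Real.exp_neg, Real.exp_log (by positivity)]
        _ ≤ _ := by
            refine Real.exp_le_exp.2 ?_
            rw [Real.log_pow]; push_cast; linarith
    · rw [Set.indicator_of_notMem h]; exact pairWeight_nonneg _ _ _ _
  rw [h2] at h3
  refine le_trans ?_ h3
  have h5 : Real.log R ≤ Real.log (R + 2) := Real.log_le_log hR (by linarith)
  have h6 : 0 ≤ (R + 2)⁻¹ := inv_nonneg.2 (by linarith)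
  have h7 : Real.log 2 ≤ 1 := by linarith [Real.log_two_lt_d9]
  have hπ := Real.pi_pos
  norm_num
  gcongr 2 * π * ?_
  linarith

/-! ### The lower bound for the partition function -/

section
variable {N : ℕ} {β lam ε : ℝ}

lemma measurable_Flam (hlam : 0 < lam) :
    Measurable fun p : (Fin N → E2) × (Fin N → E2) => Flam N lam p.1 p.2 := by
  have hg := measurable_gsm hlam
  unfold Flam
  refine Measurable.sub_const (Measurable.const_mul (Finset.measurable_fun_sum _ fun i _ =>
    Finset.measurable_fun_sum _ fun j _ => ?_) _) _
  have h1 : Measurable fun p : (Fin N → E2) × (Fin N → E2) => p.1 i - p.1 j := by fun_prop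
  have h2 : Measurable fun p : (Fin N → E2) × (Fin N → E2) => p.2 i - p.2 j := by fun_prop
  have h3 : Measurable fun p : (Fin N → E2) × (Fin N → E2) => p.1 i - p.2 j := by fun_prop
  exact ((hg.comp h1).add (hg.comp h2)).sub ((hg.comp h3).const_mul 2)

/-- The interaction between the dipoles `i` and `j`. -/
def dipoleInt (lam : ℝ) (p : (Fin N → E2) × (Fin N → E2)) (i j : Fin N) : ℝ :=
  gsm lam (p.1 i - p.1 j) + gsm lam (p.2 i - p.2 j) - gsm lam (p.1 i - p.2 j) -
    gsm lam (p.2 i - p.1 j)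

lemma Flam_eq_dipole (hlam : 0 < lam) (p : (Fin N → E2) × (Fin N → E2)) :
    Flam N lam p.1 p.2 = -(∑ i, gsm lam (p.1 i - p.2 i)) +
      (1 / 2) * ∑ i, ∑ j ∈ Finset.univ.erase i, dipoleInt lam p i j := by
  have h1 : ∑ i, ∑ j, gsm lam (p.2 i - p.1 j) = ∑ i, ∑ j, gsm lam (p.1 i - p.2 j) := by
    rw [Finset.sum_comm]
    exact Finset.sum_congr rfl fun i _ => Finset.sum_congr rfl fun j _ => gsm_sub_comm hlam _ _
  have h2 : ∑ i, ∑ j, (gsm lam (p.1 i - p.1 j) + gsm lam (p.2 i - p.2 j) -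
      2 * gsm lam (p.1 i - p.2 j)) = ∑ i, ∑ j, dipoleInt lam p i j := by
    simp only [dipoleInt, Finset.sum_sub_distrib, h1, ← Finset.mul_sum]
    ring
  have h3 : ∀ i, ∑ j, dipoleInt lam p i j = ∑ j ∈ Finset.univ.erase i, dipoleInt lam p i j +
      (2 * (-Real.log lam + kappa) - 2 * gsm lam (p.1 i - p.2 i)) := by
    intro i
    rw [← Finset.sum_erase_add _ _ (Finset.mem_univ i)]
    congr 1
    rw [dipoleInt, sub_self, sub_self, gsm_zero hlam, gsm_sub_comm hlam (p.2 i)]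
    ring
  rw [Flam, h2, Finset.sum_congr rfl fun i _ => h3 i]
  simp only [Finset.sum_add_distrib, Finset.sum_sub_distrib, Finset.sum_const, Finset.card_univ,
    Fintype.card_fin, nsmul_eq_mul, ← Finset.mul_sum]
  ring

/-- The sign of a swapped or unswapped dipole. -/
def swapSign (S : Finset (Fin N)) (i : Fin N) : ℝ := if i ∈ S then -1 else 1

lemma dipoleInt_swapOn (S : Finset (Fin N)) (p : (Fin N → E2) × (Fin N → E2)) (i j : Fin N) :
    dipoleInt lam (swapOn S p) i j = swapSign S i * swapSign S j * dipoleInt lam p i j := by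
  by_cases hi : i ∈ S <;> by_cases hj : j ∈ S <;>
    simp only [dipoleInt, swapOn, swapSign, hi, hj, if_true, if_false] <;> ring

lemma sum_swapSign_mul {i j : Fin N} (hij : i ≠ j) :
    ∑ S : Finset (Fin N), swapSign S i * swapSign S j = 0 := by
  have hinv : Function.Involutive fun S : Finset (Fin N) => symmDiff S {i} := fun S => by
    simp
  set e : Equiv.Perm (Finset (Fin N)) := hinv.toPerm _ with he
  have h1 := Equiv.sum_comp e fun S : Finset (Fin N) => swapSign S i * swapSign S j
  have h2 : ∀ S : Finset (Fin N), swapSign (e S) i * swapSign (e S) j =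
      -(swapSign S i * swapSign S j) := by
    intro S
    have hi : i ∈ e S ↔ i ∉ S := by
      simp [he, Function.Involutive.toPerm, Finset.mem_symmDiff]
    have hj : j ∈ e S ↔ j ∈ S := by
      simp [he, Function.Involutive.toPerm, Finset.mem_symmDiff, hij.symm]
    simp only [swapSign, hi, hj]
    by_cases h : i ∈ S <;> by_cases h' : j ∈ S <;> simp [h, h']
  rw [Finset.sum_congr rfl fun S _ => h2 S, Finset.sum_neg_distrib] at h1
  linarith

lemma prod_exp_le_sum_swapOn (hlam : 0 < lam) (p : (Fin N → E2) × (Fin N → E2)) :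
    2 ^ N * ∏ i, Real.exp (β * gsm lam (p.1 i - p.2 i)) ≤
      ∑ S : Finset (Fin N), Real.exp (-β * Flam N lam (swapOn S p).1 (swapOn S p).2) := by
  have h1 : ∀ S i, gsm lam ((swapOn S p).1 i - (swapOn S p).2 i) = gsm lam (p.1 i - p.2 i) := by
    intro S i
    by_cases h : i ∈ S
    · simp only [swapOn, h, if_true]; exact gsm_sub_comm hlam _ _
    · simp only [swapOn, h, if_false]
  have h2 : ∀ S : Finset (Fin N), (∏ i, Real.exp (β * gsm lam (p.1 i - p.2 i))) *
      (1 + -β / 2 * ∑ i, ∑ j ∈ Finset.univ.erase i,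
        swapSign S i * swapSign S j * dipoleInt lam p i j) ≤
      Real.exp (-β * Flam N lam (swapOn S p).1 (swapOn S p).2) := by
    intro S
    rw [Flam_eq_dipole hlam, ← Real.exp_sum]
    simp only [h1, dipoleInt_swapOn, ← Finset.mul_sum]
    rw [show ∀ a b : ℝ, -β * (-a + 1 / 2 * b) = β * a + -β / 2 * b by intros; ring, Real.exp_add]
    refine mul_le_mul_of_nonneg_left ?_ (Real.exp_pos _).le
    rw [add_comm]
    exact Real.add_one_le_exp _
  refine le_trans (le_of_eq ?_) (Finset.sum_le_sum fun S _ => h2 S)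
  have h3 : ∑ S : Finset (Fin N), ∑ i, ∑ j ∈ Finset.univ.erase i,
      swapSign S i * swapSign S j * dipoleInt lam p i j = 0 := by
    rw [Finset.sum_comm]
    refine Finset.sum_eq_zero fun i _ => ?_
    rw [Finset.sum_comm]
    refine Finset.sum_eq_zero fun j hj => ?_
    rw [← Finset.sum_mul, sum_swapSign_mul (Finset.ne_of_mem_erase hj).symm, zero_mul]
  rw [← Finset.mul_sum, Finset.sum_add_distrib, ← Finset.mul_sum, h3]
  simp
  ring

/-- The configurations forming well separated dipoles of length at most `ε`. -/
def dipoleSet (N : ℕ) (ε : ℝ) : Set ((Fin N → E2) × (Fin N → E2)) :=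
  {p | (∀ i, ‖p.1 i - p.2 i‖ ≤ ε) ∧ ∀ i j, i ≠ j → ε < ‖p.1 i - p.1 j‖ ∧
    ε < ‖p.2 i - p.2 j‖ ∧ ε < ‖p.1 i - p.2 j‖ ∧ ε < ‖p.2 i - p.1 j‖}

lemma measurableSet_dipoleSet (N : ℕ) (ε : ℝ) : MeasurableSet (dipoleSet N ε) := by
  unfold dipoleSet
  simp only [Set.ofPred_and, Set.ofPred_forall]
  refine MeasurableSet.inter (MeasurableSet.iInter fun i =>
    measurableSet_le (by fun_prop) measurable_const) (MeasurableSet.iInter fun i =>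
    MeasurableSet.iInter fun j => MeasurableSet.iInter fun _ => ?_)
  exact (measurableSet_lt measurable_const (by fun_prop)).inter
    ((measurableSet_lt measurable_const (by fun_prop)).inter
    ((measurableSet_lt measurable_const (by fun_prop)).inter
    (measurableSet_lt measurable_const (by fun_prop))))

lemma swapOn_mem_dipoleSet (S : Finset (Fin N)) {p : (Fin N → E2) × (Fin N → E2)}
    (hp : p ∈ dipoleSet N ε) : swapOn S p ∈ dipoleSet N ε := by
  refine ⟨fun i => ?_, fun i j hij => ?_⟩
  · have := hp.1 i
    by_cases h : i ∈ S
    · simp only [swapOn, h, if_true]; rwa [norm_sub_rev]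
    · simpa only [swapOn, h, if_false]
  · obtain ⟨h1, h2, h3, h4⟩ := hp.2 i j hij
    by_cases hi : i ∈ S <;> by_cases hj : j ∈ S <;>
      simp only [swapOn, hi, hj, if_true, if_false] <;> exact ⟨by assumption, by assumption,
        by assumption, by assumption⟩

lemma eq_of_mem_dipoleSet {X Y : Fin N → E2} {σ τ : Equiv.Perm (Fin N)}
    (hσ : (X, Y ∘ σ) ∈ dipoleSet N ε) (hτ : (X, Y ∘ τ) ∈ dipoleSet N ε) : σ = τ := by
  ext i
  by_contra h
  have h1 : i ≠ τ.symm (σ i) := fun h2 => h (congrArg _ (τ.symm_apply_eq.1 h2.symm))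
  have h3 := (hτ.2 i _ h1).2.2.1
  have h4 := hσ.1 i
  simp only [Function.comp_apply, Equiv.apply_symm_apply] at h3 h4
  linarith

/-- The Boltzmann factor restricted to `dipoleSet`. -/
def dipoleFactor (N : ℕ) (β lam ε : ℝ) (p : (Fin N → E2) × (Fin N → E2)) : ℝ≥0∞ :=
  (dipoleSet N ε).indicator (fun p => ENNReal.ofReal (Real.exp (-β * Flam N lam p.1 p.2))) p

lemma measurable_dipoleFactor (hlam : 0 < lam) : Measurable (dipoleFactor N β lam ε) := by
  have h1 : Measurable fun p : (Fin N → E2) × (Fin N → E2) =>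
      ENNReal.ofReal (Real.exp (-β * Flam N lam p.1 p.2)) :=
    (Real.measurable_exp.comp ((measurable_Flam hlam).const_mul _)).ennreal_ofReal
  exact h1.indicator (measurableSet_dipoleSet N ε)

lemma factorial_mul_lintegral_dipoleFactor_le (hlam : 0 < lam) :
    (N.factorial : ℝ≥0∞) *
      ∫⁻ p, dipoleFactor N β lam ε p ∂((confMeasure N).prod (confMeasure N)) ≤
    ∫⁻ p, ENNReal.ofReal (Real.exp (-β * Flam N lam p.1 p.2))
      ∂((confMeasure N).prod (confMeasure N)) := by
  have h1 : (N.factorial : ℝ≥0∞) *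
      ∫⁻ p, dipoleFactor N β lam ε p ∂((confMeasure N).prod (confMeasure N)) =
      ∫⁻ p, ∑ σ : Equiv.Perm (Fin N), dipoleFactor N β lam ε (p.1, p.2 ∘ σ)
        ∂((confMeasure N).prod (confMeasure N)) := by
    have hm : ∀ σ : Equiv.Perm (Fin N), Measurable fun p : (Fin N → E2) × (Fin N → E2) =>
        dipoleFactor N β lam ε (p.1, p.2 ∘ σ) := fun σ =>
      (measurable_dipoleFactor hlam).comp (measurePreserving_comp_perm_snd N σ).measurable
    rw [lintegral_finsetSum _ fun σ _ => hm σ]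
    rw [Finset.sum_congr rfl fun σ _ =>
      (measurePreserving_comp_perm_snd N σ).lintegral_comp (measurable_dipoleFactor hlam)]
    simp [Fintype.card_perm]
  rw [h1]
  refine lintegral_mono fun p => ?_
  simp only
  by_cases h : ∃ σ : Equiv.Perm (Fin N), (p.1, p.2 ∘ σ) ∈ dipoleSet N ε
  · obtain ⟨σ, hσ⟩ := h
    rw [Finset.sum_eq_single_of_mem σ (Finset.mem_univ _), dipoleFactor,
      Set.indicator_of_mem hσ, Flam_comp_perm]
    intro τ _ hτ
    rw [dipoleFactor, Set.indicator_of_notMem]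
    exact fun h => hτ (eq_of_mem_dipoleSet h hσ)
  · push Not at h
    rw [Finset.sum_eq_zero]
    · exact zero_le
    · intro σ _
      rw [dipoleFactor, Set.indicator_of_notMem (h σ)]

lemma lintegral_prod_exp_le_dipoleFactor (hlam : 0 < lam) :
    ∫⁻ p, (dipoleSet N ε).indicator
      (fun p => ENNReal.ofReal (∏ i, Real.exp (β * gsm lam (p.1 i - p.2 i)))) p
      ∂((confMeasure N).prod (confMeasure N)) ≤
    ∫⁻ p, dipoleFactor N β lam ε p ∂((confMeasure N).prod (confMeasure N)) := by
  have hsw : ∀ S : Finset (Fin N), MeasurePreserving (swapOn S)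
      ((confMeasure N).prod (confMeasure N)) ((confMeasure N).prod (confMeasure N)) :=
    fun S => measurePreserving_swapOn (boxMeasure N) S
  have h0 : (2 : ℝ≥0∞) ^ N ≠ 0 := by positivity
  have h0' : (2 : ℝ≥0∞) ^ N ≠ ∞ := by finiteness
  rw [← ENNReal.mul_le_mul_iff_right h0 h0', ← lintegral_const_mul' _ _ h0']
  have h1 : (2 : ℝ≥0∞) ^ N *
      ∫⁻ p, dipoleFactor N β lam ε p ∂((confMeasure N).prod (confMeasure N)) =
      ∫⁻ p, ∑ S : Finset (Fin N), dipoleFactor N β lam ε (swapOn S p)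
        ∂((confMeasure N).prod (confMeasure N)) := by
    have hm : ∀ S : Finset (Fin N), Measurable fun p : (Fin N → E2) × (Fin N → E2) =>
        dipoleFactor N β lam ε (swapOn S p) := fun S =>
      (measurable_dipoleFactor hlam).comp (hsw S).measurable
    rw [lintegral_finsetSum _ fun S _ => hm S]
    rw [Finset.sum_congr rfl fun S _ => (hsw S).lintegral_comp (measurable_dipoleFactor hlam)]
    simp
  rw [h1]
  refine lintegral_mono fun p => ?_
  simp only
  by_cases h : p ∈ dipoleSet N ε
  · rw [Set.indicator_of_mem h]
    simp only [dipoleFactor, Set.indicator_of_mem (swapOn_mem_dipoleSet _ h)]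
    rw [← ENNReal.ofReal_sum_of_nonneg fun _ _ => (Real.exp_pos _).le]
    refine le_trans (le_of_eq ?_) (ENNReal.ofReal_le_ofReal (prod_exp_le_sum_swapOn hlam p))
    rw [ENNReal.ofReal_mul (by positivity), ENNReal.ofReal_pow zero_le_two, ENNReal.ofReal_ofNat]
  · rw [Set.indicator_of_notMem h, mul_zero]
    exact zero_le

/-- The hard core constraint on the point `i` of `X`, in a box with a margin `ε`. -/
def coreFactor (N : ℕ) (ε : ℝ) (i : Fin N) (X : Fin N → E2) : ℝ≥0∞ :=
  {X : Fin N → E2 | (∀ k, X i k ∈ Set.Icc ε (Real.sqrt N - ε)) ∧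
    ∀ j, j < i → 3 * ε < ‖X i - X j‖}.indicator 1 X

lemma measurable_coreFactor (i : Fin N) : Measurable (coreFactor N ε i) := by
  refine measurable_one.indicator ?_
  simp only [Set.ofPred_and, Set.ofPred_forall]
  refine MeasurableSet.inter (MeasurableSet.iInter fun k => ?_) (MeasurableSet.iInter fun j =>
    MeasurableSet.iInter fun _ => measurableSet_lt measurable_const (by fun_prop))
  have : Measurable fun X : Fin N → E2 => X i k := by fun_prop
  exact this measurableSet_Icc

lemma mem_dipoleSet_of_core {X Y : Fin N → E2}
    (hX : ∀ i j, j < i → 3 * ε < ‖X i - X j‖) (hXY : ∀ i, ‖X i - Y i‖ ≤ ε) :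
    (X, Y) ∈ dipoleSet N ε := by
  have hX' : ∀ i j, i ≠ j → 3 * ε < ‖X i - X j‖ := by
    intro i j hij
    rcases lt_or_gt_of_ne hij with h | h
    · rw [norm_sub_rev]; exact hX j i h
    · exact hX i j h
  refine ⟨hXY, fun i j hij => ?_⟩
  simp only
  have h0 := hX' i j hij
  have h1 := hXY i
  have h2 := hXY j
  have hε : 0 ≤ ε := (norm_nonneg _).trans h1
  have h3 : ‖X i - X j‖ ≤ ‖X i - Y j‖ + ‖X j - Y j‖ := by
    calc ‖X i - X j‖ = ‖(X i - Y j) - (X j - Y j)‖ := by congr 1; abel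
      _ ≤ _ := norm_sub_le _ _
  have h4 : ‖X i - X j‖ ≤ ‖X i - Y i‖ + ‖Y i - X j‖ := by
    calc ‖X i - X j‖ = ‖(X i - Y i) + (Y i - X j)‖ := by congr 1; abel
      _ ≤ _ := norm_add_le _ _
  have h5 : ‖Y i - X j‖ ≤ ‖Y i - Y j‖ + ‖X j - Y j‖ := by
    calc ‖Y i - X j‖ = ‖(Y i - Y j) - (X j - Y j)‖ := by congr 1; abel
      _ ≤ _ := norm_sub_le _ _
  exact ⟨by linarith, by linarith, by linarith, by linarith⟩

lemma prod_core_mul_pairWeight_le (X Y : Fin N → E2) :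
    (∏ i, coreFactor N ε i X) * ∏ i, ENNReal.ofReal (pairWeight β lam ε (X i - Y i)) ≤
      (dipoleSet N ε).indicator
        (fun p => ENNReal.ofReal (∏ i, Real.exp (β * gsm lam (p.1 i - p.2 i)))) (X, Y) := by
  by_cases h : (∀ i, ‖X i - Y i‖ ≤ ε) ∧ ∀ i j, j < i → 3 * ε < ‖X i - X j‖
  · rw [Set.indicator_of_mem (mem_dipoleSet_of_core h.2 h.1)]
    have h1 : ∏ i, coreFactor N ε i X ≤ 1 := Finset.prod_le_one' fun i _ =>
      Set.indicator_le_self' (fun _ _ => zero_le) _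
    refine (mul_le_mul_left h1 _).trans (le_of_eq ?_)
    rw [one_mul, ENNReal.ofReal_prod_of_nonneg fun _ _ => (Real.exp_pos _).le]
    exact Finset.prod_congr rfl fun i _ => by rw [pairWeight, if_pos (h.1 i)]
  · suffices h2 : (∏ i, coreFactor N ε i X) *
        ∏ i, ENNReal.ofReal (pairWeight β lam ε (X i - Y i)) = 0 by
      rw [h2]; exact zero_le
    rw [mul_eq_zero]
    rcases not_and_or.1 h with h | h
    · right
      push Not at h
      obtain ⟨i, hi⟩ := h
      exact Finset.prod_eq_zero (Finset.mem_univ i)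
        (by rw [pairWeight, if_neg (not_le.2 hi), ENNReal.ofReal_zero])
    · left
      push Not at h
      obtain ⟨i, j, hj, hij⟩ := h
      refine Finset.prod_eq_zero (Finset.mem_univ i) (Set.indicator_of_notMem ?_ _)
      exact fun h => absurd (h.2 j hj) (not_lt.2 hij)

end

section
variable {N : ℕ} {β lam ε : ℝ}

lemma le_lintegral_coreFactor (hε : 0 < ε) (hε1 : 33 * ε ≤ 1) (i : Fin N) (X : Fin N → E2) :
    ENNReal.ofReal (N * (1 - 33 * ε)) ≤
      ∫⁻ a, coreFactor N ε i (Function.update X i a) ∂boxMeasure N := by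
  set S : Set E2 := {a | ∀ k, a k ∈ Set.Icc ε (Real.sqrt N - ε)} with hS
  set B : Set E2 := ⋃ j : Fin N, Metric.closedBall (X j) (3 * ε) with hB
  have hBm : MeasurableSet B := MeasurableSet.iUnion fun j => measurableSet_closedBall
  have hSm : MeasurableSet S := measurableSet_square _ _
  have h1 : ∀ a, (S \ B).indicator (1 : E2 → ℝ≥0∞) a ≤ coreFactor N ε i (Function.update X i a) := by
    intro a
    by_cases ha : a ∈ S \ B
    · rw [Set.indicator_of_mem ha, coreFactor, Set.indicator_of_mem]
      · rfl
      · refine ⟨fun k => ?_, fun j hj => ?_⟩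
        · rw [Function.update_self]; exact ha.1 k
        · rw [Function.update_self, Function.update_of_ne hj.ne]
          have h2 : a ∉ Metric.closedBall (X j) (3 * ε) := fun h => ha.2 (Set.mem_iUnion.2 ⟨j, h⟩)
          rwa [mem_closedBall_iff_norm, not_le] at h2
    · rw [Set.indicator_of_notMem ha]; exact zero_le
  have hN : (1 : ℝ) ≤ N := by
    exact_mod_cast (Nat.one_le_iff_ne_zero.2 fun h => by subst h; exact i.elim0)
  have hsq : 1 ≤ Real.sqrt N := Real.one_le_sqrt.2 hN
  have hsq2 : Real.sqrt N ^ 2 = N := Real.sq_sqrt (by linarith)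
  have h2 : volume B ≤ ENNReal.ofReal (N * (29 * ε)) := by
    calc volume B ≤ ∑ j : Fin N, volume (Metric.closedBall (X j) (3 * ε)) :=
          measure_iUnion_fintype_le _ _
      _ = N * ENNReal.ofReal ((3 * ε) ^ 2 * π) := by
          simp only [EuclideanSpace.volume_closedBall_fin_two, Finset.sum_const, Finset.card_univ,
            Fintype.card_fin, nsmul_eq_mul]
          rw [← ENNReal.ofReal_pow (by positivity), ← ENNReal.ofReal_mul (by positivity)]
      _ ≤ _ := by
          rw [← ENNReal.ofReal_natCast, ← ENNReal.ofReal_mul (by positivity)]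
          refine ENNReal.ofReal_le_ofReal (mul_le_mul_of_nonneg_left ?_ (by positivity))
          have := Real.pi_lt_d2
          nlinarith [mul_pos hε hε]
  have h3 : volume S = ENNReal.ofReal ((Real.sqrt N - 2 * ε) ^ 2) := by
    rw [hS, volume_square, ← ENNReal.ofReal_pow (by linarith)]
    congr 2; ring
  have hsub : S \ B ⊆ LamBox N := fun a ha k =>
    ⟨hε.le.trans (ha.1 k).1, (ha.1 k).2.trans (by linarith)⟩
  calc ENNReal.ofReal (N * (1 - 33 * ε)) ≤
      ENNReal.ofReal ((Real.sqrt N - 2 * ε) ^ 2 - N * (29 * ε)) := by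
        refine ENNReal.ofReal_le_ofReal ?_
        nlinarith [mul_nonneg hε.le (by nlinarith : 0 ≤ (N : ℝ) - Real.sqrt N)]
    _ = ENNReal.ofReal ((Real.sqrt N - 2 * ε) ^ 2) - ENNReal.ofReal (N * (29 * ε)) :=
        ENNReal.ofReal_sub _ (by positivity)
    _ ≤ volume S - volume B := by rw [h3]; exact tsub_le_tsub_left h2 _
    _ ≤ volume (S \ B) := le_measure_sdiff
    _ = boxMeasure N (S \ B) := by
        rw [boxMeasure, Measure.restrict_apply (hSm.diff hBm), Set.inter_eq_self_of_subset_left hsub]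
    _ = ∫⁻ a, (S \ B).indicator 1 a ∂boxMeasure N := (lintegral_indicator_one (hSm.diff hBm)).symm
    _ ≤ _ := lintegral_mono h1

lemma le_lintegral_prod_coreFactor (hε : 0 < ε) (hε1 : 33 * ε ≤ 1) :
    ENNReal.ofReal (N * (1 - 33 * ε)) ^ N ≤ ∫⁻ X, ∏ i, coreFactor N ε i X ∂confMeasure N := by
  have h := prod_le_lintegral_prod (ι := Fin N) (boxMeasure N) (fun i => (i : ℤ))
    (k := fun i => coreFactor N ε i) (c := fun _ => ENNReal.ofReal (N * (1 - 33 * ε)))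
    (fun i => measurable_coreFactor i) ?_ (fun i X => le_lintegral_coreFactor hε hε1 i X)
  · rw [Finset.prod_const, Finset.card_univ, Fintype.card_fin] at h
    exact h
  · intro i j hij hr Y a
    have hij' : i < j := lt_of_le_of_ne (by simpa using hr) hij
    have h1 : ∀ l, l ≤ i → Function.update Y j a l = Y l := fun l hl =>
      Function.update_of_ne (hl.trans_lt hij').ne _ _
    have h2 : (∀ l, l < i → 3 * ε < ‖Y i - Function.update Y j a l‖) ↔
        ∀ l, l < i → 3 * ε < ‖Y i - Y l‖ :=
      forall₂_congr fun l hl => by rw [h1 l hl.le]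
    simp only [coreFactor]
    rw [Set.indicator_eq_indicator]
    · simp only [Set.mem_ofPred_eq, h1 i le_rfl, h2]
    · rfl

lemma lintegral_pairWeight_sub_inset {x : E2}
    (hx : ∀ k, x k ∈ Set.Icc ε (Real.sqrt N - ε)) :
    ∫⁻ z, ENNReal.ofReal (pairWeight β lam ε z) ≤
      ∫⁻ y, ENNReal.ofReal (pairWeight β lam ε (x - y)) ∂boxMeasure N := by
  have hΛ : MeasurableSet (LamBox N) := measurableSet_square _ _
  rw [← lintegral_sub_left_eq_self (fun z => ENNReal.ofReal (pairWeight β lam ε z)) x, boxMeasure,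
    ← lintegral_indicator hΛ]
  refine lintegral_mono fun y => ?_
  simp only
  by_cases h : ‖x - y‖ ≤ ε
  · rw [Set.indicator_of_mem]
    intro k
    have h1 : |x k - y k| ≤ ε := by
      have := PiLp.norm_apply_le (x - y) k
      exact (le_of_eq (by simp)).trans (this.trans h)
    have h2 := abs_le.1 h1
    exact ⟨by linarith [(hx k).1], by linarith [(hx k).2]⟩
  · rw [pairWeight, if_neg h, ENNReal.ofReal_zero]; exact zero_le

lemma le_lintegral_prod_pairWeight (hlam : 0 < lam) {X : Fin N → E2}
    (hX : ∀ i k, X i k ∈ Set.Icc ε (Real.sqrt N - ε)) :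
    (∫⁻ z, ENNReal.ofReal (pairWeight β lam ε z)) ^ N ≤
      ∫⁻ Y, ∏ i, ENNReal.ofReal (pairWeight β lam ε (X i - Y i)) ∂confMeasure N := by
  have hm : ∀ i, Measurable fun Y : Fin N → E2 =>
      ENNReal.ofReal (pairWeight β lam ε (X i - Y i)) := by
    intro i
    have h1 : Measurable fun Y : Fin N → E2 => X i - Y i := by fun_prop
    exact ((measurable_pairWeight β hlam ε).comp h1).ennreal_ofReal
  have h := prod_le_lintegral_prod (ι := Fin N) (boxMeasure N) (fun i => (i : ℤ)) hm
    (c := fun _ => ∫⁻ z, ENNReal.ofReal (pairWeight β lam ε z)) ?_ ?_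
  · rw [Finset.prod_const, Finset.card_univ, Fintype.card_fin] at h
    exact h
  · intro i j hij _ Y a
    simp only [Function.update_of_ne hij]
  · intro i Y
    simp only [Function.update_self]
    exact lintegral_pairWeight_sub_inset (hX i)

lemma le_lintegral_exp_neg_mul_Flam (hβ : 0 ≤ β) (hlam : 0 < lam) (hε : 0 < ε)
    (hε1 : 33 * ε ≤ 1) (N : ℕ) :
    ENNReal.ofReal (N.factorial * ((N * (1 - 33 * ε)) ^ N * (∫ z, pairWeight β lam ε z) ^ N)) ≤
      ∫⁻ p in confSet N, ENNReal.ofReal (Real.exp (-β * Flam N lam p.1 p.2)) := by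
  have hW : 0 ≤ ∫ z, pairWeight β lam ε z := integral_nonneg fun z => pairWeight_nonneg _ _ _ _
  have hε2 : 0 ≤ 1 - 33 * ε := by linarith
  rw [volume_restrict_confSet, ENNReal.ofReal_mul (by positivity), ENNReal.ofReal_natCast,
    ENNReal.ofReal_mul (by positivity), ENNReal.ofReal_pow (by positivity),
    ENNReal.ofReal_pow hW, ← lintegral_pairWeight hβ hlam]
  refine le_trans (mul_le_mul_right ?_ _)
    (factorial_mul_lintegral_dipoleFactor_le (ε := ε) hlam)
  refine le_trans ?_ (lintegral_prod_exp_le_dipoleFactor hlam)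
  refine le_trans ?_ (lintegral_mono fun p => prod_core_mul_pairWeight_le p.1 p.2)
  have hm1 : Measurable fun X : Fin N → E2 => ∏ i, coreFactor N ε i X :=
    Finset.measurable_fun_prod _ fun i _ => measurable_coreFactor i
  have hm2 : Measurable fun p : (Fin N → E2) × (Fin N → E2) =>
      ∏ i, ENNReal.ofReal (pairWeight β lam ε (p.1 i - p.2 i)) := by
    refine Finset.measurable_fun_prod _ fun i _ => ?_
    have h1 : Measurable fun p : (Fin N → E2) × (Fin N → E2) => p.1 i - p.2 i := by fun_prop
    exact ((measurable_pairWeight β hlam ε).comp h1).ennreal_ofReal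
  have hm3 : Measurable fun p : (Fin N → E2) × (Fin N → E2) => (∏ i, coreFactor N ε i p.1) *
      ∏ i, ENNReal.ofReal (pairWeight β lam ε (p.1 i - p.2 i)) := by
    have h1 : Measurable fun p : (Fin N → E2) × (Fin N → E2) => p.1 := measurable_fst
    have h2 := hm1.comp h1
    exact h2.mul hm2
  rw [lintegral_prod _ hm3.aemeasurable]
  refine (mul_le_mul_left (le_lintegral_prod_coreFactor hε hε1) _).trans ?_
  rw [← lintegral_mul_const _ hm1]
  refine lintegral_mono fun X => ?_
  simp only
  have hm4 : Measurable fun Y : Fin N → E2 =>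
      ∏ i, ENNReal.ofReal (pairWeight β lam ε (X i - Y i)) := by
    have h1 : Measurable fun Y : Fin N → E2 => (X, Y) := measurable_prodMk_left
    have h2 := hm2.comp h1
    exact h2
  rw [lintegral_const_mul _ hm4]
  by_cases h : ∀ i k, X i k ∈ Set.Icc ε (Real.sqrt N - ε)
  · exact mul_le_mul_right (le_lintegral_prod_pairWeight hlam h) _
  · push Not at h
    obtain ⟨i, k, hik⟩ := h
    have h0 : ∏ i, coreFactor N ε i X = 0 := Finset.prod_eq_zero (Finset.mem_univ i)
      (Set.indicator_of_notMem (fun h => hik (h.1 k)) _)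
    rw [h0, zero_mul]; exact zero_le

end

/-! ### The free energy expansion -/

lemma Zpart_eq_toReal {N : ℕ} {β lam : ℝ} (hlam : 0 < lam) :
    Zpart N β lam =
      (∫⁻ p in confSet N, ENNReal.ofReal (Real.exp (-β * Flam N lam p.1 p.2))).toReal :=
  integral_eq_lintegral_of_nonneg_ae (Filter.Eventually.of_forall fun _ => (Real.exp_pos _).le)
    (Real.measurable_exp.comp ((measurable_Flam hlam).const_mul _)).aestronglyMeasurable

lemma le_log_factorial (N : ℕ) (hN : 1 ≤ N) :
    N * Real.log N - N ≤ Real.log N.factorial := by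
  have h0 : (0 : ℝ) < N := by exact_mod_cast hN
  have h1 := Real.pow_div_factorial_le_exp (N : ℝ) h0.le N
  have hf : (0 : ℝ) < N.factorial := by exact_mod_cast N.factorial_pos
  have h2 := Real.log_le_log (by positivity) h1
  rw [Real.log_exp, Real.log_div (by positivity) hf.ne', Real.log_pow] at h2
  linarith

lemma log_factorial_le (N : ℕ) (hN : 1 ≤ N) :
    Real.log N.factorial ≤ N * Real.log N - N + Real.log N + 1 := by
  induction N, hN using Nat.le_induction with
  | base => simp
  | succ n hn ih =>
    have h0 : (0 : ℝ) < n := by exact_mod_cast hn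
    have hf : (n.factorial : ℝ) ≠ 0 := by exact_mod_cast n.factorial_ne_zero
    rw [Nat.factorial_succ]
    push_cast
    rw [Real.log_mul (by positivity) hf]
    have h1 : Real.log n - Real.log (n + 1) ≤ -(1 / (n + 1)) := by
      rw [← Real.log_div h0.ne' (by positivity)]
      refine (Real.log_le_sub_one_of_pos (by positivity)).trans (le_of_eq ?_)
      field_simp
      ring
    have h2 := mul_le_mul_of_nonneg_left h1 (by positivity : (0 : ℝ) ≤ n + 1)
    have h3 : ((n : ℝ) + 1) * -(1 / (n + 1)) = -1 := by field_simp
    rw [h3] at h2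
    linarith

lemma abs_log_Zpart_sub_le {β lam T ε I L B K : ℝ} (hβ : 0 ≤ β) (hlam : 0 < lam) (hT : 1 ≤ T)
    (hT6 : 4 * lam ≤ (T ^ 6)⁻¹) (hI0 : 0 < I) (hL : 0 ≤ L)
    (hI : ∫ z, pairWeight β lam (T ^ 6)⁻¹ z ≤ I)
    (hTI : T ^ 2 * (T ^ 6) ^ β ≤ L * (T ^ 2)⁻¹ * I) (hε : 0 < ε) (hε1 : 33 * ε < 1)
    (hW : 0 < ∫ z, pairWeight β lam ε z)
    (hup : Real.log I - B + upperConst β L * (T ^ 2)⁻¹ ≤ K)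
    (hlow : B - Real.log (∫ z, pairWeight β lam ε z) - Real.log (1 - 33 * ε) ≤ K)
    {N : ℕ} (hN : 2 ≤ N) :
    |Real.log (Zpart N β lam) - (2 * N * Real.log N + N * (B - 1))| ≤
      N * K + 3 * Real.log N := by
  have h1 := lintegral_exp_neg_mul_Flam_le hβ hlam hT hT6 hI0.le hL
    ((lintegral_pairWeight hβ hlam _).le.trans (ENNReal.ofReal_le_ofReal hI)) hTI N
  have h2 := le_lintegral_exp_neg_mul_Flam hβ hlam hε hε1.le N
  have hN0 : (0 : ℝ) < N := by positivity
  have hN2 : (2 : ℝ) ≤ N := by exact_mod_cast hN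
  have hf : (0 : ℝ) < N.factorial := by exact_mod_cast N.factorial_pos
  have hε2 : 0 < 1 - 33 * ε := by linarith
  have h3 : Zpart N β lam ≤ N.factorial * (I ^ N * (N : ℝ) ^ N) *
        Real.exp (upperConst β L * (N * (T ^ 2)⁻¹)) := by
    rw [Zpart_eq_toReal hlam]
    exact ENNReal.toReal_le_of_le_ofReal (by positivity) h1
  have h4 : N.factorial * ((N * (1 - 33 * ε)) ^ N * (∫ z, pairWeight β lam ε z) ^ N) ≤
      Zpart N β lam := by
    rw [Zpart_eq_toReal hlam]
    exact (ENNReal.ofReal_le_iff_le_toReal (ne_top_of_le_ne_top ENNReal.ofReal_ne_top h1)).1 h2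
  have hlow0 : 0 < N.factorial * ((N * (1 - 33 * ε)) ^ N * (∫ z, pairWeight β lam ε z) ^ N) := by
    positivity
  have h5 := Real.log_le_log (hlow0.trans_le h4) h3
  have h6 := Real.log_le_log hlow0 h4
  rw [Real.log_mul (by positivity) (by positivity), Real.log_mul hf.ne' (by positivity),
    Real.log_mul (by positivity) (by positivity), Real.log_exp, Real.log_pow, Real.log_pow] at h5
  rw [Real.log_mul hf.ne' (by positivity), Real.log_mul (by positivity) (by positivity),
    Real.log_pow, Real.log_pow, Real.log_mul hN0.ne' hε2.ne'] at h6
  have h7 := le_log_factorial N (by omega)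
  have h8 := log_factorial_le N (by omega)
  have h9 : Real.log 2 ≤ Real.log N := Real.log_le_log two_pos hN2
  have h10 := Real.log_two_gt_d9
  have h11 := mul_le_mul_of_nonneg_left hup hN0.le
  have h12 := mul_le_mul_of_nonneg_left hlow hN0.le
  rw [abs_le]
  constructor <;> linarith

lemma neg_log_one_sub_le {x : ℝ} (hx0 : 0 ≤ x) (hx : x ≤ 1 / 2) : -Real.log (1 - x) ≤ 2 * x := by
  have h1 : 0 < 1 - x := by linarith
  have h2 := Real.one_sub_inv_le_log_of_pos h1
  have h3 : (1 - x)⁻¹ ≤ 1 + 2 * x := by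
    rw [inv_le_iff_one_le_mul₀ h1]; nlinarith
  linarith

lemma rpow_le_omegaL {β lam : ℝ} (hβ : 2 < β) (hlam : 0 < lam) (hlam1 : lam ≤ 1 / 5000) :
    lam ^ (min (β - 2) 2 / 20) ≤ omegaL β lam := by
  have hlam2 : lam ≤ 1 := by linarith
  have hmono : ∀ {s t : ℝ}, t ≤ s → lam ^ s ≤ lam ^ t := fun h =>
    Real.rpow_le_rpow_of_exponent_ge hlam hlam2 h
  rw [omegaL, if_neg hβ.ne']
  split_ifs with h4 h4'
  · refine hmono ?_
    rw [min_eq_left (by linarith), div_le_div_iff₀ (by linarith) (by norm_num)]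
    nlinarith
  · rw [min_eq_right (by linarith)]
    refine (hmono (show (1 : ℝ) / (2 + 36) ≤ 2 / 20 by norm_num)).trans ?_
    refine Real.rpow_le_rpow hlam.le ?_ (by norm_num)
    refine le_mul_of_one_le_right hlam.le ?_
    have h5 : Real.log lam ≤ -1 := by
      rw [Real.log_le_iff_le_exp hlam, Real.exp_neg]
      refine hlam1.trans ?_
      rw [one_div]
      exact inv_anti₀ (Real.exp_pos _) (by linarith [Real.exp_one_lt_d9])
    rw [abs_of_neg (by linarith)]
    linarith
  · rw [min_eq_right (by linarith [not_lt.1 h4])]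
    exact hmono (by norm_num)

lemma exists_abs_log_Zpart_sub_le {β : ℝ} (hβ : 2 < β) :
    ∃ K lam0 : ℝ, 0 < K ∧ 0 < lam0 ∧ lam0 < 1 / 2 ∧ ∀ lam : ℝ, 0 < lam → lam < lam0 →
      ∀ N : ℕ, 2 ≤ N →
        |Real.log (Zpart N β lam) - (2 * N * Real.log N +
          N * ((2 - β) * Real.log lam + Real.log (Zbeta β) - 1))| ≤
        N * (K * omegaL β lam) + 3 * Real.log N := by
  obtain ⟨C, hC, hCW⟩ := exists_le_integral_pairWeight_one hβ
  have hZ := Zbeta_pos hβ.le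
  set D := upperConst β (Zbeta β)⁻¹ with hD
  set C' := C / Zbeta β with hC'
  have hC'0 : 0 < C' := by positivity
  set q := min (β - 2) 2 with hq
  have hq0 : 0 < q := lt_min (by linarith) two_pos
  have hq1 : q ≤ β - 2 := min_le_left _ _
  have hq2 : q ≤ 2 := min_le_right _ _
  have hq3 : (4 + 6 * β) * q ≤ 40 * (β - 2) := by
    rcases le_total (β - 2) 2 with h | h
    · rw [hq, min_eq_left h]; nlinarith
    · rw [hq, min_eq_right h]; linarith
  refine ⟨|D| + 2 * C' + 66, min (1 / 5000) ((2 * C')⁻¹ ^ (4 / (β - 2))), by positivity,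
    lt_min (by norm_num) (by positivity), (min_le_left _ _).trans_lt (by norm_num),
    fun lam hlam hlam0 N hN => ?_⟩
  have hlam1 : lam ≤ 1 / 5000 := (hlam0.trans_le (min_le_left _ _)).le
  have hlam2 : lam ≤ 1 := by linarith
  have hmono : ∀ {s t : ℝ}, t ≤ s → lam ^ s ≤ lam ^ t := fun h =>
    Real.rpow_le_rpow_of_exponent_ge hlam hlam2 h
  have hω := rpow_le_omegaL hβ hlam hlam1
  rw [← hq] at hω
  set T := lam ^ (-(q / 40)) with hT
  have hTn : ∀ n : ℕ, T ^ n = lam ^ (-(q / 40) * n) := fun n => by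
    rw [hT, ← Real.rpow_natCast, ← Real.rpow_mul hlam.le]
  have hT0 : 0 < T := by positivity
  have hT2 : (T ^ 2)⁻¹ = lam ^ (q / 20) := by
    rw [hTn, ← Real.rpow_neg hlam.le]; congr 1; push_cast; ring
  have hT6 : (T ^ 6)⁻¹ = lam ^ (3 * q / 20) := by
    rw [hTn, ← Real.rpow_neg hlam.le]; congr 1; push_cast; ring
  have hs : Real.sqrt lam = lam ^ (1 / 2 : ℝ) := Real.sqrt_eq_rpow lam
  have hs0 : 0 < Real.sqrt lam := Real.sqrt_pos.2 hlam
  have hs1 : Real.sqrt lam ≤ 1 / 66 := by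
    rw [Real.sqrt_le_left (by norm_num)]; linarith
  have hss := Real.mul_self_sqrt hlam.le
  have hx : C' * lam ^ ((β - 2) / 4) ≤ 1 / 2 := by
    have h1 : lam ^ ((β - 2) / 4) ≤ (2 * C')⁻¹ := by
      refine (Real.rpow_le_rpow hlam.le (hlam0.trans_le (min_le_right _ _)).le
        (by linarith)).trans (le_of_eq ?_)
      rw [← Real.rpow_mul (by positivity), div_mul_div_cancel₀ (by linarith), div_self (by norm_num),
        Real.rpow_one]
    refine (mul_le_mul_of_nonneg_left h1 hC'0.le).trans (le_of_eq ?_)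
    field_simp
  have hW1 : lam ^ (2 - β) * (Zbeta β * (1 - C' * lam ^ ((β - 2) / 4))) ≤
      ∫ z, pairWeight β lam (Real.sqrt lam) z := by
    rw [integral_pairWeight_scale β hlam]
    refine mul_le_mul_of_nonneg_left ?_ (by positivity)
    refine le_trans (le_of_eq ?_) (hCW (Real.sqrt lam / lam) (by positivity))
    have h1 : Real.sqrt lam / lam = lam ^ (-(1 / 2) : ℝ) := by
      rw [hs, ← Real.rpow_sub_one hlam.ne']; norm_num
    rw [h1, ← Real.rpow_mul hlam.le, hC']
    have h2 : -(1 / 2) * -((β - 2) / 2) = (β - 2) / 4 := by ring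
    rw [h2]
    field_simp
  have hx1 : 0 < 1 - C' * lam ^ ((β - 2) / 4) := by linarith
  have hW0 : 0 < lam ^ (2 - β) * (Zbeta β * (1 - C' * lam ^ ((β - 2) / 4))) := by positivity
  have hlogW := Real.log_le_log hW0 hW1
  rw [Real.log_mul (by positivity) (by positivity), Real.log_mul hZ.ne' hx1.ne',
    Real.log_rpow hlam] at hlogW
  have h1 := neg_log_one_sub_le (by positivity) hx
  have h2 := neg_log_one_sub_le (x := 33 * Real.sqrt lam) (by positivity) (by linarith)
  have h3 : lam ^ ((β - 2) / 4) ≤ omegaL β lam := (hmono (by linarith)).trans hω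
  have h4 : Real.sqrt lam ≤ omegaL β lam := by
    rw [hs]; exact (hmono (by linarith)).trans hω
  have hω0 : 0 ≤ omegaL β lam := hs0.le.trans h4
  refine abs_log_Zpart_sub_le (T := T) (ε := Real.sqrt lam) (I := lam ^ (2 - β) * Zbeta β)
    (L := (Zbeta β)⁻¹) (by linarith) hlam ?_ ?_ (by positivity) (by positivity) ?_ ?_ hs0
    (by linarith) (hW0.trans_le hW1) ?_ ?_ hN
  · exact Real.one_le_rpow_of_pos_of_le_one_of_nonpos hlam hlam2 (by linarith)
  · rw [hT6]
    refine le_trans ?_ (hmono (show 3 * q / 20 ≤ 1 / 2 by linarith))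
    rw [← hs]
    nlinarith
  · rw [integral_pairWeight_scale β hlam]
    exact mul_le_mul_of_nonneg_left (integral_pairWeight_one_le hβ _) (by positivity)
  · have h5 : (Zbeta β)⁻¹ * (T ^ 2)⁻¹ * (lam ^ (2 - β) * Zbeta β) = (T ^ 2)⁻¹ * lam ^ (2 - β) := by
      field_simp
    rw [h5, hT2, hTn, hTn, ← Real.rpow_mul hlam.le, ← Real.rpow_add hlam, ← Real.rpow_add hlam]
    refine hmono ?_
    push_cast
    linarith
  · rw [Real.log_mul (by positivity) hZ.ne', Real.log_rpow hlam, sub_self, zero_add, hT2]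
    have h6 : D * lam ^ (q / 20) ≤ |D| * omegaL β lam :=
      mul_le_mul (le_abs_self _) hω (by positivity) (abs_nonneg _)
    nlinarith [mul_nonneg hC'0.le hω0]
  · have h7 := mul_le_mul_of_nonneg_left h3 hC'0.le
    nlinarith [mul_nonneg (abs_nonneg D) hω0]

lemma exists_abs_log_Zpart_two_sub_le :
    ∃ K lam0 : ℝ, 0 < K ∧ 0 < lam0 ∧ lam0 < 1 / 2 ∧ ∀ lam : ℝ, 0 < lam → lam < lam0 →
      ∀ N : ℕ, 2 ≤ N →
        |Real.log (Zpart N 2 lam) - (2 * N * Real.log N +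
          N * (Real.log |Real.log lam| + Real.log (Zbeta 2) - 1))| ≤
        N * (K * omegaL 2 lam) + 3 * Real.log N := by
  obtain ⟨C, hC, hCW⟩ := exists_integral_pairWeight_two_le
  have hπ := Real.pi_gt_three
  set D := upperConst 2 1 with hD
  refine ⟨|D| + C + 74, Real.exp (-100), by positivity, Real.exp_pos _, ?_,
    fun lam hlam hlam0 N hN => ?_⟩
  · rw [Real.exp_neg, one_div]
    exact inv_strictAnti₀ two_pos (by linarith [Real.add_one_le_exp (100 : ℝ)])
  have hlog : Real.log lam < -100 := (Real.log_lt_iff_lt_exp hlam).2 hlam0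
  have hZ : Zbeta 2 = 2 * π := if_pos rfl
  obtain ⟨l, hl⟩ : ∃ l, l = -Real.log lam := ⟨_, rfl⟩
  have hl100 : 100 < l := by linarith
  have hl0 : 0 < l := by linarith
  have hl1 : 1 ≤ l := by linarith
  have hlame : lam = Real.exp (-l) := by rw [hl, neg_neg, Real.exp_log hlam]
  have habs : |Real.log lam| = l := by rw [abs_of_neg (by linarith), hl]
  have hω : omegaL 2 lam = l ^ (-(1 : ℝ) / 41) := by
    rw [omegaL, if_pos rfl, habs]; norm_num
  have hmono : ∀ {s t : ℝ}, s ≤ t → l ^ s ≤ l ^ t := fun h =>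
    Real.rpow_le_rpow_of_exponent_le hl1 h
  rw [hω, habs, hZ]
  set w := l ^ (-(1 : ℝ) / 41) with hw
  have hw0 : 0 < w := by positivity
  set T := l ^ (1 / 40 : ℝ) with hT
  have hTn : ∀ n : ℕ, T ^ n = l ^ (1 / 40 * n : ℝ) := fun n => by
    rw [hT, ← Real.rpow_natCast, ← Real.rpow_mul hl0.le]
  have hT1 : 1 ≤ T := Real.one_le_rpow hl1 (by norm_num)
  have hT0 : 0 < T := by positivity
  have hT2 : (T ^ 2)⁻¹ ≤ w := by
    rw [hTn, ← Real.rpow_neg hl0.le]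
    exact hmono (by norm_num)
  have hT6 : T ^ 6 ≤ l := by
    rw [hTn]
    calc l ^ (1 / 40 * (6 : ℕ) : ℝ) ≤ l ^ (1 : ℝ) := hmono (by norm_num)
      _ = l := Real.rpow_one l
  have hT6' : 1 ≤ T ^ 6 := one_le_pow₀ hT1
  have h4lam : 4 * lam ≤ (T ^ 6)⁻¹ := by
    have h1 : 4 * l ≤ Real.exp l := by
      have := Real.quadratic_le_exp_of_nonneg hl0.le
      nlinarith
    refine le_trans ?_ (inv_anti₀ (by positivity) hT6)
    rw [hlame, Real.exp_neg, ← div_eq_mul_inv, div_le_iff₀ (Real.exp_pos _), inv_mul_eq_div,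
      le_div_iff₀ hl0]
    exact h1
  have hinv : l⁻¹ ≤ w := by
    rw [← Real.rpow_neg_one]; exact hmono (by norm_num)
  have hsq : (Real.sqrt l)⁻¹ ≤ w := by
    rw [Real.sqrt_eq_rpow, ← Real.rpow_neg hl0.le]; exact hmono (by norm_num)
  have hs10 : 10 ≤ Real.sqrt l := Real.le_sqrt_of_sq_le (by linarith)
  have hss := Real.mul_self_sqrt hl0.le
  have hll : Real.log l ≤ 2 * Real.sqrt l - 2 := by
    have h1 := Real.log_le_sub_one_of_pos (show 0 < Real.sqrt l by linarith)
    rw [Real.log_sqrt hl0.le] at h1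
    linarith
  set x := 2 * (Real.sqrt l)⁻¹ with hx
  have hx0 : 0 ≤ x := by positivity
  have hx1 : x ≤ 1 / 2 := by
    have : (Real.sqrt l)⁻¹ ≤ 10⁻¹ := inv_anti₀ (by norm_num) hs10
    rw [hx]; linarith
  have hxl : l * (1 - x) = l - 2 * Real.sqrt l := by
    have : l * (Real.sqrt l)⁻¹ = Real.sqrt l := by
      rw [← div_eq_mul_inv, Real.div_sqrt]
    rw [hx, mul_sub, mul_one, mul_left_comm, this]
  have hW1 : 2 * π * (l * (1 - x)) ≤ ∫ z, pairWeight 2 lam l⁻¹ z := by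
    rw [integral_pairWeight_scale 2 hlam, sub_self, Real.rpow_zero, one_mul]
    refine le_trans ?_ (le_integral_pairWeight_two (R := l⁻¹ / lam) (by positivity))
    rw [Real.log_div (by positivity) hlam.ne', Real.log_inv, hxl]
    gcongr 2 * π * ?_
    linarith
  have hx2 : 0 < 1 - x := by linarith
  have hW0 : 0 < 2 * π * (l * (1 - x)) := by positivity
  have hlogW := Real.log_le_log hW0 hW1
  rw [Real.log_mul (by positivity) (by positivity), Real.log_mul hl0.ne' hx2.ne'] at hlogW
  have hl100' : l⁻¹ ≤ 100⁻¹ := inv_anti₀ (by norm_num) hl100.le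
  have h1 := neg_log_one_sub_le hx0 hx1
  have h2 := neg_log_one_sub_le (x := 33 * l⁻¹) (by positivity) (by linarith)
  refine abs_log_Zpart_sub_le (T := T) (ε := l⁻¹) (I := 2 * π * (l + C)) (L := 1) zero_le_two hlam
    hT1 h4lam (by positivity) zero_le_one ?_ ?_ (by positivity) (by linarith) (hW0.trans_le hW1)
    ?_ ?_ hN
  · rw [integral_pairWeight_scale 2 hlam, sub_self, Real.rpow_zero, one_mul]
    refine (hCW _ ?_).trans ?_
    · rw [le_div_iff₀ hlam]; linarith
    · rw [Real.log_div (by positivity) hlam.ne', Real.log_inv]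
      have h3 : 0 ≤ Real.log (T ^ 6) := Real.log_nonneg hT6'
      gcongr 2 * π * ?_
      linarith
  · rw [one_mul, Real.rpow_two, ← div_eq_inv_mul, le_div_iff₀ (by positivity)]
    have h3 : T ^ 2 * (T ^ 6) ^ 2 * T ^ 2 = T ^ 16 := by ring
    have h4 : T ^ 16 ≤ l := by
      rw [hTn]
      calc l ^ (1 / 40 * (16 : ℕ) : ℝ) ≤ l ^ (1 : ℝ) := hmono (by norm_num)
        _ = l := Real.rpow_one l
    rw [h3]
    nlinarith
  · have h3 : Real.log (l + C) ≤ Real.log l + C * l⁻¹ := by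
      have h4 := Real.log_le_sub_one_of_pos (show 0 < (l + C) / l by positivity)
      rw [Real.log_div (by positivity) hl0.ne'] at h4
      have h5 : (l + C) / l - 1 = C * l⁻¹ := by field_simp; ring
      linarith
    rw [Real.log_mul (by positivity) (by positivity)]
    have h6 : D * (T ^ 2)⁻¹ ≤ |D| * w :=
      mul_le_mul (le_abs_self _) hT2 (by positivity) (abs_nonneg _)
    have h7 := mul_le_mul_of_nonneg_left hinv hC.le
    linarith
  · have h8 : 0 ≤ (|D| + C) * w := by positivity
    linarith

/-- Free energy expansion for the two-component plasma (Theorem 1, item (1)). -/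
theorem statement0 (β : ℝ) (hβ : 2 ≤ β) :
    ∃ C lam0 : ℝ, 0 < C ∧ 0 < lam0 ∧ lam0 < 1/2 ∧
      ∀ lam : ℝ, 0 < lam → lam < lam0 → ∀ N : ℕ, 2 ≤ N →
        |Real.log (Zpart N β lam) -
            (2 * N * Real.log N +
              N * ((if 2 < β then (2 - β) * Real.log lam else 0) +
                   (if β = 2 then Real.log |Real.log lam| else 0) +
                   Real.log (Zbeta β) - 1))| ≤
          C * (N * omegaL β lam + Real.log N) := by
  have hω : ∀ lam : ℝ, 0 < lam → 0 ≤ omegaL β lam := by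
    intro lam hlam
    unfold omegaL
    split_ifs <;> positivity
  have key : ∀ K lam : ℝ, 0 < lam → 0 < K → ∀ N : ℕ, 2 ≤ N →
      N * (K * omegaL β lam) + 3 * Real.log N ≤
        (K + 3) * (N * omegaL β lam + Real.log N) := by
    intro K lam hlam hK N hN
    have h1 : 0 ≤ N * omegaL β lam := mul_nonneg N.cast_nonneg (hω lam hlam)
    have h2 : 0 ≤ Real.log N := Real.log_natCast_nonneg N
    nlinarith [mul_nonneg hK.le h2]
  rcases hβ.eq_or_lt with rfl | hlt
  · obtain ⟨K, lam0, hK, h0, h12, H⟩ := exists_abs_log_Zpart_two_sub_le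
    refine ⟨K + 3, lam0, by positivity, h0, h12, fun lam hlam hlt N hN => ?_⟩
    rw [if_neg (lt_irrefl _), if_pos rfl, zero_add]
    exact (H lam hlam hlt N hN).trans (key K lam hlam hK N hN)
  · obtain ⟨K, lam0, hK, h0, h12, H⟩ := exists_abs_log_Zpart_sub_le hlt
    refine ⟨K + 3, lam0, by positivity, h0, h12, fun lam hlam hlam0 N hN => ?_⟩
    rw [if_pos hlt, if_neg hlt.ne', add_zero]
    exact (H lam hlam hlam0 N hN).trans (key K lam hlam hK N hN)
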